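/- Let γ > 0, let U ⊆ ℝ^N be open, and let u ∈ C(U) ∩ 𝓛_α be nonnegative on ℝ^N. Then u is a solution of Δ^{α/2}u = u^γ in U if and only if for every a ∈ ℝ^N and r > 0 with the closed ball of center a and radius r contained in U, one has u(x) + ∫_{B(a,r)} G_{B(a,r)}^α(x,y) u(y)^γ dy = H_{B(a,r)}^α u(x) for every x ∈ B(a,r). -/

import Mathlib

open MeasureTheory Real Filter Topology Metric Set

noncomputable section

abbrev EN (N : ℕ) := EuclideanSpace ℝ (Fin N)

/-- The normalizing constant `c_{N,α}` of the fractional Laplacian. -/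
def fracLapCoeff (N : ℕ) (α : ℝ) : ℝ :=
  2 ^ α * Real.pi ^ (-(N : ℝ) / 2) * Real.Gamma (((N : ℝ) + α) / 2) / |Real.Gamma (-α / 2)|

/-- `HasFracLap N α u x L` means the principal-value limit defining `Δ^{α/2} u (x)` exists
and equals `L`. -/
def HasFracLap (N : ℕ) (α : ℝ) (u : EN N → ℝ) (x : EN N) (L : ℝ) : Prop :=
  Tendsto (fun ε : ℝ =>
      fracLapCoeff N α * ∫ y in {y : EN N | ε < dist y x}, (u y - u x) / dist y x ^ ((N : ℝ) + α))
    (𝓝[>] (0 : ℝ)) (𝓝 L)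

/-- The value of the fractional Laplacian at `x` (junk value `0` where the limit fails). -/
def fracLap (N : ℕ) (α : ℝ) (u : EN N → ℝ) (x : EN N) : ℝ :=
  haveI := Classical.propDecidable (∃ L, HasFracLap N α u x L)
  if h : ∃ L, HasFracLap N α u x L then h.choose else 0

/-- The weighted space `𝓛_α`. -/
def memLalpha (N : ℕ) (α : ℝ) (u : EN N → ℝ) : Prop :=
  Integrable (fun y : EN N => u y * (1 + ‖y‖) ^ (-((N : ℝ) + α)))

/-- `δ(x) = 1 - |x|` on the unit ball, `0` outside. -/
def delta1 {N : ℕ} (x : EN N) : ℝ := if ‖x‖ < 1 then 1 - ‖x‖ else 0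

/-- The constant `κ_{N,α}`. -/
def greenCoeff (N : ℕ) (α : ℝ) : ℝ :=
  Real.Gamma ((N : ℝ) / 2) / (2 ^ α * Real.pi ^ ((N : ℝ) / 2) * Real.Gamma (α / 2) ^ 2)

/-- The Green function of the unit ball. -/
def greenB (N : ℕ) (α : ℝ) (x y : EN N) : ℝ :=
  if ‖x‖ < 1 ∧ ‖y‖ < 1 then
    greenCoeff N α * ‖x - y‖ ^ (α - (N : ℝ)) *
      ∫ s in (0:ℝ)..((1 - ‖x‖ ^ 2) * (1 - ‖y‖ ^ 2) / ‖x - y‖ ^ 2),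
        s ^ (α / 2 - 1) * (1 + s) ^ (-(N : ℝ) / 2)
  else 0

/-- The Green function of the ball `B(a,r)`, by scaling. -/
def greenBall (N : ℕ) (α : ℝ) (a : EN N) (r : ℝ) (x y : EN N) : ℝ :=
  r ^ (α - (N : ℝ)) * greenB N α (r⁻¹ • (x - a)) (r⁻¹ • (y - a))

/-- The constant `c_α^N` of the Poisson kernel. -/
def poissonCoeff (N : ℕ) (α : ℝ) : ℝ :=
  Real.pi ^ (-1 - (N : ℝ) / 2) * Real.Gamma ((N : ℝ) / 2) * Real.sin (Real.pi * α / 2)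

/-- The Poisson kernel of the ball `B(a,r)`. -/
def poissonBall (N : ℕ) (α : ℝ) (a : EN N) (r : ℝ) (x y : EN N) : ℝ :=
  poissonCoeff N α * ((r ^ 2 - ‖x - a‖ ^ 2) / (‖y - a‖ ^ 2 - r ^ 2)) ^ (α / 2) *
    ‖x - y‖ ^ (-(N : ℝ))

/-- The harmonic-measure operator `H^α_{B(a,r)} f`. -/
def Hball (N : ℕ) (α : ℝ) (a : EN N) (r : ℝ) (f : EN N → ℝ) (x : EN N) : ℝ :=
  ∫ y in {y : EN N | r < ‖y - a‖}, poissonBall N α a r x y * f y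

/-- Solution (in the distributional sense) of `Δ^{α/2} u = u^γ` in the open set `U`. -/
def IsSolution (N : ℕ) (α γ : ℝ) (U : Set (EN N)) (u : EN N → ℝ) : Prop :=
  (∀ x, 0 ≤ u x) ∧ ContinuousOn u U ∧ memLalpha N α u ∧
    ∀ φ : EN N → ℝ, ContDiff ℝ (⊤ : ℕ∞) φ → HasCompactSupport φ → tsupport φ ⊆ U →
      (∀ x, 0 ≤ φ x) →
        ∫ x, u x * fracLap N α φ x = ∫ x, u x ^ γ * φ x

/-- The surface measure `σ` on the unit sphere. -/
def sphereMeasure (N : ℕ) : Measure (Metric.sphere (0 : EN N) 1) :=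
  (volume : Measure (EN N)).toSphere

/-- The Martin integral `M_B^α g`. -/
def martinB (N : ℕ) (α : ℝ) (g : Metric.sphere (0 : EN N) 1 → ℝ) (x : EN N) : ℝ :=
  if ‖x‖ < 1 then
    ∫ y, (1 - ‖x‖ ^ 2) ^ (α / 2) * ‖x - (y : EN N)‖ ^ (-(N : ℝ)) * g y ∂(sphereMeasure N)
  else 0

/-- Solution of the moderate blow-up problem `(P_g)`. -/
def IsSolutionPg (N : ℕ) (α γ : ℝ) (g : Metric.sphere (0 : EN N) 1 → ℝ) (u : EN N → ℝ) : Prop :=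
  (∀ x, 0 ≤ u x) ∧ memLalpha N α u ∧ (∀ x : EN N, ¬ ‖x‖ < 1 → u x = 0) ∧
    IsSolution N α γ (Metric.ball (0 : EN N) 1) u ∧
    ∀ z : Metric.sphere (0 : EN N) 1,
      Tendsto (fun x => delta1 x ^ (1 - α / 2) * u x)
        (𝓝[Metric.ball (0 : EN N) 1] (z : EN N)) (𝓝 (g z))

/-- Solution of the blow-up problem `(P_∞)`. -/
def IsSolutionPinf (N : ℕ) (α γ : ℝ) (u : EN N → ℝ) : Prop :=
  (∀ x, 0 ≤ u x) ∧ memLalpha N α u ∧ (∀ x : EN N, ¬ ‖x‖ < 1 → u x = 0) ∧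
    IsSolution N α γ (Metric.ball (0 : EN N) 1) u ∧
    ∀ z : Metric.sphere (0 : EN N) 1,
      Tendsto (fun x => delta1 x ^ (1 - α / 2) * u x)
        (𝓝[Metric.ball (0 : EN N) 1] (z : EN N)) atTop

section Helpers

open scoped ENNReal

open scoped ENNReal BoundedContinuousFunction

lemma lint_of_integral {β : Type*} [MeasurableSpace β] {μ : Measure β} {f : β → ℝ} {c : ℝ}
    (hf0 : 0 ≤ᵐ[μ] f) (h : ∫ x, f x ∂μ = c) (hc : 0 < c) :
    ∫⁻ x, ENNReal.ofReal (f x) ∂μ = ENNReal.ofReal c := by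
  have hi : Integrable f μ := by
    by_contra hn
    rw [integral_undef hn] at h
    exact hc.ne h
  rw [← ofReal_integral_eq_lintegral_ofReal hi hf0, h]

lemma lint_gamma {a b : ℝ} (ha : 0 < a) (hb : 0 < b) :
    ∫⁻ t in Ioi (0:ℝ), ENNReal.ofReal (t ^ (a - 1) * exp (-(b * t)))
      = ENNReal.ofReal (Gamma a * b ^ (-a)) := by
  apply lint_of_integral
  · refine (ae_restrict_iff' measurableSet_Ioi).2 (ae_of_all _ fun t ht => ?_)
    have : (0:ℝ) < t := ht
    positivity
  · rw [integral_rpow_mul_exp_neg_mul_Ioi ha hb, one_div, inv_rpow hb.le, rpow_neg hb.le]; ring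
  · have := Gamma_pos_of_pos ha
    positivity

lemma lint_gauss {N : ℕ} {s t : ℝ} (hs : 0 < s) (ht : 0 < t) (x : EN N) :
    ∫⁻ y : EN N, ENNReal.ofReal (exp (-(s * ‖y - x‖ ^ 2)) * exp (-(t * ‖y‖ ^ 2)))
      = ENNReal.ofReal ((π / (s + t)) ^ ((N:ℝ) / 2) * exp (-(s * t / (s + t) * ‖x‖ ^ 2))) := by
  have hst : 0 < s + t := by positivity
  apply lint_of_integral
  · exact ae_of_all _ fun y => by positivity
  · have key : ∀ y : EN N, exp (-(s * ‖y - x‖ ^ 2)) * exp (-(t * ‖y‖ ^ 2))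
        = exp (-(s + t) * ‖y - (s / (s + t)) • x‖ ^ 2) * exp (-(s * t / (s + t) * ‖x‖ ^ 2)) := by
      intro y
      rw [← Real.exp_add, ← Real.exp_add]
      congr 1
      rw [@norm_sub_sq_real, @norm_sub_sq_real, inner_smul_right, norm_smul, mul_pow,
        Real.norm_eq_abs, sq_abs]
      field_simp
      ring
    simp_rw [key]
    rw [integral_mul_const, integral_sub_right_eq_self (fun y : EN N => exp (-(s + t) * ‖y‖ ^ 2)),
      GaussianFourier.integral_rexp_neg_mul_sq_norm hst]
    simp
  · positivity

lemma lint_inv {t : ℝ} (ht : 0 < t) (f : ℝ → ℝ≥0∞) :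
    ∫⁻ τ in Ioi (0:ℝ), f τ = ∫⁻ v in Ioi (0:ℝ), ENNReal.ofReal (t / v ^ 2) * f (t / v) := by
  have him : (fun v : ℝ => t / v) '' Ioi 0 = Ioi 0 := by
    ext y
    constructor
    · rintro ⟨v, hv, rfl⟩
      exact div_pos ht hv
    · intro hy
      refine ⟨t / y, div_pos ht hy, ?_⟩
      have : y ≠ 0 := ne_of_gt hy
      field_simp
  conv_lhs => rw [← him]
  rw [lintegral_image_eq_lintegral_abs_deriv_mul (f' := fun v => -(t / v ^ 2)) measurableSet_Ioi]
  · refine setLIntegral_congr_fun measurableSet_Ioi fun v hv => ?_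
    have : (0:ℝ) < v := hv
    simp only [abs_neg]
    rw [abs_of_pos (by positivity)]
  · intro v hv
    have hv0 : v ≠ 0 := ne_of_gt hv
    have := ((hasDerivAt_inv hv0).const_mul t).hasDerivWithinAt (s := Ioi 0)
    have h2 : -(t / v ^ 2) = t * -(v ^ 2)⁻¹ := by ring
    rw [h2]
    simpa only [div_eq_mul_inv] using this
  · intro v hv w hw h
    have hv0 : v ≠ 0 := ne_of_gt hv
    have hw0 : w ≠ 0 := ne_of_gt hw
    field_simp at h
    simpa using h.symm

lemma lint_expIoi {t : ℝ} (ht : 0 < t) (c : ℝ) :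
    ∫⁻ s in Ioi c, ENNReal.ofReal (exp (-(t * s))) = ENNReal.ofReal (t⁻¹ * exp (-(t * c))) := by
  apply lint_of_integral
  · exact ae_of_all _ fun y => by positivity
  · have := integral_exp_mul_Ioi (a := -t) (by linarith) c
    simp only [neg_mul] at this
    rw [this]
    field_simp
  · positivity

def lapG : ℝ →ᵇ ℝ := BoundedContinuousFunction.ofNormedAddCommGroup
  (fun s => exp (-(max s 0)) + (1 - exp (min s 0))) (by fun_prop) 2 (by
    intro s
    have h1 : exp (-(max s 0)) ≤ 1 := by
      rw [Real.exp_le_one_iff]; simp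
    have h2 : exp (min s 0) ≤ 1 := by
      rw [Real.exp_le_one_iff]; simp
    have h3 := Real.exp_pos (-(max s 0))
    have h4 := Real.exp_pos (min s 0)
    rw [Real.norm_eq_abs, abs_le]; constructor <;> linarith)

lemma lapG_pos {s : ℝ} (hs : 0 < s) : lapG s = exp (-s) := by
  simp [lapG, max_eq_left hs.le, min_eq_right hs.le]

lemma lapG_inj : Function.Injective lapG := by
  have : StrictAnti (fun s : ℝ => exp (-(max s 0)) + (1 - exp (min s 0))) := by
    intro a b hab
    simp only
    rcases le_or_gt b 0 with hb | hb
    · have ha : a ≤ 0 := by linarith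
      rw [max_eq_right ha, max_eq_right hb, min_eq_left ha, min_eq_left hb]
      have := Real.exp_lt_exp.2 hab
      linarith
    · rcases le_or_gt a 0 with ha | ha
      · rw [max_eq_right ha, max_eq_left hb.le, min_eq_left ha, min_eq_right hb.le]
        have h1 : exp (-b) < exp (-0) := Real.exp_lt_exp.2 (by linarith)
        have h2 : exp a ≤ exp 0 := Real.exp_le_exp.2 ha
        linarith
      · rw [max_eq_left ha.le, max_eq_left hb.le, min_eq_right ha.le, min_eq_right hb.le]
        have h1 : exp (-b) < exp (-a) := Real.exp_lt_exp.2 (by linarith)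
        linarith
  exact this.injective

def lapA : StarSubalgebra ℝ (ℝ →ᵇ ℝ) :=
  { Algebra.adjoin ℝ {lapG} with
    star_mem' := by
      intro a ha
      have : star a = a := by ext; simp
      rw [this]; exact ha }

lemma laplace_measure_ext {μ ν : Measure ℝ} [IsFiniteMeasure μ] [IsFiniteMeasure ν]
    (h : ∀ n : ℕ, ∫ s, lapG s ^ n ∂μ = ∫ s, lapG s ^ n ∂ν) : μ = ν := by
  refine ext_of_forall_mem_subalgebra_integral_eq_of_polish (𝕜 := ℝ) (A := lapA) ?_ ?_
  · intro x y hxy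
    refine ⟨lapG, ⟨lapG.toContinuousMap, ?_, rfl⟩, fun hh => hxy (lapG_inj hh)⟩
    refine ⟨lapG, ?_, rfl⟩
    exact Algebra.subset_adjoin (s := {lapG}) rfl
  · intro g hg
    have hg' : g ∈ Algebra.adjoin ℝ {lapG} := hg
    rw [Algebra.adjoin_singleton_eq_range_aeval] at hg'
    obtain ⟨p, rfl⟩ := hg'
    induction p using Polynomial.induction_on' with
    | add p q hp hq =>
      have hp := hp (by change _ ∈ Algebra.adjoin ℝ {lapG}; rw [Algebra.adjoin_singleton_eq_range_aeval]; exact ⟨p, rfl⟩)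
      have hq := hq (by change _ ∈ Algebra.adjoin ℝ {lapG}; rw [Algebra.adjoin_singleton_eq_range_aeval]; exact ⟨q, rfl⟩)
      simp only [map_add, BoundedContinuousFunction.coe_add, Pi.add_apply] at hp hq ⊢
      rw [integral_add (BoundedContinuousFunction.integrable _ _) (BoundedContinuousFunction.integrable _ _),
        integral_add (BoundedContinuousFunction.integrable _ _) (BoundedContinuousFunction.integrable _ _)]
      exact congrArg₂ _ hp hq
    | monomial n a =>
      have : ∀ s, (Polynomial.aeval lapG (Polynomial.monomial n a)) s = a * lapG s ^ n := by
        intro s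
        simp [Polynomial.aeval_monomial, Algebra.algebraMap_eq_smul_one]
      simp only [AlgHom.toRingHom_eq_coe, RingHom.coe_coe, this, integral_const_mul, h]

lemma laplace_uniq {Φ Ψ : ℝ → ℝ≥0∞} (hΦ : Measurable Φ) (hΨ : Measurable Ψ)
    (h : ∀ t : ℝ, 0 < t → ∫⁻ s in Ioi (0:ℝ), Φ s * ENNReal.ofReal (exp (-(t * s)))
      = ∫⁻ s in Ioi (0:ℝ), Ψ s * ENNReal.ofReal (exp (-(t * s))))
    (hfin : ∫⁻ s in Ioi (0:ℝ), Φ s * ENNReal.ofReal (exp (-(1 * s))) ≠ ∞) :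
    Φ =ᵐ[volume.restrict (Ioi 0)] Ψ := by
  set e : ℝ → ℝ≥0∞ := fun s => ENNReal.ofReal (exp (-(1 * s))) with he
  have hem : Measurable e := by fun_prop
  have hfin' : ∫⁻ s in Ioi (0:ℝ), Ψ s * e s ≠ ∞ := by rw [← h 1 one_pos]; exact hfin
  have aux : ∀ Θ : ℝ → ℝ≥0∞, Measurable Θ → ∀ n : ℕ,
      ∫ s, lapG s ^ n ∂((volume.restrict (Ioi 0)).withDensity (Θ * e))
        = (∫⁻ s in Ioi (0:ℝ), Θ s * ENNReal.ofReal (exp (-((n + 1 : ℝ) * s)))).toReal := by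
    intro Θ hΘ n
    have hac : (volume.restrict (Ioi 0)).withDensity (Θ * e) ≪ volume.restrict (Ioi 0) :=
      withDensity_absolutelyContinuous _ _
    have hae : ∀ᵐ s ∂((volume.restrict (Ioi 0)).withDensity (Θ * e)), (0:ℝ) < s := by
      apply hac.ae_le
      exact ae_restrict_mem measurableSet_Ioi
    rw [integral_eq_lintegral_of_nonneg_ae, lintegral_withDensity_eq_lintegral_mul _ (hΘ.mul hem)]
    · congr 1
      refine setLIntegral_congr_fun measurableSet_Ioi fun s hs => ?_
      have hs : 0 < s := hs
      simp only [Pi.mul_apply, lapG_pos hs, he]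
      rw [mul_assoc, ← ENNReal.ofReal_mul (by positivity), ← Real.exp_nat_mul, ← Real.exp_add]
      congr 3
      ring
    · have := lapG.continuous.measurable
      fun_prop
    · filter_upwards [hae] with s hs
      rw [lapG_pos hs]
      positivity
    · have := lapG.continuous.measurable
      exact (this.pow_const n).aestronglyMeasurable
  have : IsFiniteMeasure ((volume.restrict (Ioi 0)).withDensity (Φ * e)) :=
    isFiniteMeasure_withDensity hfin
  have : IsFiniteMeasure ((volume.restrict (Ioi 0)).withDensity (Ψ * e)) :=
    isFiniteMeasure_withDensity hfin'
  have heq := laplace_measure_ext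
    (μ := (volume.restrict (Ioi 0)).withDensity (Φ * e))
    (ν := (volume.restrict (Ioi 0)).withDensity (Ψ * e)) (by
      intro n
      rw [aux Φ hΦ, aux Ψ hΨ, h _ (by positivity)])
  rw [withDensity_eq_iff (hΦ.mul hem).aemeasurable (hΨ.mul hem).aemeasurable hfin] at heq
  filter_upwards [heq] with s hs
  have h0 : e s ≠ 0 := by simp only [he]; simp [Real.exp_pos]
  have h1 : e s ≠ ∞ := by simp [he]
  exact (ENNReal.mul_left_inj h0 h1).1 hs

lemma lint_scale {N : ℕ} {r : ℝ} (hr : 0 < r) (a : EN N) (f : EN N → ℝ≥0∞) :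
    ∫⁻ z, f z = ENNReal.ofReal (r ^ N) * ∫⁻ z, f (a + r • z) := by
  rw [← lintegral_add_left_eq_self f a]
  let e : EN N ≃ᵐ EN N := (Homeomorph.smulOfNeZero r hr.ne').toMeasurableEquiv
  have h1 : ∫⁻ z, f (a + r • z) = ∫⁻ z, f (a + z) ∂(Measure.map (fun z : EN N => r • z) volume) := by
    exact (lintegral_map_equiv (fun z => f (a + z)) e).symm
  rw [h1, Measure.map_addHaar_smul _ hr.ne', lintegral_smul_measure, smul_eq_mul, ← mul_assoc,
    ← ENNReal.ofReal_mul (by positivity)]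
  simp only [finrank_euclideanSpace, Fintype.card_fin]
  rw [abs_of_pos (by positivity), mul_inv_cancel₀ (by positivity)]
  simp

lemma lint_beta {p q : ℝ} (hp : 0 < p) (hq : 0 < q) :
    ∫⁻ v in Ioi (0:ℝ), ENNReal.ofReal (v ^ (p - 1) * (1 + v) ^ (-(p + q)))
      = ENNReal.ofReal (Gamma p * Gamma q / Gamma (p + q)) := by
  have hG := Gamma_pos_of_pos (add_pos hp hq)
  have h1 : ∀ v ∈ Ioi (0:ℝ), ENNReal.ofReal (v ^ (p - 1) * (1 + v) ^ (-(p + q)))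
      = ∫⁻ τ in Ioi (0:ℝ), ENNReal.ofReal (1 / Gamma (p + q)) *
        ENNReal.ofReal (v ^ (p - 1) * exp (-(τ * v)) * (τ ^ (p + q - 1) * exp (-τ))) := by
    intro v hv
    have hv : 0 < v := hv
    rw [lintegral_const_mul _ (by fun_prop)]
    have : ∀ τ : ℝ, ENNReal.ofReal (v ^ (p - 1) * exp (-(τ * v)) * (τ ^ (p + q - 1) * exp (-τ)))
        = ENNReal.ofReal (v ^ (p - 1)) * ENNReal.ofReal (τ ^ (p + q - 1) * exp (-((1 + v) * τ))) := by
      intro τ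
      rw [← ENNReal.ofReal_mul (by positivity)]
      congr 1
      have : exp (-((1 + v) * τ)) = exp (-(τ * v)) * exp (-τ) := by
        rw [← Real.exp_add]; congr 1; ring
      rw [this]; ring
    simp_rw [this]
    rw [lintegral_const_mul _ (by fun_prop), lint_gamma (by positivity) (by positivity),
      ← ENNReal.ofReal_mul (by positivity), ← ENNReal.ofReal_mul (by positivity)]
    congr 1
    field_simp
  rw [setLIntegral_congr_fun measurableSet_Ioi h1, lintegral_lintegral_swap (by fun_prop)]
  have h2 : ∀ τ ∈ Ioi (0:ℝ), ∫⁻ v in Ioi (0:ℝ), ENNReal.ofReal (1 / Gamma (p + q)) *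
        ENNReal.ofReal (v ^ (p - 1) * exp (-(τ * v)) * (τ ^ (p + q - 1) * exp (-τ)))
      = ENNReal.ofReal (Gamma p / Gamma (p + q)) * ENNReal.ofReal (τ ^ (q - 1) * exp (-(1 * τ))) := by
    intro τ hτ
    have hτ : 0 < τ := hτ
    have : ∀ v : ℝ, ENNReal.ofReal (v ^ (p - 1) * exp (-(τ * v)) * (τ ^ (p + q - 1) * exp (-τ)))
        = ENNReal.ofReal (v ^ (p - 1) * exp (-(τ * v))) * ENNReal.ofReal (τ ^ (p + q - 1) * exp (-τ)) := by
      intro v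
      rw [ENNReal.ofReal_mul' (by positivity)]
    simp_rw [this]
    have hGp := Gamma_pos_of_pos hp
    rw [lintegral_const_mul _ (by fun_prop), lintegral_mul_const _ (by fun_prop),
      lint_gamma hp hτ, ← ENNReal.ofReal_mul (by positivity), ← ENNReal.ofReal_mul (by positivity),
      ← ENNReal.ofReal_mul (by positivity)]
    congr 1
    have : τ ^ (q - 1) = τ ^ (-p) * τ ^ (p + q - 1) := by
      rw [← Real.rpow_add hτ]; congr 1; ring
    rw [this, one_mul]
    ring
  have hGp := Gamma_pos_of_pos hp
  have hGq := Gamma_pos_of_pos hq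
  rw [setLIntegral_congr_fun measurableSet_Ioi h2, lintegral_const_mul _ (by fun_prop),
    lint_gamma hq one_pos, ← ENNReal.ofReal_mul (by positivity)]
  congr 1
  simp
  ring

def gdens (N : ℕ) (α v : ℝ) : ℝ := v ^ (α / 2 - 1) * (1 + v) ^ (-(N : ℝ) / 2)

lemma gdens_meas (N : ℕ) (α : ℝ) : Measurable (gdens N α) := by
  unfold gdens; fun_prop

lemma gdens_nonneg (N : ℕ) (α : ℝ) {v : ℝ} (hv : 0 ≤ v) : 0 ≤ gdens N α v := by
  unfold gdens; positivity

def betaC (N : ℕ) (α : ℝ) : ℝ := Gamma (α / 2) * Gamma (((N:ℝ) - α) / 2) / Gamma ((N:ℝ) / 2)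

lemma lint_gdens {N : ℕ} {α : ℝ} (h0 : 0 < α) (hN : α < N) :
    ∫⁻ v in Ioi (0:ℝ), ENNReal.ofReal (gdens N α v) = ENNReal.ofReal (betaC N α) := by
  have := lint_beta (p := α / 2) (q := ((N:ℝ) - α) / 2) (by linarith) (by linarith)
  unfold gdens betaC
  convert this using 5
  · ring
  · congr 1; ring

def PhiE (N : ℕ) (α : ℝ) (η : EN N) (s : ℝ) : ℝ≥0∞ :=
  ∫⁻ ζ : EN N, (if ‖ζ‖ ^ 2 < s then ENNReal.ofReal ((s - ‖ζ‖ ^ 2) ^ (-(α / 2))) else 0) *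
    ENNReal.ofReal (‖ζ - η‖ ^ (α - (N:ℝ)))

def equC (N : ℕ) (α : ℝ) : ℝ := Gamma (1 - α / 2) * π ^ ((N:ℝ) / 2) / Gamma (((N:ℝ) - α) / 2)

def PsiE (N : ℕ) (α : ℝ) (η : EN N) (s : ℝ) : ℝ≥0∞ :=
  ENNReal.ofReal (equC N α) *
    ∫⁻ v in Ioi (0:ℝ), if ‖η‖ ^ 2 < s * (1 + v) then ENNReal.ofReal (gdens N α v) else 0

lemma PhiE_meas (N : ℕ) (α : ℝ) : Measurable (fun p : EN N × ℝ => PhiE N α p.1 p.2) := by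
  unfold PhiE
  apply Measurable.lintegral_prod_right' (f := fun q : (EN N × ℝ) × EN N =>
    (if ‖q.2‖ ^ 2 < q.1.2 then ENNReal.ofReal ((q.1.2 - ‖q.2‖ ^ 2) ^ (-(α / 2))) else 0) *
    ENNReal.ofReal (‖q.2 - q.1.1‖ ^ (α - (N:ℝ))))
  refine Measurable.mul (Measurable.ite ?_ (by fun_prop) (by fun_prop)) (by fun_prop)
  exact measurableSet_lt (by fun_prop) (by fun_prop)

lemma PsiE_meas (N : ℕ) (α : ℝ) : Measurable (fun p : EN N × ℝ => PsiE N α p.1 p.2) := by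
  unfold PsiE
  refine Measurable.const_mul ?_ _
  have := gdens_meas N α
  apply Measurable.lintegral_prod_right' (f := fun q : (EN N × ℝ) × ℝ =>
    if ‖q.1.1‖ ^ 2 < q.1.2 * (1 + q.2) then ENNReal.ofReal (gdens N α q.2) else 0)
  refine (Measurable.ite ?_ (by fun_prop) (by fun_prop)) 
  exact measurableSet_lt (by fun_prop) (by fun_prop)

lemma lint_riesz {b ρ : ℝ} (hb : 0 < b) (hρ : 0 < ρ) :
    ∫⁻ τ in Ioi (0:ℝ), ENNReal.ofReal (τ ^ (b - 1) * exp (-(τ * ρ ^ 2)))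
      = ENNReal.ofReal (Gamma b * ρ ^ (-(2 * b))) := by
  have := lint_gamma (b := ρ ^ 2) hb (by positivity)
  simp_rw [mul_comm (ρ ^ 2)] at this
  rw [this, ← Real.rpow_natCast, ← Real.rpow_mul hρ.le]
  congr 3
  push_cast; ring

lemma lint_shift {a t c : ℝ} (ha : 0 < a) (ht : 0 < t) (hc : 0 ≤ c) :
    ∫⁻ s in Ioi (0:ℝ), (if c < s then ENNReal.ofReal ((s - c) ^ (a - 1)) else 0) *
        ENNReal.ofReal (exp (-(t * s)))
      = ENNReal.ofReal (Gamma a * t ^ (-a) * exp (-(t * c))) := by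
  have hGa := Gamma_pos_of_pos ha
  rw [ENNReal.ofReal_mul (by positivity), ← lint_gamma ha ht, ← lintegral_indicator measurableSet_Ioi,
    ← lintegral_indicator measurableSet_Ioi, ← lintegral_mul_const _
    ((by fun_prop : Measurable fun t_1 : ℝ => ENNReal.ofReal (t_1 ^ (a - 1) * rexp (-(t * t_1)))).indicator measurableSet_Ioi),
    ← lintegral_sub_right_eq_self (fun x => (Ioi (0:ℝ)).indicator (fun t_1 : ℝ => ENNReal.ofReal (t_1 ^ (a - 1) * rexp (-(t * t_1)))) x *
      ENNReal.ofReal (rexp (-(t * c)))) c]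
  refine lintegral_congr fun s => ?_
  by_cases h : c < s
  · have h1 : s ∈ Ioi (0:ℝ) := lt_of_le_of_lt hc h
    have h2 : s - c ∈ Ioi (0:ℝ) := sub_pos.2 h
    have h3 : 0 < s - c := h2
    rw [indicator_of_mem h1, indicator_of_mem h2, if_pos h, ← ENNReal.ofReal_mul (by positivity),
      ← ENNReal.ofReal_mul (by positivity), mul_assoc, ← Real.exp_add]
    congr 3; ring_nf
  · have h2 : s - c ∉ Ioi (0:ℝ) := by simpa using h
    rw [indicator_of_notMem h2]
    simp [h, indicator]

lemma PhiE_laplace {N : ℕ} {α : ℝ} (h2 : α < 2) (η : EN N) {t : ℝ} (ht : 0 < t) :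
    ∫⁻ s in Ioi (0:ℝ), PhiE N α η s * ENNReal.ofReal (exp (-(t * s)))
      = ENNReal.ofReal (Gamma (1 - α / 2) * t ^ (α / 2 - 1)) *
        ∫⁻ ζ : EN N, ENNReal.ofReal (‖ζ - η‖ ^ (α - (N:ℝ)) * exp (-(t * ‖ζ‖ ^ 2))) := by
  have m1 : Measurable (fun p : ℝ × EN N => 
    (if ‖p.2‖ ^ 2 < p.1 then ENNReal.ofReal ((p.1 - ‖p.2‖ ^ 2) ^ (-(α / 2))) else 0)) := by
    refine (Measurable.ite ?_ (by fun_prop) (by fun_prop))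
    exact measurableSet_lt (by fun_prop) (by fun_prop)
  have : ∀ s, PhiE N α η s * ENNReal.ofReal (exp (-(t * s))) = 
      ∫⁻ ζ : EN N, (if ‖ζ‖ ^ 2 < s then ENNReal.ofReal ((s - ‖ζ‖ ^ 2) ^ (-(α / 2))) else 0) *
    ENNReal.ofReal (‖ζ - η‖ ^ (α - (N:ℝ))) * ENNReal.ofReal (exp (-(t * s))) := by
    intro s
    rw [PhiE, lintegral_mul_const]
    exact (m1.comp (measurable_const.prodMk measurable_id)).mul (by fun_prop)
  simp_rw [this]
  rw [lintegral_lintegral_swap ((m1.mul (by fun_prop)).mul (by fun_prop)).aemeasurable,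
    ← lintegral_const_mul _ (by fun_prop)]
  refine lintegral_congr fun ζ => ?_
  have hG := Gamma_pos_of_pos (show 0 < 1 - α / 2 by linarith)
  have e := lint_shift (a := 1 - α / 2) (by linarith) ht (sq_nonneg ‖ζ‖)
  rw [show 1 - α / 2 - 1 = -(α / 2) by ring, show -(1 - α / 2) = α / 2 - 1 by ring] at e
  rw [ENNReal.ofReal_mul (by positivity : 0 ≤ ‖ζ - η‖ ^ (α - (N:ℝ))), ← mul_assoc,
    mul_comm _ (ENNReal.ofReal (‖ζ - η‖ ^ (α - (N:ℝ)))), mul_assoc, ← ENNReal.ofReal_mul (by positivity),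
    ← e, ← lintegral_const_mul' _ _ (by simp)]
  refine lintegral_congr fun s => ?_
  ring

lemma riesz_gauss {N : ℕ} {α : ℝ} (hN0 : N ≠ 0) (hN : α < N) (η : EN N) {t : ℝ} (ht : 0 < t) :
    ∫⁻ ζ : EN N, ENNReal.ofReal (‖ζ - η‖ ^ (α - (N:ℝ)) * exp (-(t * ‖ζ‖ ^ 2)))
      = ENNReal.ofReal (1 / Gamma (((N:ℝ) - α) / 2)) * ∫⁻ τ in Ioi (0:ℝ),
        ENNReal.ofReal (τ ^ (((N:ℝ) - α) / 2 - 1) * ((π / (τ + t)) ^ ((N:ℝ) / 2) *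
          exp (-(τ * t / (τ + t) * ‖η‖ ^ 2)))) := by
  have hb : 0 < ((N:ℝ) - α) / 2 := by linarith
  have hG := Gamma_pos_of_pos hb
  have : Nonempty (Fin N) := ⟨⟨0, Nat.pos_of_ne_zero hN0⟩⟩
  have h1 : ∀ᵐ ζ : EN N, ENNReal.ofReal (‖ζ - η‖ ^ (α - (N:ℝ)) * exp (-(t * ‖ζ‖ ^ 2)))
      = ∫⁻ τ in Ioi (0:ℝ), ENNReal.ofReal (1 / Gamma (((N:ℝ) - α) / 2)) * ENNReal.ofReal
        (τ ^ (((N:ℝ) - α) / 2 - 1) * (exp (-(τ * ‖ζ - η‖ ^ 2)) * exp (-(t * ‖ζ‖ ^ 2)))) := by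
    have : ∀ᵐ ζ : EN N, ζ ≠ η := by
      simp [ae_iff]
    filter_upwards [this] with ζ hζ
    have hρ : 0 < ‖ζ - η‖ := norm_pos_iff.2 (sub_ne_zero.2 hζ)
    rw [lintegral_const_mul _ (by fun_prop)]
    simp_rw [← mul_assoc]
    simp_rw [ENNReal.ofReal_mul' (Real.exp_pos (-(t * ‖ζ‖ ^ 2))).le]
    rw [lintegral_mul_const _ (by fun_prop), lint_riesz hb hρ, ← ENNReal.ofReal_mul (by positivity),
      ← ENNReal.ofReal_mul (by positivity), ← ENNReal.ofReal_mul (by positivity)]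
    congr 1
    rw [show -(2 * (((N:ℝ) - α) / 2)) = α - N by ring]
    field_simp
  rw [lintegral_congr_ae h1, lintegral_lintegral_swap (by fun_prop), ← lintegral_const_mul _ (by fun_prop)]
  refine setLIntegral_congr_fun measurableSet_Ioi fun τ hτ => ?_
  have hτ : 0 < τ := hτ
  rw [lintegral_const_mul _ (by fun_prop)]
  simp_rw [ENNReal.ofReal_mul (by positivity : 0 ≤ τ ^ (((N:ℝ) - α) / 2 - 1))]
  rw [lintegral_const_mul _ (by fun_prop), lint_gauss hτ ht]

lemma riesz_gauss2 {N : ℕ} {α : ℝ} (hN0 : N ≠ 0) (hN : α < N) (η : EN N) {t : ℝ} (ht : 0 < t) :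
    ∫⁻ ζ : EN N, ENNReal.ofReal (‖ζ - η‖ ^ (α - (N:ℝ)) * exp (-(t * ‖ζ‖ ^ 2)))
      = ENNReal.ofReal (π ^ ((N:ℝ) / 2) / Gamma (((N:ℝ) - α) / 2) * t ^ (-(α / 2))) *
       ∫⁻ v in Ioi (0:ℝ), ENNReal.ofReal (gdens N α v * exp (-(t * (‖η‖ ^ 2 / (1 + v))))) := by
  have hb : 0 < ((N:ℝ) - α) / 2 := by linarith
  have hG := Gamma_pos_of_pos hb
  have := gdens_meas N α
  rw [riesz_gauss hN0 hN η ht, lint_inv ht, ← lintegral_const_mul _ (by fun_prop),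
    ← lintegral_const_mul _ (by fun_prop)]
  refine setLIntegral_congr_fun measurableSet_Ioi fun v hv => ?_
  have hv : 0 < v := hv
  have hg := gdens_nonneg N α hv.le
  rw [← ENNReal.ofReal_mul (by positivity), ← ENNReal.ofReal_mul (by positivity),
    ← ENNReal.ofReal_mul (by positivity)]
  congr 1
  unfold gdens
  have e1 : t / v * t / (t / v + t) * ‖η‖ ^ 2 = t * (‖η‖ ^ 2 / (1 + v)) := by field_simp
  rw [e1]
  simp only [← mul_assoc]
  congr 1
  apply Real.log_injOn_pos (by simp only [mem_Ioi]; positivity) (by simp only [mem_Ioi]; positivity)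
  have e2 : t / v + t = t * (1 + v) / v := by field_simp
  have v1 : 1 + v ≠ 0 := by positivity
  have v0 := hv.ne'
  have t0 := ht.ne'
  have p0 := Real.pi_pos.ne'
  have A : ∀ a b : ℝ, 0 < a → 0 < b → log (a * b) = log a + log b := fun a b h h' => Real.log_mul h.ne' h'.ne'
  have B : ∀ a b : ℝ, 0 < a → 0 < b → log (a / b) = log a - log b := fun a b h h' => Real.log_div h.ne' h'.ne'
  have C : ∀ a b : ℝ, 0 < a → log (a ^ b) = b * log a := fun a b h => Real.log_rpow h b
  rw [e2]
  rw [A _ _ (by positivity) (by positivity), A _ _ (by positivity) (by positivity),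
   A _ _ (by positivity) (by positivity), A _ _ (by positivity) (by positivity),
   A _ _ (by positivity) (by positivity), A _ _ (by positivity) (by positivity),
   C _ _ (by positivity), C _ _ (by positivity), C _ _ (by positivity), C _ _ (by positivity), C _ _ (by positivity),
   B _ _ (by positivity) (by positivity), B _ _ (by positivity) (by positivity), B _ _ (by positivity) (by positivity),
   B _ _ (by positivity) (by positivity), B _ _ (by positivity) (by positivity), B _ _ (by positivity) (by positivity),
   A _ _ (by positivity) (by positivity), C _ _ (by positivity), Real.log_one, Real.log_pow]
  push_cast
  ring

lemma PsiE_laplace {N : ℕ} {α : ℝ} (η : EN N) {t : ℝ} (ht : 0 < t) :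
    ∫⁻ s in Ioi (0:ℝ), PsiE N α η s * ENNReal.ofReal (exp (-(t * s)))
      = ENNReal.ofReal (equC N α) * (ENNReal.ofReal t⁻¹ *
       ∫⁻ v in Ioi (0:ℝ), ENNReal.ofReal (gdens N α v * exp (-(t * (‖η‖ ^ 2 / (1 + v)))))) := by
  have := gdens_meas N α
  have m1 : Measurable (fun p : ℝ × ℝ =>
      if ‖η‖ ^ 2 < p.1 * (1 + p.2) then ENNReal.ofReal (gdens N α p.2) else 0) := by
    refine (Measurable.ite ?_ (by fun_prop) (by fun_prop))
    exact measurableSet_lt (by fun_prop) (by fun_prop)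
  have : ∀ s, PsiE N α η s * ENNReal.ofReal (exp (-(t * s))) = ENNReal.ofReal (equC N α) *
      ∫⁻ v in Ioi (0:ℝ), (if ‖η‖ ^ 2 < s * (1 + v) then ENNReal.ofReal (gdens N α v) else 0) *
        ENNReal.ofReal (exp (-(t * s))) := by
    intro s
    rw [PsiE, lintegral_mul_const' _ _ (by simp), mul_assoc]
  simp_rw [this]
  rw [lintegral_const_mul]
  swap
  · apply Measurable.lintegral_prod_right' (f := fun p : ℝ × ℝ =>
      (if ‖η‖ ^ 2 < p.1 * (1 + p.2) then ENNReal.ofReal (gdens N α p.2) else 0) *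
        ENNReal.ofReal (exp (-(t * p.1))))
    exact m1.mul (by fun_prop)
  congr 1
  rw [lintegral_lintegral_swap (m1.mul (by fun_prop)).aemeasurable, ← lintegral_const_mul _ (by fun_prop)]
  refine setLIntegral_congr_fun measurableSet_Ioi fun v hv => ?_
  have hv : 0 < v := hv
  have hg := gdens_nonneg N α hv.le
  rw [ENNReal.ofReal_mul hg, ← mul_assoc, mul_comm (ENNReal.ofReal t⁻¹), mul_assoc,
    ← ENNReal.ofReal_mul (by positivity), ← lint_expIoi ht, ← lintegral_const_mul _ (by fun_prop),
    ← lintegral_indicator measurableSet_Ioi, ← lintegral_indicator measurableSet_Ioi]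
  refine lintegral_congr fun s => ?_
  by_cases h : ‖η‖ ^ 2 < s * (1 + v)
  · have h1 : s ∈ Ioi (‖η‖ ^ 2 / (1 + v)) := by
      simp only [mem_Ioi]; rwa [div_lt_iff₀ (by positivity)]
    have h2 : s ∈ Ioi (0:ℝ) := lt_of_le_of_lt (show (0:ℝ) ≤ ‖η‖ ^ 2 / (1 + v) by positivity) h1
    rw [indicator_of_mem h1, indicator_of_mem h2, if_pos h]
  · have h1 : s ∉ Ioi (‖η‖ ^ 2 / (1 + v)) := by
      simp only [mem_Ioi]; rwa [div_lt_iff₀ (by positivity)]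
    rw [indicator_of_notMem h1]
    simp [h, indicator]

lemma PhiE_eq_ae_s {N : ℕ} {α : ℝ} (hN0 : N ≠ 0) (h0 : 0 < α) (h2 : α < 2) (hN : α < N) (η : EN N) :
    ∀ᵐ s ∂(volume.restrict (Ioi (0:ℝ))), PhiE N α η s = PsiE N α η s := by
  have hG1 := Gamma_pos_of_pos (show 0 < 1 - α / 2 by linarith)
  have hG2 := Gamma_pos_of_pos (show 0 < ((N:ℝ) - α) / 2 by linarith)
  have key : ∀ t : ℝ, 0 < t → ∫⁻ s in Ioi (0:ℝ), PhiE N α η s * ENNReal.ofReal (exp (-(t * s)))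
      = ∫⁻ s in Ioi (0:ℝ), PsiE N α η s * ENNReal.ofReal (exp (-(t * s))) := by
    intro t ht
    rw [PhiE_laplace h2 η ht, riesz_gauss2 hN0 hN η ht, PsiE_laplace η ht, ← mul_assoc, ← mul_assoc,
      ← ENNReal.ofReal_mul (by positivity), ← ENNReal.ofReal_mul (by unfold equC; positivity)]
    have e1 : Gamma (1 - α / 2) * t ^ (α / 2 - 1) * (π ^ ((N:ℝ) / 2) / Gamma (((N:ℝ) - α) / 2) * t ^ (-(α / 2)))
        = equC N α * t⁻¹ := ?_
    · rw [e1]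
    unfold equC
    have : t⁻¹ = t ^ (α / 2 - 1) * t ^ (-(α / 2)) := by
      rw [← Real.rpow_add ht, ← Real.rpow_neg_one]; congr 1; ring
    rw [this]
    ring
  refine laplace_uniq (Φ := PhiE N α η) (Ψ := PsiE N α η) ?_ ?_ key ?_
  · have := (PhiE_meas N α).comp (g := fun p : EN N × ℝ => PhiE N α p.1 p.2) (f := fun s : ℝ => (η, s)) (by fun_prop)
    exact this
  · have := (PsiE_meas N α).comp (g := fun p : EN N × ℝ => PsiE N α p.1 p.2) (f := fun s : ℝ => (η, s)) (by fun_prop)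
    exact this
  · rw [key 1 one_pos, PsiE_laplace η one_pos]
    refine ENNReal.mul_ne_top (by simp) (ENNReal.mul_ne_top (by simp) ?_)
    refine ne_top_of_le_ne_top (b := ENNReal.ofReal (betaC N α)) (by simp) ?_
    rw [← lint_gdens h0 hN]
    refine setLIntegral_mono' measurableSet_Ioi fun v hv => ?_
    have hv : 0 < v := hv
    apply ENNReal.ofReal_le_ofReal
    have : exp (-(1 * (‖η‖ ^ 2 / (1 + v)))) ≤ 1 := by
      rw [Real.exp_le_one_iff, neg_nonpos]; positivity
    exact mul_le_of_le_one_right (gdens_nonneg N α hv.le) this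

lemma PhiE_scale {N : ℕ} {α : ℝ} (η : EN N) {s : ℝ} (hs : 0 < s) :
    PhiE N α (√s • η) s = PhiE N α η 1 := by
  have hr : 0 < √s := Real.sqrt_pos.2 hs
  unfold PhiE
  rw [lint_scale hr 0, ← lintegral_const_mul']
  swap; · simp
  refine lintegral_congr fun ζ => ?_
  have e0 : s = √s ^ 2 := (Real.sq_sqrt hs.le).symm
  have e1 : ‖(0:EN N) + √s • ζ‖ ^ 2 = s * ‖ζ‖ ^ 2 := by
    rw [zero_add, norm_smul, mul_pow, Real.norm_eq_abs, sq_abs, ← e0]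
  have e2 : ‖(0:EN N) + √s • ζ - √s • η‖ = √s * ‖ζ - η‖ := by
    rw [zero_add, ← smul_sub, norm_smul, Real.norm_of_nonneg hr.le]
  rw [e1, e2]
  by_cases h : ‖ζ‖ ^ 2 < 1
  · have h' : s * ‖ζ‖ ^ 2 < s := by nlinarith
    rw [if_pos h, if_pos h', ← ENNReal.ofReal_mul, ← ENNReal.ofReal_mul (by positivity), ← ENNReal.ofReal_mul]
    · congr 1
      have h1 : 0 < 1 - ‖ζ‖ ^ 2 := by linarith
      rw [show s - s * ‖ζ‖ ^ 2 = s * (1 - ‖ζ‖ ^ 2) by ring, mul_rpow hs.le h1.le, mul_rpow hr.le (norm_nonneg _)]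
      have : √s ^ N * (s ^ (-(α / 2)) * √s ^ (α - (N:ℝ))) = 1 := by
        conv_lhs => enter [2, 1]; rw [e0]
        rw [← Real.rpow_natCast, ← Real.rpow_natCast, ← Real.rpow_mul hr.le, ← Real.rpow_add hr, ← Real.rpow_add hr]
        rw [show (N:ℝ) + ((2:ℕ) * -(α / 2) + (α - N)) = 0 by push_cast; ring, Real.rpow_zero]
      linear_combination ((1 - ‖ζ‖ ^ 2) ^ (-(α / 2)) * ‖ζ - η‖ ^ (α - (N:ℝ))) * this
    · have h1 : 0 < 1 - ‖ζ‖ ^ 2 := by linarith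
      positivity
    · have h1 : 0 < s - s * ‖ζ‖ ^ 2 := by linarith
      positivity
  · have h' : ¬ s * ‖ζ‖ ^ 2 < s := by nlinarith
    simp [h, h']

lemma PsiE_scale {N : ℕ} {α : ℝ} (η : EN N) {s : ℝ} (hs : 0 < s) :
    PsiE N α (√s • η) s = PsiE N α η 1 := by
  unfold PsiE
  have e1 : ‖√s • η‖ ^ 2 = s * ‖η‖ ^ 2 := by
    rw [norm_smul, mul_pow, Real.norm_eq_abs, sq_abs, Real.sq_sqrt hs.le]
  rw [e1]
  simp_rw [mul_lt_mul_iff_right₀ hs, one_mul]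

/-- Riesz potential of the equilibrium density of the unit ball. -/
lemma PhiE_ae {N : ℕ} {α : ℝ} (hN0 : N ≠ 0) (h0 : 0 < α) (h2 : α < 2) (hN : α < N) :
    ∀ᵐ η : EN N, PhiE N α η 1 = PsiE N α η 1 := by
  have h1 : ∀ᵐ η : EN N, ∀ᵐ s ∂(volume.restrict (Ioi (0:ℝ))), PhiE N α η s = PsiE N α η s :=
    ae_of_all _ fun η => PhiE_eq_ae_s hN0 h0 h2 hN η
  rw [Measure.ae_ae_comm (p := fun η s => PhiE N α η s = PsiE N α η s) (measurableSet_eq_fun (PhiE_meas N α) (PsiE_meas N α))] at h1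
  have h3 := h1.and (ae_restrict_mem measurableSet_Ioi)
  have : (ae (volume.restrict (Ioi (0:ℝ)))).NeBot := by
    rw [ae_neBot, Ne, Measure.restrict_eq_zero]; simp
  obtain ⟨s, hs, hs0⟩ := h3.exists
  have hs0 : 0 < s := hs0
  have hr : 0 < √s := Real.sqrt_pos.2 hs0
  have := (Measure.quasiMeasurePreserving_smul (volume : Measure (EN N)) hr.ne').ae hs
  filter_upwards [this] with η hη
  rwa [PhiE_scale _ hs0, PsiE_scale _ hs0] at hη

/-- reflected inversion -/
def Tx {N : ℕ} (x z : EN N) : EN N := x - ((1 - ‖x‖ ^ 2) / ‖z - x‖ ^ 2) • (z - x)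

lemma Tx_eq {N : ℕ} {x : EN N} (hx : ‖x‖ < 1) (z : EN N) :
    Tx x z = (x + x) - EuclideanGeometry.inversion x (√(1 - ‖x‖ ^ 2)) z := by
  have : 0 ≤ 1 - ‖x‖ ^ 2 := by nlinarith [norm_nonneg x]
  simp only [Tx, EuclideanGeometry.inversion, vsub_eq_sub, vadd_eq_add, div_pow, Real.sq_sqrt this, dist_eq_norm]
  abel

lemma Rx_pos {N : ℕ} {x : EN N} (hx : ‖x‖ < 1) : 0 < 1 - ‖x‖ ^ 2 := by nlinarith [norm_nonneg x]

lemma Tx_sub {N : ℕ} {x : EN N} (z : EN N) :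
    Tx x z - x = -(((1 - ‖x‖ ^ 2) / ‖z - x‖ ^ 2) • (z - x)) := by
  simp [Tx]

lemma Tx_norm_sub {N : ℕ} {x : EN N} (hx : ‖x‖ < 1) {z : EN N} (hz : z ≠ x) :
    ‖Tx x z - x‖ = (1 - ‖x‖ ^ 2) / ‖z - x‖ := by
  have h1 : 0 < ‖z - x‖ := norm_pos_iff.2 (sub_ne_zero.2 hz)
  have := Rx_pos hx
  rw [Tx_sub, norm_neg, norm_smul, Real.norm_of_nonneg (by positivity)]
  field_simp

lemma Tx_ne {N : ℕ} {x : EN N} (hx : ‖x‖ < 1) {z : EN N} (hz : z ≠ x) : Tx x z ≠ x := by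
  have h1 : 0 < ‖z - x‖ := norm_pos_iff.2 (sub_ne_zero.2 hz)
  have := Rx_pos hx
  rw [← sub_ne_zero, ← norm_pos_iff, Tx_norm_sub hx hz]
  positivity

lemma Tx_Tx {N : ℕ} {x : EN N} (hx : ‖x‖ < 1) {z : EN N} (hz : z ≠ x) : Tx x (Tx x z) = z := by
  have h1 : 0 < ‖z - x‖ := norm_pos_iff.2 (sub_ne_zero.2 hz)
  have := Rx_pos hx
  rw [Tx, Tx_norm_sub hx hz, Tx_sub, smul_neg, smul_smul]
  have : (1 - ‖x‖ ^ 2) / ((1 - ‖x‖ ^ 2) / ‖z - x‖) ^ 2 * ((1 - ‖x‖ ^ 2) / ‖z - x‖ ^ 2) = 1 := by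
    field_simp
  rw [this]; simp

lemma Tx_dist {N : ℕ} {x : EN N} (hx : ‖x‖ < 1) {z y : EN N} (hz : z ≠ x) (hy : y ≠ x) :
    ‖Tx x z - Tx x y‖ = (1 - ‖x‖ ^ 2) / (‖z - x‖ * ‖y - x‖) * ‖z - y‖ := by
  rw [Tx_eq hx, Tx_eq hx, sub_sub_sub_cancel_left, ← dist_eq_norm, dist_comm,
    EuclideanGeometry.dist_inversion_inversion hz hy, Real.sq_sqrt (Rx_pos hx).le,
    dist_eq_norm, dist_eq_norm, dist_eq_norm]

lemma Tx_norm_sq {N : ℕ} {x : EN N} {z : EN N} (hz : z ≠ x) :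
    ‖Tx x z‖ ^ 2 - 1 = (1 - ‖x‖ ^ 2) * (1 - ‖z‖ ^ 2) / ‖z - x‖ ^ 2 := by
  have h1 : 0 < ‖z - x‖ := norm_pos_iff.2 (sub_ne_zero.2 hz)
  have e : ‖z‖ ^ 2 = ‖x‖ ^ 2 + 2 * inner ℝ x (z - x) + ‖z - x‖ ^ 2 := by
    rw [← norm_add_sq_real, add_sub_cancel]
  rw [Tx, norm_sub_sq_real, norm_smul, real_inner_smul_right, mul_pow, Real.norm_eq_abs, sq_abs, e]
  field_simp
  ring

lemma Tx_deriv {N : ℕ} {x : EN N} (hx : ‖x‖ < 1) {z : EN N} (hz : z ≠ x) :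
    ∃ f' : EN N →L[ℝ] EN N, HasFDerivAt (Tx x) f' z ∧ |f'.det| = ((1 - ‖x‖ ^ 2) / ‖z - x‖ ^ 2) ^ N := by
  have h := (EuclideanGeometry.hasFDerivAt_inversion (R := √(1 - ‖x‖ ^ 2)) hz).const_sub (x + x)
  have h1 : 0 < ‖z - x‖ := norm_pos_iff.2 (sub_ne_zero.2 hz)
  have hR := Rx_pos hx
  refine ⟨_, h.congr_of_eventuallyEq (Eventually.of_forall fun w => Tx_eq hx w), ?_⟩
  rw [div_pow, Real.sq_sqrt hR.le, dist_eq_norm, ← neg_smul]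
  have : LinearMap.det (((Submodule.span ℝ {z - x})ᗮ.reflection).toLinearMap) =
    (-1) ^ Module.finrank ℝ ((Submodule.span ℝ {z - x})ᗮ)ᗮ := Submodule.det_reflection _
  rw [ContinuousLinearMap.det, ContinuousLinearMap.toLinearMap_smul, LinearMap.det_smul]
  erw [this]
  rw [abs_mul, abs_pow, abs_pow, abs_neg, abs_of_pos (by positivity)]
  simp

lemma Tx_lint {N : ℕ} (hN0 : N ≠ 0) {x : EN N} (hx : ‖x‖ < 1) (f : EN N → ℝ≥0∞) :
    ∫⁻ z in {z : EN N | 1 < ‖z‖}, f z =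
      ∫⁻ z in {z : EN N | ‖z‖ < 1}, ENNReal.ofReal (((1 - ‖x‖ ^ 2) / ‖z - x‖ ^ 2) ^ N) * f (Tx x z) := by
  have hNe : Nonempty (Fin N) := ⟨⟨0, Nat.pos_of_ne_zero hN0⟩⟩
  have hR := Rx_pos hx
  have him : Tx x '' ({z : EN N | ‖z‖ < 1} \ {x}) = {z : EN N | 1 < ‖z‖} := by
    ext z
    constructor
    · rintro ⟨w, ⟨hw, hwx⟩, rfl⟩
      have hwx : w ≠ x := hwx
      have h1 : 0 < ‖w - x‖ := norm_pos_iff.2 (sub_ne_zero.2 hwx)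
      have hw' := Rx_pos (show ‖w‖ < 1 from hw)
      have h := Tx_norm_sq hwx
      have : 0 < ‖Tx x w‖ ^ 2 - 1 := by rw [h]; positivity
      simp only [mem_setOf_eq]
      nlinarith [norm_nonneg (Tx x w)]
    · intro hz
      simp only [mem_setOf_eq] at hz
      have hzx : z ≠ x := by rintro rfl; linarith
      have h1 : 0 < ‖z - x‖ := norm_pos_iff.2 (sub_ne_zero.2 hzx)
      refine ⟨Tx x z, ⟨?_, Tx_ne hx hzx⟩, Tx_Tx hx hzx⟩
      have h := Tx_norm_sq hzx
      have : 0 < (1 - ‖x‖ ^ 2) * (‖z‖ ^ 2 - 1) / ‖z - x‖ ^ 2 := by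
        have : 0 < ‖z‖ ^ 2 - 1 := by nlinarith
        positivity
      have h' : (1 - ‖x‖ ^ 2) * (1 - ‖z‖ ^ 2) / ‖z - x‖ ^ 2 = - ((1 - ‖x‖ ^ 2) * (‖z‖ ^ 2 - 1) / ‖z - x‖ ^ 2) := by ring
      simp only [mem_setOf_eq]
      nlinarith [norm_nonneg (Tx x z)]
  have hae : ({z : EN N | ‖z‖ < 1} \ {x} : Set (EN N)) =ᵐ[volume] {z : EN N | ‖z‖ < 1} :=
    diff_null_ae_eq_self (by simp)
  have hm : MeasurableSet ({z : EN N | ‖z‖ < 1} \ {x} : Set (EN N)) :=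
    (measurableSet_lt (by fun_prop) (by fun_prop)).diff (measurableSet_singleton x)
  classical
  choose! f' hf' hdet using fun (z : EN N) (hz : z ≠ x) => Tx_deriv hx hz
  rw [← him, lintegral_image_eq_lintegral_abs_det_fderiv_mul volume hm
    (fun z hz => (hf' z hz.2).hasFDerivWithinAt), ← setLIntegral_congr hae]
  · exact setLIntegral_congr_fun hm fun z hz => by rw [hdet z hz.2]
  · intro z hz w hw h
    rw [← Tx_Tx hx hz.2, h, Tx_Tx hx hw.2]

lemma Tx_ae {N : ℕ} (hN0 : N ≠ 0) {x : EN N} (hx : ‖x‖ < 1) {p : EN N → Prop} (hp : ∀ᵐ y, p y) :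
    ∀ᵐ y, p (Tx x y) := by
  have hNe : Nonempty (Fin N) := ⟨⟨0, Nat.pos_of_ne_zero hN0⟩⟩
  rw [ae_iff] at hp ⊢
  have h1 : volume (Tx x '' ({y | ¬ p y} \ {x})) = 0 := by
    refine addHaar_image_eq_zero_of_differentiableOn_of_addHaar_eq_zero _ ?_
      (measure_mono_null diff_subset hp)
    intro z hz
    obtain ⟨f', hf, -⟩ := Tx_deriv hx (show z ≠ x from hz.2)
    exact hf.differentiableAt.differentiableWithinAt
  refine measure_mono_null (t := Tx x '' ({y | ¬ p y} \ {x}) ∪ {x}) ?_ (measure_union_null h1 (by simp))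
  intro y hy
  by_cases hyx : y = x
  · right; exact hyx
  · left; exact ⟨Tx x y, ⟨hy, Tx_ne hx hyx⟩, Tx_Tx hx hyx⟩

def rieszA (N : ℕ) (α : ℝ) : ℝ :=
  Gamma (((N:ℝ) - α) / 2) / (2 ^ α * π ^ ((N:ℝ) / 2) * Gamma (α / 2))

lemma rieszA_pos {N : ℕ} {α : ℝ} (h0 : 0 < α) (hN : α < N) : 0 < rieszA N α := by
  have hG2 := Gamma_pos_of_pos (show 0 < ((N:ℝ) - α) / 2 by linarith)
  have hG3 := Gamma_pos_of_pos (show 0 < α / 2 by linarith)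
  unfold rieszA; positivity

lemma betaC_pos {N : ℕ} {α : ℝ} (h0 : 0 < α) (hN : α < N) : 0 < betaC N α := by
  have hG2 := Gamma_pos_of_pos (show 0 < ((N:ℝ) - α) / 2 by linarith)
  have hG3 := Gamma_pos_of_pos (show 0 < α / 2 by linarith)
  have hG4 := Gamma_pos_of_pos (show 0 < (N:ℝ) / 2 by linarith)
  unfold betaC; positivity

lemma greenCoeff_eq {N : ℕ} {α : ℝ} (h0 : 0 < α) (hN : α < N) :
    greenCoeff N α * betaC N α = rieszA N α := by
  have hG2 := Gamma_pos_of_pos (show 0 < ((N:ℝ) - α) / 2 by linarith)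
  have hG3 := Gamma_pos_of_pos (show 0 < α / 2 by linarith)
  have hG4 := Gamma_pos_of_pos (show 0 < (N:ℝ) / 2 by linarith)
  unfold greenCoeff betaC rieszA
  field_simp

lemma greenCoeff_pos {N : ℕ} {α : ℝ} (h0 : 0 < α) (hN : α < N) : 0 < greenCoeff N α := by
  have hG3 := Gamma_pos_of_pos (show 0 < α / 2 by linarith)
  have hG4 := Gamma_pos_of_pos (show 0 < (N:ℝ) / 2 by linarith)
  unfold greenCoeff; positivity

lemma poissonCoeff_pos {N : ℕ} {α : ℝ} (h0 : 0 < α) (h2 : α < 2) (hN : α < N) : 0 < poissonCoeff N α := by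
  have hG4 := Gamma_pos_of_pos (show 0 < (N:ℝ) / 2 by linarith)
  have : 0 < sin (π * α / 2) := by
    apply Real.sin_pos_of_pos_of_lt_pi
    · positivity
    · nlinarith [Real.pi_pos]
  unfold poissonCoeff; positivity

lemma poissonCoeff_eq {N : ℕ} {α : ℝ} (h0 : 0 < α) (h2 : α < 2) (hN : α < N) :
    poissonCoeff N α * equC N α * betaC N α = 1 := by
  have hG1 := Gamma_pos_of_pos (show 0 < 1 - α / 2 by linarith)
  have hG2 := Gamma_pos_of_pos (show 0 < ((N:ℝ) - α) / 2 by linarith)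
  have hG3 := Gamma_pos_of_pos (show 0 < α / 2 by linarith)
  have hG4 := Gamma_pos_of_pos (show 0 < (N:ℝ) / 2 by linarith)
  have h := Real.Gamma_mul_Gamma_one_sub (α / 2)
  have hs : 0 < sin (π * (α / 2)) := by
    apply Real.sin_pos_of_pos_of_lt_pi
    · positivity
    · nlinarith [Real.pi_pos]
  rw [eq_div_iff hs.ne'] at h
  have hp : π ^ (-1 - (N:ℝ) / 2) * π ^ ((N:ℝ) / 2) * π = 1 := by
    rw [← Real.rpow_add Real.pi_pos, ← Real.rpow_add_one Real.pi_pos.ne']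
    rw [show -1 - (N:ℝ) / 2 + N / 2 + 1 = 0 by ring, Real.rpow_zero]
  unfold poissonCoeff equC betaC
  rw [show π * α / 2 = π * (α / 2) by ring]
  generalize Gamma (1 - α / 2) = g1 at *
  generalize Gamma (((N:ℝ) - α) / 2) = g2 at *
  generalize Gamma (α / 2) = g3 at *
  generalize Gamma ((N:ℝ) / 2) = g4 at *
  generalize sin (π * (α / 2)) = g5 at *
  generalize π ^ (-1 - (N:ℝ) / 2) = g6 at *
  generalize π ^ ((N:ℝ) / 2) = g7 at *
  field_simp
  linear_combination g6 * g7 * h + hp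

lemma gdens_intervalIntegral {N : ℕ} {α : ℝ} (h0 : 0 < α) (hN : α < N) {V : ℝ} (hV : 0 ≤ V) :
    ENNReal.ofReal (∫ s in (0:ℝ)..V, s ^ (α / 2 - 1) * (1 + s) ^ (-(N : ℝ) / 2))
      = ∫⁻ v in Ioc 0 V, ENNReal.ofReal (gdens N α v) := by
  rw [intervalIntegral.integral_of_le hV, ofReal_integral_eq_lintegral_ofReal]
  · rfl
  · have : IntegrableOn (gdens N α) (Ioi 0) := by
      refine ⟨(gdens_meas N α).aestronglyMeasurable, ?_⟩
      rw [hasFiniteIntegral_iff_ofReal, lint_gdens h0 hN]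
      · simp
      · exact (ae_restrict_mem measurableSet_Ioi).mono fun v hv => gdens_nonneg N α (le_of_lt hv)
    exact this.mono_set Ioc_subset_Ioi_self
  · exact (ae_restrict_mem measurableSet_Ioc).mono fun v hv => gdens_nonneg N α (le_of_lt hv.1)

/-- sweeping identity in the unit ball -/
lemma sweep1 {N : ℕ} {α : ℝ} (hN0 : N ≠ 0) (h0 : 0 < α) (h2 : α < 2) (hN : α < N)
    {x : EN N} (hx : ‖x‖ < 1) :
    ∀ᵐ y : EN N, (∫⁻ z in {z : EN N | 1 < ‖z‖},
      ENNReal.ofReal (poissonBall N α 0 1 x z) * ENNReal.ofReal (rieszA N α * ‖z - y‖ ^ (α - (N:ℝ))))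
      + ENNReal.ofReal (greenB N α x y) = ENNReal.ofReal (rieszA N α * ‖x - y‖ ^ (α - (N:ℝ))) := by
  have hNe : Nonempty (Fin N) := ⟨⟨0, Nat.pos_of_ne_zero hN0⟩⟩
  have hR := Rx_pos hx
  have hA := rieszA_pos h0 hN
  have hc := poissonCoeff_pos h0 h2 hN
  have hg := gdens_meas N α
  have hyx : ∀ᵐ y : EN N, y ≠ x := by simp [ae_iff]
  filter_upwards [hyx, Tx_ae hN0 hx (PhiE_ae hN0 h0 h2 hN)] with y hyx hE
  have hy1 : 0 < ‖y - x‖ := norm_pos_iff.2 (sub_ne_zero.2 hyx)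
  set η := Tx x y with hη
  have hηx : η ≠ x := Tx_ne hx hyx
  have hη1 : 0 < ‖η - x‖ := norm_pos_iff.2 (sub_ne_zero.2 hηx)
  have hyη : y = Tx x η := (Tx_Tx hx hyx).symm
  have hyη1 : ‖y - x‖ = (1 - ‖x‖ ^ 2) / ‖η - x‖ := by
    conv_lhs => rw [hyη]
    exact Tx_norm_sub hx hηx
  have step1 : (∫⁻ z in {z : EN N | 1 < ‖z‖},
      ENNReal.ofReal (poissonBall N α 0 1 x z) * ENNReal.ofReal (rieszA N α * ‖z - y‖ ^ (α - (N:ℝ))))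
      = ENNReal.ofReal (rieszA N α * poissonCoeff N α * ‖y - x‖ ^ (α - (N:ℝ))) * PhiE N α η 1 := by
    rw [Tx_lint hN0 hx, PhiE, ← lintegral_const_mul' _ _ (by simp),
      ← lintegral_indicator (measurableSet_lt (by fun_prop) (by fun_prop))]
    have hzx : ∀ᵐ y : EN N, y ≠ x := by simp [ae_iff]
    refine lintegral_congr_ae ?_
    filter_upwards [hzx] with ζ hζ
    by_cases h : ‖ζ‖ < 1
    · have h' : ‖ζ‖ ^ 2 < 1 := by nlinarith [norm_nonneg ζ]
      have h'' : 0 < 1 - ‖ζ‖ ^ 2 := by linarith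
      have hζ1 : 0 < ‖ζ - x‖ := norm_pos_iff.2 (sub_ne_zero.2 hζ)
      have hpp : 0 ≤ poissonBall N α 0 1 x (Tx x ζ) := by
        unfold poissonBall
        rw [sub_zero, sub_zero, one_pow, Tx_norm_sq hζ]
        positivity
      rw [indicator_of_mem (by exact h), if_pos h',
        ← ENNReal.ofReal_mul hpp, ← ENNReal.ofReal_mul (by positivity), ← ENNReal.ofReal_mul (by positivity), ← ENNReal.ofReal_mul (by positivity)]
      congr 1
      unfold poissonBall
      rw [sub_zero, sub_zero, one_pow, Tx_norm_sq hζ, norm_sub_rev x, Tx_norm_sub hx hζ, hyη1]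
      conv_lhs => rw [hyη]
      rw [Tx_dist hx hζ hηx]
      have e1 : (1 - ‖x‖ ^ 2) / ((1 - ‖x‖ ^ 2) * (1 - ‖ζ‖ ^ 2) / ‖ζ - x‖ ^ 2) = ‖ζ - x‖ ^ 2 / (1 - ‖ζ‖ ^ 2) := by
        field_simp
      rw [e1, mul_rpow (by positivity) (by positivity)]
      have e2 : ((1 - ‖x‖ ^ 2) / ‖ζ - x‖ ^ 2) ^ N = ((1 - ‖x‖ ^ 2) / ‖ζ - x‖ ^ 2) ^ (N:ℝ) := by
        rw [Real.rpow_natCast]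
      rw [e2]
      suffices hs : ((1 - ‖x‖ ^ 2) / ‖ζ - x‖ ^ 2) ^ (N:ℝ) * ((‖ζ - x‖ ^ 2 / (1 - ‖ζ‖ ^ 2)) ^ (α / 2) *
          ((1 - ‖x‖ ^ 2) / ‖ζ - x‖) ^ (-(N:ℝ)) * ((1 - ‖x‖ ^ 2) / (‖ζ - x‖ * ‖η - x‖)) ^ (α - (N:ℝ)))
          = ((1 - ‖x‖ ^ 2) / ‖η - x‖) ^ (α - (N:ℝ)) * (1 - ‖ζ‖ ^ 2) ^ (-(α / 2)) by
        linear_combination rieszA N α * poissonCoeff N α * ‖ζ - η‖ ^ (α - (N:ℝ)) * hs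
      apply Real.log_injOn_pos (by simp only [mem_Ioi]; positivity) (by simp only [mem_Ioi]; positivity)
      generalize 1 - ‖x‖ ^ 2 = R at *
      generalize 1 - ‖ζ‖ ^ 2 = W at *
      generalize ‖ζ - x‖ = a at *
      generalize ‖η - x‖ = b at *
      have A : ∀ a b : ℝ, 0 < a → 0 < b → log (a * b) = log a + log b := fun a b h h' => Real.log_mul h.ne' h'.ne'
      have B : ∀ a b : ℝ, 0 < a → 0 < b → log (a / b) = log a - log b := fun a b h h' => Real.log_div h.ne' h'.ne'
      have C : ∀ a b : ℝ, 0 < a → log (a ^ b) = b * log a := fun a b h => Real.log_rpow h b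
      rw [A _ _ (by positivity) (by positivity), A _ _ (by positivity) (by positivity),
        A _ _ (by positivity) (by positivity), A _ _ (by positivity) (by positivity),
        C _ _ (by positivity), C _ _ (by positivity), C _ _ (by positivity), C _ _ (by positivity),
        C _ _ (by positivity), C _ _ (by positivity),
        B _ _ (by positivity) (by positivity), B _ _ (by positivity) (by positivity),
        B _ _ (by positivity) (by positivity), B _ _ (by positivity) (by positivity),
        B _ _ (by positivity) (by positivity), A _ _ (by positivity) (by positivity), Real.log_pow]
      push_cast
      ring
    · have h' : ¬ ‖ζ‖ ^ 2 < 1 := by nlinarith [norm_nonneg ζ]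
      rw [indicator_of_notMem (by exact h), if_neg h']
      simp
  have hnn : 0 < ‖y - x‖ ^ (α - (N:ℝ)) := by positivity
  have e3 : rieszA N α * poissonCoeff N α * ‖y - x‖ ^ (α - (N:ℝ)) * equC N α
      = greenCoeff N α * ‖y - x‖ ^ (α - (N:ℝ)) := by
    have h1 := poissonCoeff_eq h0 h2 hN
    have h2 := greenCoeff_eq h0 hN
    rw [← h2]
    linear_combination greenCoeff N α * ‖y - x‖ ^ (α - (N:ℝ)) * h1
  have hgc := greenCoeff_pos h0 hN
  have hb := betaC_pos h0 hN
  rw [step1, hE, PsiE, ← mul_assoc, ← ENNReal.ofReal_mul (by positivity), e3, norm_sub_rev x y]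
  have hV := Tx_norm_sq hyx
  rw [← hη] at hV
  have hVe : ∀ v : ℝ, ‖η‖ ^ 2 < 1 * (1 + v) ↔ (1 - ‖x‖ ^ 2) * (1 - ‖y‖ ^ 2) / ‖y - x‖ ^ 2 < v := by
    intro v; rw [← hV]; constructor <;> intro h <;> linarith
  simp_rw [hVe]
  set V := (1 - ‖x‖ ^ 2) * (1 - ‖y‖ ^ 2) / ‖y - x‖ ^ 2 with hVd
  have tot : ENNReal.ofReal (greenCoeff N α * ‖y - x‖ ^ (α - (N:ℝ))) * ∫⁻ v in Ioi (0:ℝ), ENNReal.ofReal (gdens N α v)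
      = ENNReal.ofReal (rieszA N α * ‖y - x‖ ^ (α - (N:ℝ))) := by
    rw [lint_gdens h0 hN, ← ENNReal.ofReal_mul (by positivity), ← greenCoeff_eq h0 hN]
    congr 1; ring
  by_cases hy : ‖y‖ < 1
  · have hy' := Rx_pos hy
    have hV0 : 0 < V := by positivity
    rw [greenB, if_pos ⟨hx, hy⟩, norm_sub_rev x y, ← hVd, ENNReal.ofReal_mul (by positivity : 0 ≤ greenCoeff N α * ‖y - x‖ ^ (α - (N:ℝ))),
      gdens_intervalIntegral h0 hN hV0.le, ← mul_add, ← tot]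
    congr 1
    rw [← lintegral_indicator measurableSet_Ioi, ← lintegral_indicator measurableSet_Ioi, ← lintegral_indicator measurableSet_Ioc,
      ← lintegral_add_right _ ((by fun_prop : Measurable fun v => ENNReal.ofReal (gdens N α v)).indicator measurableSet_Ioc)]
    refine lintegral_congr fun v => ?_
    simp only [indicator, mem_Ioi, mem_Ioc]
    by_cases h1 : 0 < v <;> by_cases h2 : V < v
    · simp [h1, h2]
    · simp [h1, h2, not_lt.1 h2]
    · simp [h1]
    · simp [h1]
  · have : V ≤ 0 := by
      have h1 : 1 - ‖y‖ ^ 2 ≤ 0 := by nlinarith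
      rw [hVd]
      exact div_nonpos_of_nonpos_of_nonneg (mul_nonpos_of_nonneg_of_nonpos hR.le h1) (by positivity)
    rw [greenB, if_neg (by tauto), ENNReal.ofReal_zero, add_zero, ← tot]
    congr 1
    refine setLIntegral_congr_fun measurableSet_Ioi fun v hv => ?_
    exact if_pos (lt_of_le_of_lt this hv)

lemma poissonBall_scale {N : ℕ} {α : ℝ} {a : EN N} {r : ℝ} (hr : 0 < r) (x z : EN N) :
    poissonBall N α a r (a + r • x) (a + r • z) = r ^ (-(N:ℝ)) * poissonBall N α 0 1 x z := by
  unfold poissonBall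
  have e1 : ‖a + r • x - a‖ = r * ‖x‖ := by rw [add_sub_cancel_left, norm_smul, Real.norm_of_nonneg hr.le]
  have e2 : ‖a + r • z - a‖ = r * ‖z‖ := by rw [add_sub_cancel_left, norm_smul, Real.norm_of_nonneg hr.le]
  have e3 : ‖a + r • x - (a + r • z)‖ = r * ‖x - z‖ := by
    rw [add_sub_add_left_eq_sub, ← smul_sub, norm_smul, Real.norm_of_nonneg hr.le]
  rw [e1, e2, e3, mul_rpow hr.le (norm_nonneg _), sub_zero, sub_zero]
  have e4 : (r ^ 2 - (r * ‖x‖) ^ 2) / ((r * ‖z‖) ^ 2 - r ^ 2) = (1 ^ 2 - ‖x‖ ^ 2) / (‖z‖ ^ 2 - 1 ^ 2) := by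
    rw [show r ^ 2 - (r * ‖x‖) ^ 2 = r ^ 2 * (1 ^ 2 - ‖x‖ ^ 2) by ring,
      show (r * ‖z‖) ^ 2 - r ^ 2 = r ^ 2 * (‖z‖ ^ 2 - 1 ^ 2) by ring, mul_div_mul_left _ _ (by positivity)]
  rw [e4]; ring

lemma greenBall_scale {N : ℕ} {α : ℝ} {a : EN N} {r : ℝ} (hr : 0 < r) (x z : EN N) :
    greenBall N α a r (a + r • x) (a + r • z) = r ^ (α - (N:ℝ)) * greenB N α x z := by
  unfold greenBall
  rw [add_sub_cancel_left, add_sub_cancel_left, smul_smul, smul_smul, inv_mul_cancel₀ hr.ne', one_smul, one_smul]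

/-- sweeping identity in a general ball -/
lemma sweep {N : ℕ} {α : ℝ} (hN0 : N ≠ 0) (h0 : 0 < α) (h2 : α < 2) (hN : α < N)
    {a : EN N} {r : ℝ} (hr : 0 < r) {x : EN N} (hx : x ∈ ball a r) :
    ∀ᵐ y : EN N, (∫⁻ z in {z : EN N | r < ‖z - a‖},
      ENNReal.ofReal (poissonBall N α a r x z) * ENNReal.ofReal (rieszA N α * ‖z - y‖ ^ (α - (N:ℝ))))
      + ENNReal.ofReal (greenBall N α a r x y) = ENNReal.ofReal (rieszA N α * ‖x - y‖ ^ (α - (N:ℝ))) := by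
  obtain ⟨x', rfl⟩ : ∃ x', x = a + r • x' := ⟨r⁻¹ • (x - a), by
    rw [smul_smul, mul_inv_cancel₀ hr.ne', one_smul, add_sub_cancel]⟩
  have hx' : ‖x'‖ < 1 := by
    rw [mem_ball, dist_eq_norm, add_sub_cancel_left, norm_smul, Real.norm_of_nonneg hr.le] at hx
    nlinarith
  have hA := rieszA_pos h0 hN
  have h1 := sweep1 hN0 h0 h2 hN hx'
  have q1 := (Measure.quasiMeasurePreserving_smul (volume : Measure (EN N)) (inv_ne_zero hr.ne'))
  have q2 := (measurePreserving_sub_right (volume : Measure (EN N)) a).quasiMeasurePreserving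
  filter_upwards [(q1.comp q2).ae h1] with y hy
  simp only [Function.comp_apply] at hy
  obtain ⟨y', rfl⟩ : ∃ x', y = a + r • x' := ⟨r⁻¹ • (y - a), by
    rw [smul_smul, mul_inv_cancel₀ hr.ne', one_smul, add_sub_cancel]⟩
  rw [add_sub_cancel_left, smul_smul, inv_mul_cancel₀ hr.ne', one_smul] at hy
  have e3 : ∀ x z : EN N, ‖a + r • x - (a + r • z)‖ = r * ‖x - z‖ := fun x z => by
    rw [add_sub_add_left_eq_sub, ← smul_sub, norm_smul, Real.norm_of_nonneg hr.le]
  have hrp : 0 < r ^ (α - (N:ℝ)) := by positivity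
  rw [greenBall_scale hr, e3, mul_rpow hr.le (norm_nonneg _), ENNReal.ofReal_mul hrp.le,
    show rieszA N α * (r ^ (α - (N:ℝ)) * ‖x' - y'‖ ^ (α - (N:ℝ))) = r ^ (α - (N:ℝ)) * (rieszA N α * ‖x' - y'‖ ^ (α - (N:ℝ))) by ring,
    ENNReal.ofReal_mul hrp.le, ← hy, mul_add]
  congr 1
  rw [← lintegral_indicator (measurableSet_lt (by fun_prop) (by fun_prop)),
    ← lintegral_indicator (measurableSet_lt (by fun_prop) (by fun_prop)), lint_scale hr a,
    ← lintegral_const_mul' _ _ (by simp), ← lintegral_const_mul' _ _ (by simp)]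
  refine lintegral_congr fun z => ?_
  have hiff : r < ‖a + r • z - a‖ ↔ 1 < ‖z‖ := by
    rw [add_sub_cancel_left, norm_smul, Real.norm_of_nonneg hr.le]
    exact lt_mul_iff_one_lt_right hr
  by_cases h : 1 < ‖z‖
  · rw [indicator_of_mem (by exact hiff.2 h), indicator_of_mem (by exact h), poissonBall_scale hr, e3,
      mul_rpow hr.le (norm_nonneg _), ENNReal.ofReal_mul (by positivity : 0 ≤ r ^ (-(N:ℝ))),
      show rieszA N α * (r ^ (α - (N:ℝ)) * ‖z - y'‖ ^ (α - (N:ℝ))) = r ^ (α - (N:ℝ)) * (rieszA N α * ‖z - y'‖ ^ (α - (N:ℝ))) by ring,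
      ENNReal.ofReal_mul hrp.le]
    have : ENNReal.ofReal (r ^ N) * ENNReal.ofReal (r ^ (-(N:ℝ))) = 1 := by
      rw [← ENNReal.ofReal_mul (by positivity), ← Real.rpow_natCast, ← Real.rpow_add hr]
      simp
    calc _ = (ENNReal.ofReal (r ^ N) * ENNReal.ofReal (r ^ (-(N:ℝ)))) * (ENNReal.ofReal (r ^ (α - (N:ℝ))) * 
        (ENNReal.ofReal (poissonBall N α 0 1 x' z) * ENNReal.ofReal (rieszA N α * ‖z - y'‖ ^ (α - (N:ℝ))))) := by ring
      _ = _ := by rw [this, one_mul]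
  · rw [indicator_of_notMem (by exact fun h' => h (hiff.1 h')), indicator_of_notMem (by exact h)]
    simp

lemma poissonBall_meas (N : ℕ) (α : ℝ) (a : EN N) (r : ℝ) :
    Measurable (fun p : EN N × EN N => poissonBall N α a r p.1 p.2) := by
  unfold poissonBall; fun_prop

lemma poissonBall_nonneg {N : ℕ} {α : ℝ} (h0 : 0 < α) (h2 : α < 2) (hN : α < N) {a : EN N} {r : ℝ}
    (hr : 0 < r) {x y : EN N} (hx : x ∈ ball a r) (hy : r < ‖y - a‖) : 0 ≤ poissonBall N α a r x y := by
  have := poissonCoeff_pos h0 h2 hN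
  rw [mem_ball, dist_eq_norm] at hx
  have h3 : 0 < r ^ 2 - ‖x - a‖ ^ 2 := by nlinarith [norm_nonneg (x - a)]
  have h4 : 0 < ‖y - a‖ ^ 2 - r ^ 2 := by nlinarith
  unfold poissonBall; positivity

def FV (N : ℕ) (α V : ℝ) : ℝ := (∫⁻ v in Ioi (0:ℝ), if v ≤ V then ENNReal.ofReal (gdens N α v) else 0).toReal

lemma FV_meas (N : ℕ) (α : ℝ) : Measurable (FV N α) := by
  unfold FV
  have := gdens_meas N α
  refine Measurable.ennreal_toReal ?_
  apply Measurable.lintegral_prod_right' (f := fun q : ℝ × ℝ =>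
    if q.2 ≤ q.1 then ENNReal.ofReal (gdens N α q.2) else 0)
  refine (Measurable.ite ?_ (by fun_prop) (by fun_prop)) 
  exact measurableSet_le (by fun_prop) (by fun_prop)

lemma FV_le {N : ℕ} {α : ℝ} (h0 : 0 < α) (hN : α < N) (V : ℝ) : FV N α V ≤ betaC N α := by
  unfold FV
  have : ∫⁻ v in Ioi (0:ℝ), (if v ≤ V then ENNReal.ofReal (gdens N α v) else 0) ≤ ENNReal.ofReal (betaC N α) := by
    rw [← lint_gdens h0 hN]
    refine lintegral_mono fun v => ?_
    dsimp only; split_ifs <;> simp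
  exact ENNReal.toReal_le_of_le_ofReal (betaC_pos h0 hN).le this

lemma FV_nonneg (N : ℕ) (α V : ℝ) : 0 ≤ FV N α V := ENNReal.toReal_nonneg

lemma FV_eq {N : ℕ} {α : ℝ} (h0 : 0 < α) (hN : α < N) {V : ℝ} (hV : 0 ≤ V) :
    ∫ s in (0:ℝ)..V, s ^ (α / 2 - 1) * (1 + s) ^ (-(N : ℝ) / 2) = FV N α V := by
  have h := gdens_intervalIntegral h0 hN hV
  have hnn : 0 ≤ ∫ s in (0:ℝ)..V, s ^ (α / 2 - 1) * (1 + s) ^ (-(N : ℝ) / 2) := by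
    rw [intervalIntegral.integral_of_le hV]
    exact setIntegral_nonneg measurableSet_Ioc fun v hv => gdens_nonneg N α (le_of_lt hv.1)
  rw [← ENNReal.toReal_ofReal hnn, h, FV]
  congr 1
  rw [← lintegral_indicator measurableSet_Ioc, ← lintegral_indicator measurableSet_Ioi]
  refine lintegral_congr fun v => ?_
  by_cases h1 : 0 < v <;> by_cases h2 : v ≤ V <;> simp [indicator, h1, h2]

lemma greenB_eq {N : ℕ} {α : ℝ} (h0 : 0 < α) (hN : α < N) (x y : EN N) : greenB N α x y =
    if ‖x‖ < 1 ∧ ‖y‖ < 1 then greenCoeff N α * ‖x - y‖ ^ (α - (N : ℝ)) *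
      FV N α ((1 - ‖x‖ ^ 2) * (1 - ‖y‖ ^ 2) / ‖x - y‖ ^ 2) else 0 := by
  unfold greenB
  split_ifs with h
  · rw [FV_eq h0 hN]
    have := Rx_pos h.1
    have := Rx_pos h.2
    positivity
  · rfl

lemma greenB_nonneg {N : ℕ} {α : ℝ} (h0 : 0 < α) (hN : α < N) (x y : EN N) : 0 ≤ greenB N α x y := by
  rw [greenB_eq h0 hN]
  have := greenCoeff_pos h0 hN
  have := FV_nonneg N α ((1 - ‖x‖ ^ 2) * (1 - ‖y‖ ^ 2) / ‖x - y‖ ^ 2)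
  split_ifs <;> positivity

lemma greenB_le {N : ℕ} {α : ℝ} (h0 : 0 < α) (hN : α < N) (x y : EN N) :
    greenB N α x y ≤ rieszA N α * ‖x - y‖ ^ (α - (N:ℝ)) := by
  have hA := rieszA_pos h0 hN
  have := greenCoeff_pos h0 hN
  rw [greenB_eq h0 hN]
  split_ifs
  · rw [← greenCoeff_eq h0 hN]
    have := FV_le h0 hN ((1 - ‖x‖ ^ 2) * (1 - ‖y‖ ^ 2) / ‖x - y‖ ^ 2)
    calc _ ≤ greenCoeff N α * ‖x - y‖ ^ (α - (N : ℝ)) * betaC N α := by gcongr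
      _ = _ := by ring
  · positivity

lemma greenB_meas {N : ℕ} {α : ℝ} (h0 : 0 < α) (hN : α < N) :
    Measurable (fun p : EN N × EN N => greenB N α p.1 p.2) := by
  simp_rw [greenB_eq h0 hN]
  have := FV_meas N α
  refine Measurable.ite ?_ (by fun_prop) (by fun_prop)
  have m1 : MeasurableSet {p : EN N × EN N | ‖p.1‖ < 1} := measurableSet_lt (by fun_prop) (by fun_prop)
  have m2 : MeasurableSet {p : EN N × EN N | ‖p.2‖ < 1} := measurableSet_lt (by fun_prop) (by fun_prop)
  exact m1.inter m2

lemma greenB_symm {N : ℕ} {α : ℝ} (x y : EN N) : greenB N α x y = greenB N α y x := by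
  unfold greenB
  simp only [and_comm, norm_sub_rev x y, mul_comm (1 - ‖x‖ ^ 2)]

lemma greenBall_symm {N : ℕ} {α : ℝ} (a : EN N) (r : ℝ) (x y : EN N) :
    greenBall N α a r x y = greenBall N α a r y x := by
  unfold greenBall; rw [greenB_symm]

lemma greenBall_nonneg {N : ℕ} {α : ℝ} (h0 : 0 < α) (hN : α < N) (a : EN N) {r : ℝ} (hr : 0 < r) (x y : EN N) :
    0 ≤ greenBall N α a r x y := by
  have := greenB_nonneg h0 hN (r⁻¹ • (x - a)) (r⁻¹ • (y - a))
  unfold greenBall; positivity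

lemma greenBall_le {N : ℕ} {α : ℝ} (h0 : 0 < α) (hN : α < N) (a : EN N) {r : ℝ} (hr : 0 < r) (x y : EN N) :
    greenBall N α a r x y ≤ rieszA N α * ‖x - y‖ ^ (α - (N:ℝ)) := by
  have := greenB_le h0 hN (r⁻¹ • (x - a)) (r⁻¹ • (y - a))
  unfold greenBall
  rw [← smul_sub, sub_sub_sub_cancel_right, norm_smul, Real.norm_of_nonneg (by positivity),
    mul_rpow (by positivity) (norm_nonneg _)] at this
  calc _ ≤ r ^ (α - (N:ℝ)) * (rieszA N α * (r⁻¹ ^ (α - (N:ℝ)) * ‖x - y‖ ^ (α - (N:ℝ)))) := by gcongr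
    _ = (r ^ (α - (N:ℝ)) * r⁻¹ ^ (α - (N:ℝ))) * (rieszA N α * ‖x - y‖ ^ (α - (N:ℝ))) := by ring
    _ = _ := by rw [← mul_rpow hr.le (by positivity), mul_inv_cancel₀ hr.ne', one_rpow, one_mul]

lemma greenBall_meas {N : ℕ} {α : ℝ} (h0 : 0 < α) (hN : α < N) (a : EN N) (r : ℝ) :
    Measurable (fun p : EN N × EN N => greenBall N α a r p.1 p.2) := by
  unfold greenBall
  refine Measurable.const_mul ?_ _
  exact (greenB_meas h0 hN).comp (g := fun p : EN N × EN N => greenB N α p.1 p.2)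
    (f := fun p : EN N × EN N => (r⁻¹ • (p.1 - a), r⁻¹ • (p.2 - a))) (by fun_prop)

lemma greenBall_zero {N : ℕ} {α : ℝ} (a : EN N) {r : ℝ} (hr : 0 < r) (x : EN N) {y : EN N} (hy : y ∉ ball a r) :
    greenBall N α a r x y = 0 := by
  unfold greenBall greenB
  rw [if_neg, mul_zero]
  rintro ⟨-, h⟩
  apply hy
  rw [norm_smul, Real.norm_of_nonneg (by positivity), inv_mul_lt_iff₀ hr, mul_one] at h
  rwa [mem_ball, dist_eq_norm]

/-- symmetric second difference -/
def D2 {N : ℕ} (w : EN N → ℝ) (y h : EN N) : ℝ := w (y + h) + w (y - h) - 2 * w y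

/-- test functions -/
def Tst {N : ℕ} (w : EN N → ℝ) : Prop := ContDiff ℝ (⊤ : ℕ∞) w ∧ HasCompactSupport w

lemma Tst.bdd {N : ℕ} {w : EN N → ℝ} (hw : Tst w) : ∃ M, 0 < M ∧ ∀ y, |w y| ≤ M := by
  obtain ⟨C, hC⟩ := hw.2.exists_bound_of_continuous hw.1.continuous
  exact ⟨max C 1, by positivity, fun y => (hC y).trans (le_max_left _ _)⟩

lemma Tst.integrable {N : ℕ} {w : EN N → ℝ} (hw : Tst w) : Integrable w :=
  hw.1.continuous.integrable_of_hasCompactSupport hw.2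

lemma Tst.supp {N : ℕ} {w : EN N → ℝ} (hw : Tst w) : ∃ ρ, 1 ≤ ρ ∧ ∀ y, ρ < ‖y‖ → w y = 0 := by
  obtain ⟨ρ, hρ⟩ := hw.2.isBounded.subset_closedBall 0
  refine ⟨max ρ 1, le_max_right _ _, fun y hy => ?_⟩
  by_contra h
  have := hρ (subset_tsupport _ (Function.mem_support.2 h))
  rw [mem_closedBall, dist_zero_right] at this
  exact absurd (this.trans (le_max_left _ 1)) (not_le.2 hy)

lemma Tst.lip_taylor {N : ℕ} {w : EN N → ℝ} (hw : Tst w) : ∃ L, 0 ≤ L ∧ ∀ y h, 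
    |w (y + h) - w y - fderiv ℝ w y h| ≤ L * ‖h‖ ^ 2 := by
  have h1 : ContDiff ℝ 1 (fderiv ℝ w) := hw.1.fderiv_right (m := 1) (by
    have h : ((2:ℕ∞)) ≤ ⊤ := le_top
    have h' : (((2:ℕ∞)) : WithTop ℕ∞) ≤ ((⊤ : ℕ∞) : WithTop ℕ∞) := WithTop.coe_le_coe.2 h
    refine le_trans (le_of_eq ?_) h'
    norm_num)
  obtain ⟨L, hL⟩ := ContDiff.lipschitzWith_of_hasCompactSupport (𝕂 := ℝ) (hw.2.fderiv ℝ) h1 (by simp)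
  have hd : Differentiable ℝ w := hw.1.differentiable (by simp)
  refine ⟨L, L.2, fun y h => ?_⟩
  have := Convex.norm_image_sub_le_of_norm_hasFDerivWithin_le' (f := w) (f' := fderiv ℝ w)
    (s := closedBall y ‖h‖) (φ := fderiv ℝ w y) (C := L * ‖h‖) (x := y) (y := y + h)
    (fun z _ => (hd z).hasFDerivAt.hasFDerivWithinAt) (fun z hz => ?_) (convex_closedBall _ _)
    (by simp) (by simp)
  · rw [add_sub_cancel_left] at this
    rw [← Real.norm_eq_abs, pow_two, ← mul_assoc]
    exact this
  · rw [← dist_eq_norm]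
    refine (hL.dist_le_mul z y).trans ?_
    have : dist z y ≤ ‖h‖ := hz
    gcongr

lemma Tst.D2_bound {N : ℕ} {w : EN N → ℝ} (hw : Tst w) : ∃ C, 0 < C ∧ ∀ y h, 
    |D2 w y h| ≤ C * min (‖h‖ ^ 2) 1 := by
  obtain ⟨L, hL0, hL⟩ := hw.lip_taylor
  obtain ⟨M, hM0, hM⟩ := hw.bdd
  refine ⟨2 * L + 4 * M, by positivity, fun y h => ?_⟩
  rw [mul_min_of_nonneg _ _ (by positivity), le_min_iff]
  constructor
  · have h1 := hL y h
    have h2 := hL y (-h)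
    rw [← sub_eq_add_neg, map_neg, norm_neg] at h2
    rw [abs_le] at h1 h2 ⊢
    unfold D2
    have := mul_nonneg hM0.le (sq_nonneg ‖h‖)
    constructor <;> nlinarith
  · have h1 := hM (y + h)
    have h2 := hM (y - h)
    have h3 := hM y
    rw [abs_le] at h1 h2 h3 ⊢
    unfold D2
    constructor <;> nlinarith

lemma D2_meas {N : ℕ} {w : EN N → ℝ} (hw : Measurable w) :
    Measurable (fun p : EN N × EN N => D2 w p.1 p.2) := by
  unfold D2; fun_prop

lemma riesz_locInt {N : ℕ} {α : ℝ} (hN0 : N ≠ 0) (h0 : 0 < α) :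
    LocallyIntegrable (fun x : EN N => ‖x‖ ^ (α - (N:ℝ))) := by
  have : Nonempty (Fin N) := ⟨⟨0, Nat.pos_of_ne_zero hN0⟩⟩
  refine locallyIntegrable_of_norm_le_rpow (C := 1) (α := (N:ℝ) - α) ?_ ?_ (ae_of_all _ fun x => ?_) ?_
  · rw [finrank_euclideanSpace]; simp; omega
  · rw [finrank_euclideanSpace]; simp; exact h0
  · rw [Real.norm_of_nonneg (by positivity), neg_sub, one_mul]
  · exact Measurable.aestronglyMeasurable (by fun_prop)

lemma weight_int {N : ℕ} {α : ℝ} (h0 : 0 < α) :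
    Integrable (fun x : EN N => (1 + ‖x‖) ^ (-((N:ℝ) + α))) := by
  apply integrable_one_add_norm
  rw [finrank_euclideanSpace]; simp; exact h0

lemma minw_int {N : ℕ} {α : ℝ} (hN0 : N ≠ 0) (h0 : 0 < α) (h2 : α < 2) :
    Integrable (fun x : EN N => min (‖x‖ ^ 2) 1 * ‖x‖ ^ (-((N:ℝ) + α))) := by
  have hI : IntegrableOn (fun x : EN N => ‖x‖ ^ ((2 - α) - (N:ℝ))) (closedBall 0 1) :=
    (riesz_locInt hN0 (by linarith)).integrableOn_isCompact (isCompact_closedBall 0 1)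
  have hI' := (integrable_indicator_iff measurableSet_closedBall).2 hI
  refine (hI'.add ((weight_int h0).const_mul (2 ^ ((N:ℝ) + α)))).mono' (Measurable.aestronglyMeasurable (by fun_prop)) (ae_of_all _ fun x => ?_)
  rw [Real.norm_of_nonneg (by positivity), Pi.add_apply]
  by_cases hx : ‖x‖ ≤ 1
  · rw [indicator_of_mem (by simpa using hx)]
    refine le_add_of_le_of_nonneg ?_ (by positivity)
    rcases eq_or_lt_of_le (norm_nonneg x) with h | h
    · rw [← h]; simp; positivity
    · rw [show 2 - α - (N:ℝ) = (2:ℕ) + (-((N:ℝ) + α)) by push_cast; ring, Real.rpow_add h, Real.rpow_natCast]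
      gcongr
      exact min_le_left _ _
  · rw [indicator_of_notMem (by simpa using hx), zero_add]
    push Not at hx
    have : ‖x‖ ^ (-((N:ℝ) + α)) ≤ 2 ^ ((N:ℝ) + α) * (1 + ‖x‖) ^ (-((N:ℝ) + α)) := by
      have : ‖x‖ ^ (-((N:ℝ) + α)) ≤ ((1 + ‖x‖) / 2) ^ (-((N:ℝ) + α)) := by
        apply Real.rpow_le_rpow_of_nonpos (by positivity) (by linarith)
        have : (0:ℝ) ≤ N := by positivity
        linarith
      refine this.trans (le_of_eq ?_)
      rw [div_rpow (by positivity) (by positivity), Real.rpow_neg (by positivity) (x := 2)]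
      field_simp
    refine le_trans ?_ this
    calc _ ≤ 1 * ‖x‖ ^ (-((N:ℝ) + α)) := by gcongr; exact min_le_right _ _
      _ = _ := one_mul _

lemma riesz_weight_int {N : ℕ} {α : ℝ} (hN0 : N ≠ 0) (h0 : 0 < α) (hN : α < N) :
    Integrable (fun x : EN N => ‖x‖ ^ (α - (N:ℝ)) * (1 + ‖x‖) ^ (-((N:ℝ) + α))) := by
  have hI : IntegrableOn (fun x : EN N => ‖x‖ ^ (α - (N:ℝ))) (closedBall 0 1) :=
    (riesz_locInt hN0 h0).integrableOn_isCompact (isCompact_closedBall 0 1)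
  have hI' := (integrable_indicator_iff measurableSet_closedBall).2 hI
  refine (hI'.add ((weight_int h0))).mono' (Measurable.aestronglyMeasurable (by fun_prop)) (ae_of_all _ fun x => ?_)
  rw [Real.norm_of_nonneg (by positivity), Pi.add_apply]
  have : (0:ℝ) ≤ N := by positivity
  by_cases hx : ‖x‖ ≤ 1
  · rw [indicator_of_mem (by simpa using hx)]
    refine le_add_of_le_of_nonneg (mul_le_of_le_one_right (by positivity) ?_) (by positivity)
    apply Real.rpow_le_one_of_one_le_of_nonpos <;> linarith [norm_nonneg x]
  · rw [indicator_of_notMem (by simpa using hx), zero_add]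
    push Not at hx
    apply mul_le_of_le_one_left (by positivity)
    apply Real.rpow_le_one_of_one_le_of_nonpos <;> linarith [norm_nonneg x]

/-- absolute integral of second difference -/
def JD (N : ℕ) (α : ℝ) (w : EN N → ℝ) (y : EN N) : ℝ≥0∞ :=
  ∫⁻ h : EN N, ENNReal.ofReal (|D2 w y h| * ‖h‖ ^ (-((N:ℝ) + α)))

lemma Tst.D2_integrable {N : ℕ} {α : ℝ} (hN0 : N ≠ 0) (h0 : 0 < α) (h2 : α < 2) {w : EN N → ℝ} (hw : Tst w) (y : EN N) :
    Integrable (fun h : EN N => D2 w y h * ‖h‖ ^ (-((N:ℝ) + α))) := by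
  obtain ⟨C, hC0, hC⟩ := hw.D2_bound
  have hm := hw.1.continuous.measurable
  refine ((minw_int hN0 h0 h2).const_mul C).mono' (Measurable.aestronglyMeasurable (by unfold D2; fun_prop)) (ae_of_all _ fun h => ?_)
  rw [norm_mul, Real.norm_of_nonneg (by positivity : 0 ≤ ‖h‖ ^ (-((N:ℝ) + α))), ← mul_assoc]
  gcongr
  exact hC y h

set_option maxHeartbeats 800000 in
lemma Tst.JD_bound {N : ℕ} {α : ℝ} (hN0 : N ≠ 0) (h0 : 0 < α) (h2 : α < 2) {w : EN N → ℝ} (hw : Tst w) :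
    ∃ C, 0 < C ∧ ∀ y, JD N α w y ≤ ENNReal.ofReal (C * (1 + ‖y‖) ^ (-((N:ℝ) + α))) := by
  obtain ⟨C, hC0, hC⟩ := hw.D2_bound
  obtain ⟨ρ, hρ1, hρ⟩ := hw.supp
  have hm := hw.1.continuous.measurable
  have hNn : (0:ℝ) ≤ N := by positivity
  set I := ∫ x : EN N, min (‖x‖ ^ 2) 1 * ‖x‖ ^ (-((N:ℝ) + α)) with hI
  have hI0 : 0 ≤ I := integral_nonneg fun x => by positivity
  set W := ∫ x : EN N, |w x| with hW
  have hW0 : 0 ≤ W := integral_nonneg fun x => by positivity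
  have b1 : ∀ y, JD N α w y ≤ ENNReal.ofReal (C * I) := by
    intro y
    rw [hI, ← integral_const_mul, ofReal_integral_eq_lintegral_ofReal ((minw_int hN0 h0 h2).const_mul C)
      (ae_of_all _ fun x => by positivity)]
    refine lintegral_mono fun h => ENNReal.ofReal_le_ofReal ?_
    rw [← mul_assoc]
    gcongr
    exact hC y h
  have b2 : ∀ y, 2 * ρ < ‖y‖ → JD N α w y ≤ ENNReal.ofReal (2 * (‖y‖ / 2) ^ (-((N:ℝ) + α)) * W) := by
    intro y hy
    have hy0 : 0 < ‖y‖ := by linarith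
    have i1 : Integrable (fun h => |w (y + h)|) := hw.integrable.abs.comp_add_left y
    have i2 : Integrable (fun h => |w (y - h)|) := hw.integrable.abs.comp_sub_left y
    have e1 : ∫ h, (|w (y + h)| + |w (y - h)|) = 2 * W := by
      rw [integral_add i1 i2, integral_add_left_eq_self (fun h => |w h|), integral_sub_left_eq_self (fun h => |w h|)]
      ring
    have i3 : Integrable (fun h => (‖y‖ / 2) ^ (-((N:ℝ) + α)) * (|w (y + h)| + |w (y - h)|)) :=
      (i1.add i2).const_mul _
    rw [show 2 * (‖y‖ / 2) ^ (-((N:ℝ) + α)) * W = ∫ h, (‖y‖ / 2) ^ (-((N:ℝ) + α)) * (|w (y + h)| + |w (y - h)|) by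
      rw [integral_const_mul, e1]; ring, ofReal_integral_eq_lintegral_ofReal i3
      (ae_of_all _ fun x => by positivity)]
    refine lintegral_mono fun h => ENNReal.ofReal_le_ofReal ?_
    have hwy : w y = 0 := hρ y (by linarith)
    by_cases hh : ‖h‖ < ‖y‖ / 2
    · have h1 : w (y + h) = 0 := by
        apply hρ
        have := norm_sub_le_norm_add y h
        linarith
      have h2 : w (y - h) = 0 := by
        apply hρ
        have := norm_sub_norm_le y h
        linarith
      simp [D2, hwy, h1, h2]
    · push Not at hh
      have a1 : |D2 w y h| ≤ |w (y + h)| + |w (y - h)| := by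
        unfold D2; rw [hwy, mul_zero, sub_zero]; exact abs_add_le _ _
      have a2 : ‖h‖ ^ (-((N:ℝ) + α)) ≤ (‖y‖ / 2) ^ (-((N:ℝ) + α)) :=
        Real.rpow_le_rpow_of_nonpos (by positivity) hh (by linarith)
      rw [mul_comm]
      gcongr
  have hρ0 : 0 < ρ := by linarith
  clear_value I W
  set E := (N:ℝ) + α with hE
  have hEp : 0 < E := by positivity
  refine ⟨(C * I + 1) * (1 + 2 * ρ) ^ E + 2 * 4 ^ E * W, by positivity, fun y => ?_⟩
  rcases le_or_gt ‖y‖ (2 * ρ) with hy | hy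
  · refine (b1 y).trans (ENNReal.ofReal_le_ofReal ?_)
    have h1 : 1 ≤ (1 + 2 * ρ) ^ E * (1 + ‖y‖) ^ (-E) := by
      rw [Real.rpow_neg (by positivity), ← div_eq_mul_inv, ← div_rpow (by positivity) (by positivity)]
      apply Real.one_le_rpow _ hEp.le
      rw [one_le_div (by positivity)]; linarith
    calc C * I ≤ (C * I + 1) * ((1 + 2 * ρ) ^ E * (1 + ‖y‖) ^ (-E)) + 0 := by
          nlinarith [mul_nonneg hC0.le hI0]
      _ ≤ (C * I + 1) * ((1 + 2 * ρ) ^ E * (1 + ‖y‖) ^ (-E)) + 2 * 4 ^ E * W * (1 + ‖y‖) ^ (-E) := by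
          gcongr; positivity
      _ = _ := by ring
  · refine (b2 y hy).trans (ENNReal.ofReal_le_ofReal ?_)
    have hy0 : 0 < ‖y‖ := by linarith
    have h1 : (‖y‖ / 2) ^ (-E) ≤ 4 ^ E * (1 + ‖y‖) ^ (-E) := by
      have : (‖y‖ / 2) ^ (-E) ≤ ((1 + ‖y‖) / 4) ^ (-E) := by
        apply Real.rpow_le_rpow_of_nonpos (by positivity) (by linarith) (by linarith)
      refine this.trans (le_of_eq ?_)
      rw [div_rpow (by positivity) (by positivity), Real.rpow_neg (by positivity) (x := 4)]
      field_simp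
    have h3 : 0 ≤ (C * I + 1) * (1 + 2 * ρ) ^ E * (1 + ‖y‖) ^ (-E) :=
      mul_nonneg (mul_nonneg (by nlinarith [mul_nonneg hC0.le hI0]) (Real.rpow_nonneg (by linarith) _)) (Real.rpow_nonneg (by linarith) _)
    have h4 := mul_le_mul_of_nonneg_right h1 hW0
    rw [add_mul]
    linarith [h3, h4]

/-- absolutely convergent form of the fractional Laplacian -/
def FL (N : ℕ) (α : ℝ) (w : EN N → ℝ) (y : EN N) : ℝ :=
  fracLapCoeff N α / 2 * ∫ h : EN N, D2 w y h * ‖h‖ ^ (-((N:ℝ) + α))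

lemma Tst.hasFracLap {N : ℕ} {α : ℝ} (hN0 : N ≠ 0) (h0 : 0 < α) (h2 : α < 2) {w : EN N → ℝ} (hw : Tst w) (y : EN N) :
    HasFracLap N α w y (FL N α w y) := by
  obtain ⟨M, hM0, hM⟩ := hw.bdd
  have hm := hw.1.continuous.measurable
  unfold HasFracLap FL
  have key : ∀ ε : ℝ, 0 < ε → ∫ z in {z : EN N | ε < dist z y}, (w z - w y) / dist z y ^ ((N : ℝ) + α)
      = 1 / 2 * ∫ h, ({h : EN N | ε < ‖h‖}).indicator (fun h => D2 w y h * ‖h‖ ^ (-((N:ℝ) + α))) h := by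
    intro ε hε
    have hms : MeasurableSet {h : EN N | ε < ‖h‖} := measurableSet_lt measurable_const measurable_norm
    have hms' : MeasurableSet {z : EN N | ε < dist z y} :=
      measurableSet_lt measurable_const (measurable_id.dist measurable_const)
    set g : EN N → ℝ := ({h : EN N | ε < ‖h‖}).indicator (fun h => (w (y + h) - w y) * ‖h‖ ^ (-((N:ℝ) + α))) with hg
    have e1 : ∫ z in {z : EN N | ε < dist z y}, (w z - w y) / dist z y ^ ((N : ℝ) + α) = ∫ h, g h := by
      rw [← integral_indicator hms', ← integral_add_left_eq_self _ y]
      congr 1; ext h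
      by_cases hh : ε < ‖h‖
      · rw [hg, indicator_of_mem (by simpa using hh), indicator_of_mem (by simpa using hh)]
        rw [Real.rpow_neg (norm_nonneg _), dist_eq_norm, add_sub_cancel_left, div_eq_mul_inv]
      · rw [hg, indicator_of_notMem (by simpa using hh), indicator_of_notMem (by simpa using hh)]
    have hgi : Integrable g := by
      refine ((minw_int hN0 h0 h2).const_mul (2 * M / min (ε ^ 2) 1)).mono' (Measurable.aestronglyMeasurable ?_) (ae_of_all _ fun h => ?_)
      · exact Measurable.indicator (by fun_prop) hms
      · by_cases hh : ε < ‖h‖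
        · rw [hg, indicator_of_mem (by simpa using hh), norm_mul, Real.norm_of_nonneg (by positivity : 0 ≤ ‖h‖ ^ (-((N:ℝ) + α))), ← mul_assoc]
          gcongr
          have hp : 0 < min (ε ^ 2) 1 := by positivity
          have h1 : min (ε ^ 2) 1 ≤ min (‖h‖ ^ 2) 1 := by gcongr
          have h3 : |w (y + h) - w y| ≤ 2 * M := by
            have := hM (y + h)
            have := hM y
            rw [abs_le] at *
            constructor <;> linarith
          rw [Real.norm_eq_abs]
          calc _ ≤ 2 * M := h3
            _ = 2 * M / min (ε ^ 2) 1 * min (ε ^ 2) 1 := by field_simp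
            _ ≤ _ := by gcongr
        · rw [hg, indicator_of_notMem (by simpa using hh)]
          simp only [norm_zero]; positivity
    have e2 : ∫ h, g h = ∫ h, g (-h) := (integral_neg_eq_self g volume).symm
    have e3 : (∫ h, g h) + ∫ h, g (-h) = ∫ h, ({h : EN N | ε < ‖h‖}).indicator (fun h => D2 w y h * ‖h‖ ^ (-((N:ℝ) + α))) h := by
      rw [← integral_add hgi hgi.comp_neg]
      congr 1; ext h
      by_cases hh : ε < ‖h‖
      · rw [hg, indicator_of_mem (by simpa using hh), indicator_of_mem (by simpa using hh), indicator_of_mem (by simpa using hh), norm_neg, D2, ← sub_eq_add_neg]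
        ring
      · rw [hg, indicator_of_notMem (by simpa using hh), indicator_of_notMem (by simpa using hh), indicator_of_notMem (by simpa using hh)]
        simp
    rw [e1, ← e3, ← e2]; ring
  have hlim : Tendsto (fun ε : ℝ => ∫ h, ({h : EN N | ε < ‖h‖}).indicator (fun h => D2 w y h * ‖h‖ ^ (-((N:ℝ) + α))) h)
      (𝓝[>] (0 : ℝ)) (𝓝 (∫ h, D2 w y h * ‖h‖ ^ (-((N:ℝ) + α)))) := by
    have hD2i := hw.D2_integrable hN0 h0 h2 y
    refine tendsto_integral_filter_of_dominated_convergence (fun h => ‖D2 w y h * ‖h‖ ^ (-((N:ℝ) + α))‖) ?_ ?_ hD2i.norm ?_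
    · exact Eventually.of_forall fun ε => hD2i.1.indicator (measurableSet_lt measurable_const measurable_norm)
    · exact Eventually.of_forall fun ε => ae_of_all _ fun h => norm_indicator_le_norm_self _ _
    · refine ae_of_all _ fun h => ?_
      rcases eq_or_lt_of_le (norm_nonneg h) with hh | hh
      · have : h = 0 := norm_eq_zero.1 hh.symm
        refine tendsto_const_nhds.congr' ?_
        refine Eventually.of_forall fun ε => ?_
        rw [this]; beta_reduce
        have hz : D2 w y 0 = 0 := by simp [D2]; ring
        by_cases hc : (0:EN N) ∈ {h : EN N | ε < ‖h‖}
        · rw [indicator_of_mem hc]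
        · rw [indicator_of_notMem hc, hz, zero_mul]
      · refine tendsto_const_nhds.congr' ?_
        filter_upwards [nhdsWithin_le_nhds (Iio_mem_nhds hh)] with ε hε
        rw [indicator_of_mem (by simpa using hε)]
  have := hlim.const_mul (fracLapCoeff N α / 2)
  refine this.congr' ?_
  filter_upwards [self_mem_nhdsWithin] with ε hε
  rw [key ε hε]; ring

lemma Tst.fracLap_eq {N : ℕ} {α : ℝ} (hN0 : N ≠ 0) (h0 : 0 < α) (h2 : α < 2) {w : EN N → ℝ} (hw : Tst w) (y : EN N) :
    fracLap N α w y = FL N α w y := by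
  have h := hw.hasFracLap hN0 h0 h2 y
  unfold fracLap
  have he : ∃ L, HasFracLap N α w y L := ⟨_, h⟩
  rw [dif_pos he]
  exact tendsto_nhds_unique he.choose_spec h

lemma Tst.FL_bound {N : ℕ} {α : ℝ} (hN0 : N ≠ 0) (h0 : 0 < α) (h2 : α < 2) {w : EN N → ℝ} (hw : Tst w) :
    ∃ C, 0 < C ∧ ∀ y, |FL N α w y| ≤ C * (1 + ‖y‖) ^ (-((N:ℝ) + α)) := by
  obtain ⟨C, hC0, hC⟩ := hw.JD_bound hN0 h0 h2
  refine ⟨(|fracLapCoeff N α / 2| + 1) * C, by positivity, fun y => ?_⟩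
  unfold FL
  rw [abs_mul]
  have h1 : |∫ h : EN N, D2 w y h * ‖h‖ ^ (-((N:ℝ) + α))| ≤ C * (1 + ‖y‖) ^ (-((N:ℝ) + α)) := by
    rw [← Real.norm_eq_abs]
    refine (norm_integral_le_lintegral_norm _).trans ?_
    refine ENNReal.toReal_le_of_le_ofReal (by positivity) (le_trans (le_of_eq ?_) (hC y))
    unfold JD
    congr 1; ext h
    rw [norm_mul, Real.norm_eq_abs, Real.norm_of_nonneg (by positivity : 0 ≤ ‖h‖ ^ (-((N:ℝ) + α)))]
  rw [mul_assoc]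
  have h3 : 0 ≤ C * (1 + ‖y‖) ^ (-((N:ℝ) + α)) := by positivity
  calc _ ≤ |fracLapCoeff N α / 2| * (C * (1 + ‖y‖) ^ (-((N:ℝ) + α))) := by gcongr
    _ ≤ _ := by nlinarith

lemma FL_meas {N : ℕ} {α : ℝ} {w : EN N → ℝ} (hw : Measurable w) : Measurable (FL N α w) := by
  unfold FL
  apply Measurable.const_mul
  have : StronglyMeasurable (Function.uncurry fun (y h : EN N) => D2 w y h * ‖h‖ ^ (-((N:ℝ) + α))) := by
    apply Measurable.stronglyMeasurable
    unfold D2 Function.uncurry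
    fun_prop
  exact this.integral_prod_right.measurable

lemma FL_trans {N : ℕ} {α : ℝ} (w : EN N → ℝ) (z y : EN N) :
    FL N α (fun t => w (t - z)) y = FL N α w (y - z) := by
  unfold FL D2
  congr 2; ext h
  beta_reduce
  rw [show y + h - z = y - z + h by abel, show y - h - z = y - z - h by abel]

lemma FL_even {N : ℕ} {α : ℝ} {w : EN N → ℝ} (hw : ∀ t, w (-t) = w t) (y : EN N) :
    FL N α w (-y) = FL N α w y := by
  unfold FL D2
  congr 2; ext h
  rw [hw y, show -y + h = -(y - h) by abel, show -y - h = -(y + h) by abel, hw, hw]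
  ring

lemma FL_sum {N : ℕ} {α : ℝ} (hN0 : N ≠ 0) (h0 : 0 < α) (h2 : α < 2) {ι : Type*} (s : Finset ι) (w : ι → EN N → ℝ)
    (hw : ∀ i ∈ s, Tst (w i)) (y : EN N) :
    FL N α (fun t => ∑ i ∈ s, w i t) y = ∑ i ∈ s, FL N α (w i) y := by
  unfold FL
  rw [← Finset.mul_sum, ← integral_finsetSum s (fun i hi => (hw i hi).D2_integrable hN0 h0 h2 y)]
  congr 2; ext h
  rw [← Finset.sum_mul]
  congr 1
  unfold D2
  rw [Finset.sum_sub_distrib, Finset.sum_add_distrib, Finset.mul_sum]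

lemma FL_symm {N : ℕ} {α : ℝ} (hN0 : N ≠ 0) (h0 : 0 < α) (h2 : α < 2) {φ ψ : EN N → ℝ} (hφ : Tst φ) (hψ : Tst ψ) :
    ∫ y, ψ y * FL N α φ y = ∫ y, φ y * FL N α ψ y := by
  have key : ∀ {φ ψ : EN N → ℝ} (_ : Tst φ) (_ : Tst ψ), ∫ y, ψ y * FL N α φ y
      = fracLapCoeff N α / 2 * ∫ h : EN N, ∫ y, ψ y * (D2 φ y h * ‖h‖ ^ (-((N:ℝ) + α))) := by
    intro φ ψ hφ hψ
    rw [← integral_integral_swap, ← integral_const_mul]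
    · congr 1; ext y
      unfold FL
      rw [integral_const_mul]; ring
    · obtain ⟨C, hC0, hC⟩ := hφ.D2_bound
      have hm1 := hφ.1.continuous.measurable
      have hm2 := hψ.1.continuous.measurable
      refine (hψ.integrable.norm.mul_prod ((minw_int hN0 h0 h2).const_mul C)).mono' (Measurable.aestronglyMeasurable ?_) (ae_of_all _ fun p => ?_)
      · unfold D2 Function.uncurry; fun_prop
      · simp only [Function.uncurry]
        rw [norm_mul, norm_mul, Real.norm_of_nonneg (by positivity : 0 ≤ ‖p.2‖ ^ (-((N:ℝ) + α))), ← mul_assoc C]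
        gcongr
        exact hC _ _
  rw [key hφ hψ, key hψ hφ]
  congr 2; ext h
  simp_rw [← mul_assoc]
  rw [integral_mul_const, integral_mul_const]
  congr 1
  have i0 : ∀ {φ ψ : EN N → ℝ} (_ : Tst φ) (_ : Tst ψ) (h : EN N), Integrable (fun y => ψ y * φ (y + h)) := by
    intro φ ψ hφ hψ h
    exact (hψ.1.continuous.mul (hφ.1.continuous.comp (continuous_add_const h))).integrable_of_hasCompactSupport
      (hψ.2.mul_right)
  have i1 : ∀ {φ ψ : EN N → ℝ} (_ : Tst φ) (_ : Tst ψ) (h : EN N), ∫ y, ψ y * D2 φ y h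
      = (∫ y, ψ y * φ (y + h)) + (∫ y, ψ y * φ (y + -h)) - 2 * ∫ y, ψ y * φ y := by
    intro φ ψ hφ hψ h
    have i3 := i0 hφ hψ 0
    simp only [add_zero] at i3
    rw [← integral_const_mul, ← integral_add (i0 hφ hψ h) (i0 hφ hψ (-h)), ← integral_sub]
    · congr 1; ext y
      unfold D2
      rw [sub_eq_add_neg y h]; ring
    · exact (i0 hφ hψ h).add (i0 hφ hψ (-h))
    · exact i3.const_mul 2
  have i2 : ∀ (φ ψ : EN N → ℝ) (h : EN N), ∫ y, ψ y * φ (y + h) = ∫ y, φ y * ψ (y + -h) := by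
    intro φ ψ h
    rw [← integral_add_right_eq_self _ (-h)]
    congr 1; ext y
    rw [neg_add_cancel_right, mul_comm]
  rw [i1 hφ hψ, i1 hψ hφ, i2 φ ψ h, i2 φ ψ (-h), neg_neg]
  simp_rw [mul_comm (ψ _) (φ _)]
  ring

lemma log_lint {τ : ℝ} (hτ : 0 < τ) :
    ∫⁻ v in Ioc (0:ℝ) 1, ENNReal.ofReal (1 / (τ + v)) = ENNReal.ofReal (log ((1 + τ) / τ)) := by
  have h1 : ∫ v in (0:ℝ)..1, 1 / (τ + v) = log ((1 + τ) / τ) := by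
    rw [intervalIntegral.integral_comp_add_left (fun x => 1 / x) τ, integral_one_div_of_pos (by linarith) (by linarith)]
    congr 2 <;> ring
  rw [← h1, intervalIntegral.integral_of_le zero_le_one, ofReal_integral_eq_lintegral_ofReal]
  · have : IntervalIntegrable (fun v : ℝ => 1 / (τ + v)) volume 0 1 := by
      apply ContinuousOn.intervalIntegrable
      apply ContinuousOn.div continuousOn_const (by fun_prop)
      intro x hx
      rw [uIcc_of_le zero_le_one] at hx
      have := hx.1
      positivity
    rw [intervalIntegrable_iff_integrableOn_Ioc_of_le zero_le_one] at this
    exact this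
  · refine (ae_restrict_iff' measurableSet_Ioc).2 (ae_of_all _ fun v hv => ?_)
    have := hv.1
    show 0 ≤ 1 / (τ + v)
    positivity

lemma pow_lint {a v : ℝ} (h0 : 0 < a) (h1 : a < 1) (hv : 0 < v) :
    ∫⁻ τ in Ioi (0:ℝ), ENNReal.ofReal (τ ^ (a - 1) * (1 / (τ + v)))
      = ENNReal.ofReal (v ^ (a - 1) * (Gamma a * Gamma (1 - a))) := by
  rw [lint_inv hv]
  have hb := lint_beta (p := 1 - a) (q := a) (by linarith) h0
  rw [sub_add_cancel, Gamma_one, div_one, mul_comm (Gamma (1 - a))] at hb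
  have hG := Gamma_pos_of_pos h0
  have hG2 := Gamma_pos_of_pos (show 0 < 1 - a by linarith)
  rw [ENNReal.ofReal_mul (by positivity), ← hb, ← lintegral_const_mul' _ _ (by simp)]
  refine setLIntegral_congr_fun measurableSet_Ioi fun x hx => ?_
  have hx : 0 < x := hx
  beta_reduce
  rw [← ENNReal.ofReal_mul (by positivity), ← ENNReal.ofReal_mul (by positivity)]
  congr 1
  rw [div_rpow hv.le hx.le, show 1 - a - 1 = -(a - 1) - 1 by ring, Real.rpow_sub hx (-(a-1)), Real.rpow_neg hx.le, Real.rpow_one, Real.rpow_neg_one]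
  have := Real.rpow_pos_of_pos hx (a - 1)
  have := Real.rpow_pos_of_pos hv (a - 1)
  generalize x ^ (a - 1) = X at *
  generalize v ^ (a - 1) = V at *
  have hvx : v / x + v = v * (1 + x) / x := by field_simp; 
  rw [hvx]
  field_simp

lemma logint {a : ℝ} (h0 : 0 < a) (h1 : a < 1) :
    ∫⁻ τ in Ioi (0:ℝ), ENNReal.ofReal (τ ^ (a - 1) * log ((1 + τ) / τ))
      = ENNReal.ofReal (Gamma a * Gamma (1 - a) / a) := by
  have hG := Gamma_pos_of_pos h0
  have hG2 := Gamma_pos_of_pos (show 0 < 1 - a by linarith)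
  have e1 : ∫⁻ τ in Ioi (0:ℝ), ENNReal.ofReal (τ ^ (a - 1) * log ((1 + τ) / τ))
      = ∫⁻ τ in Ioi (0:ℝ), ∫⁻ v in Ioc (0:ℝ) 1, ENNReal.ofReal (τ ^ (a - 1) * (1 / (τ + v))) := by
    refine setLIntegral_congr_fun measurableSet_Ioi fun x hx => ?_
    have hx : 0 < x := hx
    beta_reduce
    rw [ENNReal.ofReal_mul (by positivity), ← log_lint hx, ← lintegral_const_mul' _ _ (by simp)]
    refine lintegral_congr fun v => ?_
    rw [ENNReal.ofReal_mul (by positivity)]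
  rw [e1, lintegral_lintegral_swap (Measurable.aemeasurable (by unfold Function.uncurry; fun_prop))]
  have e2 : ∫⁻ v in Ioc (0:ℝ) 1, ∫⁻ τ in Ioi (0:ℝ), ENNReal.ofReal (τ ^ (a - 1) * (1 / (τ + v)))
      = ∫⁻ v in Ioc (0:ℝ) 1, ENNReal.ofReal (v ^ (a - 1)) * ENNReal.ofReal (Gamma a * Gamma (1 - a)) := by
    refine setLIntegral_congr_fun measurableSet_Ioc fun v hv => ?_
    have hv : 0 < v := hv.1
    beta_reduce
    rw [pow_lint h0 h1 hv, ENNReal.ofReal_mul (by positivity)]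
  rw [e2, lintegral_mul_const' _ _ (by simp)]
  have e3 : ∫⁻ v in Ioc (0:ℝ) 1, ENNReal.ofReal (v ^ (a - 1)) = ENNReal.ofReal (1 / a) := by
    apply lint_of_integral
    · refine (ae_restrict_iff' measurableSet_Ioc).2 (ae_of_all _ fun v hv => ?_)
      exact Real.rpow_nonneg hv.1.le _
    · rw [← intervalIntegral.integral_of_le zero_le_one, integral_rpow (Or.inl (by linarith))]
      simp [h0.ne']
    · positivity
  rw [e3, ← ENNReal.ofReal_mul (by positivity)]
  congr 1; ring

lemma frullani {f : ℝ → ℝ} {c K l0 L : ℝ} (hf : ContinuousOn f (Ioi 0)) (hK : ∀ s, |f s| ≤ K)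
    (hl0 : Tendsto f (𝓝[>] 0) (𝓝 l0)) (hL : Tendsto f atTop (𝓝 L)) (hc0 : 0 < c) (hc1 : c < 1)
    (hi : IntegrableOn (fun s => s⁻¹ * (f (c * s) - f s)) (Ioi 0)) :
    ∫ s in Ioi (0:ℝ), s⁻¹ * (f (c * s) - f s) = (L - l0) * log c := by
  have hg : ContinuousOn (fun s => s⁻¹ * f s) (Ioi 0) :=
    (continuousOn_inv₀.mono (fun x hx => by have : 0 < x := hx; simp; exact this.ne')).mul hf
  have hgi : ∀ {x y : ℝ}, 0 < x → 0 < y → IntervalIntegrable (fun s => s⁻¹ * f s) volume x y := by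
    intro x y hx hy
    apply (hg.mono _).intervalIntegrable
    intro z hz
    exact lt_of_lt_of_le (lt_min hx hy) hz.1
  have key : ∀ ε M : ℝ, 0 < ε → 0 < M → ∫ s in ε..M, s⁻¹ * (f (c * s) - f s)
      = (∫ v in c..1, v⁻¹ * f (ε * v)) - ∫ v in c..1, v⁻¹ * f (M * v) := by
    intro ε M hε hM
    have e0 : ∀ {x : ℝ}, 0 < x → ∫ v in c..1, v⁻¹ * f (x * v) = ∫ s in c * x..x, s⁻¹ * f s := by
      intro x hx
      have := intervalIntegral.mul_integral_comp_mul_left (f := fun s => s⁻¹ * f s) (a := c) (b := 1) x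
      rw [mul_one, mul_comm x c] at this
      rw [← this, ← intervalIntegral.integral_const_mul]
      congr 1; ext v
      rw [mul_inv]; field_simp
    have e1 : ∫ s in ε..M, s⁻¹ * (f (c * s) - f s) = (∫ s in c * ε..c * M, s⁻¹ * f s) - ∫ s in ε..M, s⁻¹ * f s := by
      have := intervalIntegral.mul_integral_comp_mul_left (f := fun s => s⁻¹ * f s) (a := ε) (b := M) c
      rw [← this, ← intervalIntegral.integral_const_mul, ← intervalIntegral.integral_sub]
      · congr 1; ext v
        rw [mul_inv]; field_simp
      · have h3 := (hgi (mul_pos hc0 hε) (mul_pos hc0 hM)).comp_mul_left (c := c)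
        rw [mul_div_cancel_left₀ _ hc0.ne', mul_div_cancel_left₀ _ hc0.ne'] at h3
        exact h3.const_mul c
      · exact hgi hε hM
    rw [e1, e0 hε, e0 hM]
    have a1 := intervalIntegral.integral_add_adjacent_intervals (hgi (mul_pos hc0 hε) hε) (hgi hε hM)
    have a2 := intervalIntegral.integral_add_adjacent_intervals (hgi (mul_pos hc0 hε) (mul_pos hc0 hM)) (hgi (mul_pos hc0 hM) hM)
    linarith
  have lim : ∀ {u : ℕ → ℝ} {ℓ : ℝ} (_ : ∀ n, 0 < u n) (_ : ∀ v, 0 < v → Tendsto (fun n => f (u n * v)) atTop (𝓝 ℓ)),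
      Tendsto (fun n => ∫ v in c..1, v⁻¹ * f (u n * v)) atTop (𝓝 (∫ v in c..1, v⁻¹ * ℓ)) := by
    intro u ℓ hu hul
    apply intervalIntegral.tendsto_integral_filter_of_dominated_convergence (fun _ => c⁻¹ * K)
    · refine Eventually.of_forall fun n => ?_
      refine ContinuousOn.aestronglyMeasurable ?_ measurableSet_uIoc
      rw [uIoc_of_le hc1.le]
      apply ContinuousOn.mul
      · exact continuousOn_inv₀.mono (fun x hx => by simp; linarith [hx.1])
      · refine hf.comp (by fun_prop) fun x hx => ?_
        exact mul_pos (hu n) (hc0.trans hx.1)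
    · refine Eventually.of_forall fun n => ae_of_all _ fun v hv => ?_
      rw [uIoc_of_le hc1.le] at hv
      have hv0 := hc0.trans hv.1
      rw [norm_mul, Real.norm_of_nonneg (by positivity)]
      have := hK (u n * v)
      have h4 := inv_anti₀ hc0 hv.1.le
      rw [Real.norm_eq_abs]
      gcongr
    · exact intervalIntegrable_const
    · refine ae_of_all _ fun v hv => ?_
      rw [uIoc_of_le hc1.le] at hv
      exact (hul v (hc0.trans hv.1)).const_mul _
  have hp : ∀ n : ℕ, (0:ℝ) < n + 1 := fun n => by positivity
  have t1 : Tendsto (fun n : ℕ => ∫ s in Ioc ((n + 1 : ℝ)⁻¹) (n + 1), s⁻¹ * (f (c * s) - f s)) atTop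
      (𝓝 (∫ s in ⋃ n : ℕ, Ioc ((n + 1 : ℝ)⁻¹) (n + 1), s⁻¹ * (f (c * s) - f s))) := by
    have hU : (⋃ n : ℕ, Ioc ((n + 1 : ℝ)⁻¹) (n + 1)) ⊆ Ioi 0 := by
      intro x hx
      obtain ⟨n, hn⟩ := mem_iUnion.1 hx
      exact lt_trans (inv_pos.2 (hp n)) hn.1
    apply tendsto_setIntegral_of_monotone
    · intro n; exact measurableSet_Ioc
    · intro n m hnm
      have : (n:ℝ) ≤ m := by exact_mod_cast hnm
      apply Ioc_subset_Ioc
      · apply inv_anti₀ (hp n); linarith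
      · linarith
    · exact hi.mono_set hU
  have hU : (⋃ n : ℕ, Ioc ((n + 1 : ℝ)⁻¹) (n + 1)) = Ioi 0 := by
    ext x
    constructor
    · intro hx
      obtain ⟨n, hn⟩ := mem_iUnion.1 hx
      exact lt_trans (inv_pos.2 (hp n)) hn.1
    · intro hx
      have hx : 0 < x := hx
      obtain ⟨n, hn⟩ := exists_nat_ge (max x x⁻¹)
      refine mem_iUnion.2 ⟨n, ?_, ?_⟩
      · rw [inv_lt_comm₀ (hp n) hx]
        linarith [le_max_right x x⁻¹]
      · linarith [le_max_left x x⁻¹]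
  rw [hU] at t1
  have t2 : Tendsto (fun n : ℕ => ∫ s in Ioc ((n + 1 : ℝ)⁻¹) (n + 1), s⁻¹ * (f (c * s) - f s)) atTop
      (𝓝 ((∫ v in c..1, v⁻¹ * l0) - ∫ v in c..1, v⁻¹ * L)) := by
    have hn1 : Tendsto (fun n : ℕ => (n:ℝ) + 1) atTop atTop :=
      tendsto_natCast_atTop_atTop.atTop_add tendsto_const_nhds
    have := (lim (u := fun n => ((n:ℝ) + 1)⁻¹) (ℓ := l0) (fun n => inv_pos.2 (hp n)) ?_).sub
      (lim (u := fun n => (n:ℝ) + 1) (ℓ := L) hp ?_)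
    · refine this.congr fun n => ?_
      rw [← intervalIntegral.integral_of_le, key _ _ (inv_pos.2 (hp n)) (hp n)]
      have : (0:ℝ) ≤ n := by positivity
      calc ((n:ℝ) + 1)⁻¹ ≤ 1 := inv_le_one_of_one_le₀ (by linarith)
        _ ≤ _ := by linarith
    · intro v hv
      refine hl0.comp (tendsto_nhdsWithin_iff.2 ⟨?_, Eventually.of_forall fun n => mul_pos (inv_pos.2 (hp n)) hv⟩)
      have := (tendsto_inv_atTop_zero.comp hn1).mul_const v
      rw [zero_mul] at this
      exact this
    · intro v hv
      exact hL.comp (hn1.atTop_mul_const hv)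
  rw [tendsto_nhds_unique t1 t2, intervalIntegral.integral_mul_const, intervalIntegral.integral_mul_const, integral_inv_of_pos hc0 one_pos, one_div, log_inv]
  ring

lemma gauss_integral {N : ℕ} {t : ℝ} (ht : 0 < t) :
    ∫ y : EN N, exp (-(t * ‖y‖ ^ 2)) = (π / t) ^ ((N:ℝ) / 2) := by
  have := GaussianFourier.integral_rexp_neg_mul_sq_norm (V := EN N) ht
  rw [finrank_euclideanSpace, Fintype.card_fin] at this
  simp_rw [neg_mul] at this
  exact this

lemma gauss_integrable {N : ℕ} {t : ℝ} (ht : 0 < t) :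
    Integrable (fun y : EN N => exp (-(t * ‖y‖ ^ 2))) := by
  by_contra h
  have h1 := gauss_integral (N := N) ht
  rw [integral_undef h] at h1
  have : 0 < (π / t) ^ ((N:ℝ) / 2) := by positivity
  linarith

lemma gauss_conv {N : ℕ} {s t : ℝ} (hs : 0 < s) (ht : 0 < t) (x : EN N) :
    ∫ y : EN N, exp (-(t * ‖y - x‖ ^ 2)) * exp (-(s * ‖y‖ ^ 2))
      = (π / (s + t)) ^ ((N:ℝ) / 2) * exp (-(s * t / (s + t) * ‖x‖ ^ 2)) := by
  rw [integral_eq_lintegral_of_nonneg_ae (ae_of_all _ fun y => by positivity)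
    (Measurable.aestronglyMeasurable (by fun_prop)), lint_gauss ht hs, ENNReal.toReal_ofReal (by positivity),
    add_comm t s, mul_comm t s]

/-- Gaussian average -/
def mA {N : ℕ} (w : EN N → ℝ) (s : ℝ) : ℝ := ∫ y : EN N, exp (-(1 * ‖y‖ ^ 2)) * w (s ^ (-(1/2) : ℝ) • y)

/-- Gaussian integral -/
def mM {N : ℕ} (w : EN N → ℝ) (s : ℝ) : ℝ := ∫ y : EN N, exp (-(s * ‖y‖ ^ 2)) * w y

lemma mM_eq {N : ℕ} (w : EN N → ℝ) {s : ℝ} (hs : 0 < s) : mM w s = s ^ (-((N:ℝ) / 2)) * mA w s := by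
  unfold mM mA
  have h := Measure.integral_comp_smul (volume : Measure (EN N)) (fun y : EN N => exp (-(s * ‖y‖ ^ 2)) * w y) (s ^ (-(1/2) : ℝ))
  have hp := Real.rpow_pos_of_pos hs (-(1/2) : ℝ)
  have e : ∀ y : EN N, s * ‖s ^ (-(1/2) : ℝ) • y‖ ^ 2 = 1 * ‖y‖ ^ 2 := by
    intro y
    rw [norm_smul, Real.norm_of_nonneg hp.le, mul_pow, ← Real.rpow_natCast, ← Real.rpow_mul hs.le]
    norm_num
    rw [Real.rpow_neg_one]; field_simp
  simp only [e] at h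
  rw [h, finrank_euclideanSpace, Fintype.card_fin, smul_eq_mul, ← mul_assoc, abs_of_pos (by positivity),
    ← Real.rpow_natCast, ← Real.rpow_mul hs.le, ← Real.rpow_neg hs.le, ← Real.rpow_add hs]
  rw [show -((N:ℝ) / 2) + -(-(1 / 2) * (N:ℝ)) = 0 by ring, Real.rpow_zero, one_mul]

lemma mA_bdd {N : ℕ} {w : EN N → ℝ} (hw : Tst w) : ∃ K, ∀ s, |mA w s| ≤ K := by
  obtain ⟨M, hM0, hM⟩ := hw.bdd
  refine ⟨∫ y : EN N, exp (-(1 * ‖y‖ ^ 2)) * M, fun s => ?_⟩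
  rw [← Real.norm_eq_abs]
  refine norm_integral_le_of_norm_le ((gauss_integrable one_pos).mul_const M) (ae_of_all _ fun y => ?_)
  rw [norm_mul, Real.norm_of_nonneg (by positivity)]
  have := hM (s ^ (-(1/2) : ℝ) • y)
  rw [Real.norm_eq_abs]
  gcongr

lemma mA_aux {N : ℕ} {w : EN N → ℝ} (hw : Tst w) :
    Continuous (fun σ : ℝ => ∫ y : EN N, exp (-(1 * ‖y‖ ^ 2)) * w (σ • y)) := by
  obtain ⟨M, hM0, hM⟩ := hw.bdd
  have hc := hw.1.continuous
  refine continuous_of_dominated (bound := fun y => exp (-(1 * ‖y‖ ^ 2)) * M) (fun σ => ?_) (fun σ => ?_) ((gauss_integrable one_pos).mul_const M) (ae_of_all _ fun y => ?_)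
  · exact Continuous.aestronglyMeasurable (by fun_prop)
  · refine ae_of_all _ fun y => ?_
    rw [norm_mul, Real.norm_of_nonneg (by positivity)]
    have := hM (σ • y)
    rw [Real.norm_eq_abs]
    gcongr
  · fun_prop

lemma mA_cont {N : ℕ} {w : EN N → ℝ} (hw : Tst w) : ContinuousOn (mA w) (Ioi 0) := by
  have h : ContinuousOn (fun s : ℝ => s ^ (-(1/2) : ℝ)) (Ioi 0) := by
    intro s hs
    exact (Real.continuousAt_rpow_const s _ (Or.inl (ne_of_gt hs))).continuousWithinAt
  exact (mA_aux hw).comp_continuousOn h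

lemma mA_top {N : ℕ} {w : EN N → ℝ} (hw : Tst w) : Tendsto (mA w) atTop (𝓝 (π ^ ((N:ℝ)/2) * w 0)) := by
  have h := ((mA_aux hw).tendsto 0).comp (tendsto_rpow_neg_atTop (show (0:ℝ) < 1/2 by norm_num))
  simp only [zero_smul] at h
  rw [integral_mul_const, gauss_integral one_pos, div_one] at h
  exact h

lemma mA_zero {N : ℕ} (hN0 : N ≠ 0) {w : EN N → ℝ} (hw : Tst w) : Tendsto (mA w) (𝓝[>] 0) (𝓝 0) := by
  have hb : ∀ s ∈ Ioi (0:ℝ), ‖mA w s‖ ≤ s ^ ((N:ℝ)/2) * ∫ y, ‖w y‖ := by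
    intro s hs
    have hs : 0 < s := hs
    have h1 : mA w s = s ^ ((N:ℝ)/2) * mM w s := by
      rw [mM_eq w hs, ← mul_assoc, ← Real.rpow_add hs, add_neg_cancel, Real.rpow_zero, one_mul]
    rw [h1, norm_mul, Real.norm_of_nonneg (by positivity)]
    gcongr
    refine norm_integral_le_of_norm_le hw.integrable.norm (ae_of_all _ fun y => ?_)
    rw [norm_mul, Real.norm_of_nonneg (by positivity)]
    apply mul_le_of_le_one_left (norm_nonneg _)
    apply Real.exp_le_one_iff.2
    have : 0 ≤ s * ‖y‖ ^ 2 := by positivity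
    linarith
  have hNp : 0 < (N:ℝ) / 2 := by have := Nat.pos_of_ne_zero hN0; positivity
  have ht : Tendsto (fun s : ℝ => s ^ ((N:ℝ)/2) * ∫ y, ‖w y‖) (𝓝[>] 0) (𝓝 0) := by
    have := ((Real.continuousAt_rpow_const 0 ((N:ℝ)/2) (Or.inr hNp.le)).tendsto.mul_const (∫ y, ‖w y‖)).mono_left (nhdsWithin_le_nhds (s := Ioi 0))
    rw [Real.zero_rpow hNp.ne', zero_mul] at this
    exact this
  exact squeeze_zero_norm' (eventually_nhdsWithin_of_forall hb) ht

lemma D2_gauss {N : ℕ} {w : EN N → ℝ} (hw : Tst w) {s t : ℝ} (hs : 0 < s) (ht : 0 < t) :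
    Integrable (fun P : EN N × EN N => D2 w P.1 P.2 * (exp (-(s * ‖P.1‖ ^ 2)) * exp (-(t * ‖P.2‖ ^ 2)))) ∧
    ∫ P : EN N × EN N, D2 w P.1 P.2 * (exp (-(s * ‖P.1‖ ^ 2)) * exp (-(t * ‖P.2‖ ^ 2)))
      = 2 * ((π / (s + t)) ^ ((N:ℝ) / 2) * mM w (s * t / (s + t)) - (π / t) ^ ((N:ℝ) / 2) * mM w s) := by
  obtain ⟨M, hM0, hM⟩ := hw.bdd
  have hc := hw.1.continuous
  have hpi : Integrable (fun P : EN N × EN N => exp (-(s * ‖P.1‖ ^ 2)) * exp (-(t * ‖P.2‖ ^ 2))) (volume.prod volume) :=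
    (gauss_integrable hs).mul_prod (gauss_integrable ht)
  have gen : ∀ f : EN N × EN N → ℝ, Continuous f → (∀ P, |f P| ≤ M) →
      Integrable (fun P : EN N × EN N => f P * (exp (-(s * ‖P.1‖ ^ 2)) * exp (-(t * ‖P.2‖ ^ 2)))) (volume.prod volume) := by
    intro f hf hfM
    exact hpi.bdd_mul hf.aestronglyMeasurable (ae_of_all _ hfM)
  have g1 := gen (fun P => w (P.1 + P.2)) (by fun_prop) (fun P => hM _)
  have g2 := gen (fun P => w (P.1 - P.2)) (by fun_prop) (fun P => hM _)
  have g3 := gen (fun P => w P.1) (by fun_prop) (fun P => hM _)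
  have hsplit : (fun P : EN N × EN N => D2 w P.1 P.2 * (exp (-(s * ‖P.1‖ ^ 2)) * exp (-(t * ‖P.2‖ ^ 2))))
      = fun P => (w (P.1 + P.2) * (exp (-(s * ‖P.1‖ ^ 2)) * exp (-(t * ‖P.2‖ ^ 2))) +
        w (P.1 - P.2) * (exp (-(s * ‖P.1‖ ^ 2)) * exp (-(t * ‖P.2‖ ^ 2)))) -
        2 * (w P.1 * (exp (-(s * ‖P.1‖ ^ 2)) * exp (-(t * ‖P.2‖ ^ 2)))) := by
    ext P; unfold D2; ring
  have e1 : ∫ P : EN N × EN N, w (P.1 + P.2) * (exp (-(s * ‖P.1‖ ^ 2)) * exp (-(t * ‖P.2‖ ^ 2))) ∂(volume.prod volume)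
      = (π / (s + t)) ^ ((N:ℝ) / 2) * mM w (s * t / (s + t)) := by
    rw [integral_prod _ g1]
    have : ∀ y : EN N, ∫ h, w (y + h) * (exp (-(s * ‖y‖ ^ 2)) * exp (-(t * ‖h‖ ^ 2)))
        = ∫ z, w z * (exp (-(s * ‖y‖ ^ 2)) * exp (-(t * ‖y - z‖ ^ 2))) := by
      intro y
      rw [← integral_add_left_eq_self (fun z => w z * (exp (-(s * ‖y‖ ^ 2)) * exp (-(t * ‖y - z‖ ^ 2)))) y]
      congr 1; ext h
      rw [sub_add_cancel_left, norm_neg]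
    simp_rw [this]
    rw [integral_integral_swap]
    · unfold mM
      rw [← integral_const_mul]
      congr 1; ext z
      rw [integral_const_mul, ← mul_assoc, ← gauss_conv hs ht z, mul_comm]
      congr 2; ext y; rw [mul_comm]
    · refine ((gauss_integrable hs).mul_prod hw.integrable.norm).mono' (Continuous.aestronglyMeasurable (by unfold Function.uncurry; fun_prop)) (ae_of_all _ fun P => ?_)
      simp only [Function.uncurry]
      rw [norm_mul, norm_mul, Real.norm_of_nonneg (by positivity : 0 ≤ exp (-(s * ‖P.1‖ ^ 2))), Real.norm_of_nonneg (by positivity : 0 ≤ exp (-(t * ‖P.1 - P.2‖ ^ 2))), mul_comm]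
      gcongr
      apply mul_le_of_le_one_right (by positivity)
      apply Real.exp_le_one_iff.2
      have : 0 ≤ t * ‖P.1 - P.2‖ ^ 2 := by positivity
      linarith
  have e2 : ∫ P : EN N × EN N, w (P.1 - P.2) * (exp (-(s * ‖P.1‖ ^ 2)) * exp (-(t * ‖P.2‖ ^ 2))) ∂(volume.prod volume)
      = (π / (s + t)) ^ ((N:ℝ) / 2) * mM w (s * t / (s + t)) := by
    rw [← e1, integral_prod _ g1, integral_prod _ g2]
    congr 1; ext y
    rw [← integral_neg_eq_self]
    congr 1; ext h
    rw [norm_neg, sub_neg_eq_add]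
  have e3 : ∫ P : EN N × EN N, w P.1 * (exp (-(s * ‖P.1‖ ^ 2)) * exp (-(t * ‖P.2‖ ^ 2))) ∂(volume.prod volume)
      = (π / t) ^ ((N:ℝ) / 2) * mM w s := by
    rw [integral_prod _ g3]
    simp_rw [← mul_assoc, integral_const_mul, gauss_integral ht]
    rw [integral_mul_const, mul_comm]
    congr 1
    unfold mM
    congr 1; ext y; ring
  rw [hsplit]
  constructor
  · exact (g1.add g2).sub (g3.const_mul 2)
  · rw [Measure.volume_eq_prod]
    rw [integral_sub, integral_add g1 g2, integral_const_mul, e1, e2, e3]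
    · ring
    · exact g1.add g2
    · exact g3.const_mul 2

/-- subordination kernel, `Q = (τ, s)`, `P = (y, h)` -/
def sk (N : ℕ) (α : ℝ) (P : EN N × EN N) (Q : ℝ × ℝ) : ℝ :=
  (Q.2 ^ ((N:ℝ) - 1) * Q.1 ^ (((N:ℝ) + α) / 2 - 1)) * (exp (-(Q.2 * ‖P.1‖ ^ 2)) * exp (-(Q.2 * Q.1 * ‖P.2‖ ^ 2)))

lemma sk_nonneg {N : ℕ} {α : ℝ} (P : EN N × EN N) {Q : ℝ × ℝ} (h1 : 0 < Q.1) (h2 : 0 < Q.2) : 0 ≤ sk N α P Q := by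
  unfold sk; positivity

lemma sk_lint {N : ℕ} {α : ℝ} (h0 : 0 < α) (hN : α < N) {P : EN N × EN N} (h1 : P.1 ≠ 0) (h2 : P.2 ≠ 0) :
    ∫⁻ Q, ENNReal.ofReal (sk N α P Q) ∂((volume.restrict (Ioi (0:ℝ))).prod (volume.restrict (Ioi (0:ℝ))))
      = ENNReal.ofReal (Gamma (((N:ℝ) - α) / 2) * Gamma (((N:ℝ) + α) / 2) * (‖P.1‖ ^ (α - (N:ℝ)) * ‖P.2‖ ^ (-((N:ℝ) + α)))) := by
  have n1 : 0 < ‖P.1‖ := norm_pos_iff.2 h1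
  have n2 : 0 < ‖P.2‖ := norm_pos_iff.2 h2
  have hb : 0 < ((N:ℝ) + α) / 2 := by positivity
  have hb' : 0 < ((N:ℝ) - α) / 2 := by linarith
  have hG := Gamma_pos_of_pos hb
  have hG' := Gamma_pos_of_pos hb'
  rw [lintegral_prod_symm' _ (by unfold sk; fun_prop)]
  have : ∀ s ∈ Ioi (0:ℝ), ∫⁻ τ in Ioi (0:ℝ), ENNReal.ofReal (sk N α P (τ, s))
      = ENNReal.ofReal (Gamma (((N:ℝ) + α) / 2) * ‖P.2‖ ^ (-((N:ℝ) + α))) * ENNReal.ofReal (s ^ (((N:ℝ) - α) / 2 - 1) * exp (-(s * ‖P.1‖ ^ 2))) := by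
    intro s hs
    have hs : 0 < s := hs
    have e1 : ∀ τ ∈ Ioi (0:ℝ), ENNReal.ofReal (sk N α P (τ, s)) = ENNReal.ofReal (s ^ ((N:ℝ) - 1) * exp (-(s * ‖P.1‖ ^ 2))) *
        ENNReal.ofReal (τ ^ (((N:ℝ) + α) / 2 - 1) * exp (-(s * ‖P.2‖ ^ 2 * τ))) := by
      intro τ hτ
      rw [← ENNReal.ofReal_mul (by positivity)]
      congr 1
      unfold sk
      simp only
      rw [show s * τ * ‖P.2‖ ^ 2 = s * ‖P.2‖ ^ 2 * τ by ring]
      ring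
    rw [setLIntegral_congr_fun measurableSet_Ioi e1, lintegral_const_mul' _ _ (by simp), lint_gamma hb (by positivity),
      ← ENNReal.ofReal_mul (by positivity), ← ENNReal.ofReal_mul (by positivity)]
    congr 1
    rw [Real.mul_rpow hs.le (by positivity), ← Real.rpow_natCast ‖P.2‖, ← Real.rpow_mul n2.le,
      show ((2:ℕ):ℝ) * -(((N:ℝ) + α) / 2) = -((N:ℝ) + α) by push_cast; ring,
      show ((N:ℝ) - α) / 2 - 1 = (N:ℝ) - 1 + -(((N:ℝ) + α) / 2) by ring, Real.rpow_add hs]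
    ring
  rw [setLIntegral_congr_fun measurableSet_Ioi this, lintegral_const_mul' _ _ (by simp), lint_riesz hb' n1,
    ← ENNReal.ofReal_mul (by positivity)]
  congr 1
  rw [show -(2 * (((N:ℝ) - α) / 2)) = α - (N:ℝ) by ring]
  ring

lemma sk_integral {N : ℕ} {α : ℝ} (h0 : 0 < α) (hN : α < N) {P : EN N × EN N} (h1 : P.1 ≠ 0) (h2 : P.2 ≠ 0) :
    ∫ Q, sk N α P Q ∂((volume.restrict (Ioi (0:ℝ))).prod (volume.restrict (Ioi (0:ℝ))))
      = Gamma (((N:ℝ) - α) / 2) * Gamma (((N:ℝ) + α) / 2) * (‖P.1‖ ^ (α - (N:ℝ)) * ‖P.2‖ ^ (-((N:ℝ) + α))) := by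
  have hb : 0 < ((N:ℝ) + α) / 2 := by positivity
  have hb' : 0 < ((N:ℝ) - α) / 2 := by linarith
  have hG := Gamma_pos_of_pos hb
  have hG' := Gamma_pos_of_pos hb'
  rw [integral_eq_lintegral_of_nonneg_ae, sk_lint h0 hN h1 h2, ENNReal.toReal_ofReal (by positivity)]
  · rw [Measure.prod_restrict]
    refine (ae_restrict_iff' (measurableSet_Ioi.prod measurableSet_Ioi)).2 (ae_of_all _ fun Q hQ => sk_nonneg P hQ.1 hQ.2)
  · exact Measurable.aestronglyMeasurable (by unfold sk; fun_prop)

lemma ae_ne_zero {N : ℕ} (hN0 : N ≠ 0) : ∀ᵐ y : EN N, y ≠ 0 := by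
  have : Nonempty (Fin N) := ⟨⟨0, Nat.pos_of_ne_zero hN0⟩⟩
  have := Measure.ae_ne (volume : Measure (EN N)) 0
  exact this

lemma ae_ne_zero2 {N : ℕ} (hN0 : N ≠ 0) : ∀ᵐ P : EN N × EN N ∂(volume.prod volume), P.1 ≠ 0 ∧ P.2 ≠ 0 := by
  have h1 := (Measure.quasiMeasurePreserving_fst (μ := (volume : Measure (EN N))) (ν := (volume : Measure (EN N)))).ae (ae_ne_zero hN0)
  have h2 := (Measure.quasiMeasurePreserving_snd (μ := (volume : Measure (EN N))) (ν := (volume : Measure (EN N)))).ae (ae_ne_zero hN0)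
  filter_upwards [h1, h2] with P a b using ⟨a, b⟩

lemma riesz_D2_integrable {N : ℕ} {α : ℝ} (hN0 : N ≠ 0) (h0 : 0 < α) (h2 : α < 2) (hN : α < N) {w : EN N → ℝ} (hw : Tst w) :
    Integrable (fun P : EN N × EN N => D2 w P.1 P.2 * (‖P.1‖ ^ (α - (N:ℝ)) * ‖P.2‖ ^ (-((N:ℝ) + α)))) (volume.prod volume) := by
  obtain ⟨C, hC0, hC⟩ := hw.JD_bound hN0 h0 h2
  have hm := hw.1.continuous.measurable
  have hmm : Measurable (fun P : EN N × EN N => D2 w P.1 P.2 * (‖P.1‖ ^ (α - (N:ℝ)) * ‖P.2‖ ^ (-((N:ℝ) + α)))) := by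
    unfold D2; fun_prop
  refine ⟨hmm.aestronglyMeasurable, ?_⟩
  rw [hasFiniteIntegral_iff_norm, lintegral_prod _ hmm.norm.ennreal_ofReal.aemeasurable]
  have hI := ((riesz_weight_int hN0 h0 hN).const_mul C)
  have hfin : ∫⁻ x : EN N, ENNReal.ofReal (C * (‖x‖ ^ (α - (N:ℝ)) * (1 + ‖x‖) ^ (-((N:ℝ) + α)))) < ∞ := by
    rw [← ofReal_integral_eq_lintegral_ofReal hI (ae_of_all _ fun x => by positivity)]
    simp
  refine lt_of_le_of_lt (lintegral_mono fun y => ?_) hfin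
  calc _ = ENNReal.ofReal (‖y‖ ^ (α - (N:ℝ))) * JD N α w y := by
        unfold JD
        rw [← lintegral_const_mul' _ _ (by simp)]
        congr 1; ext h
        rw [← ENNReal.ofReal_mul (by positivity), norm_mul, Real.norm_eq_abs, Real.norm_of_nonneg (by positivity)]
        congr 1; ring
    _ ≤ ENNReal.ofReal (‖y‖ ^ (α - (N:ℝ))) * ENNReal.ofReal (C * (1 + ‖y‖) ^ (-((N:ℝ) + α))) := by
        gcongr; exact hC y
    _ = _ := by
        rw [← ENNReal.ofReal_mul (by positivity)]
        congr 1; ring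

lemma inner_P {N : ℕ} {α : ℝ} {w : EN N → ℝ} (hw : Tst w) {Q : ℝ × ℝ} (h1 : 0 < Q.1) (h2 : 0 < Q.2) :
    ∫ P : EN N × EN N, D2 w P.1 P.2 * sk N α P Q ∂(volume.prod volume)
      = 2 * π ^ ((N:ℝ) / 2) * (Q.1 ^ (α / 2 - 1) * (Q.2⁻¹ * (mA w (Q.1 / (1 + Q.1) * Q.2) - mA w Q.2))) := by
  obtain ⟨τ, s⟩ := Q
  simp only at h1 h2
  have e := (D2_gauss hw h2 (mul_pos h2 h1)).2
  have hc : 0 < τ / (1 + τ) * s := by positivity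
  rw [show s * (s * τ) / (s + s * τ) = τ / (1 + τ) * s by field_simp, mM_eq w hc, mM_eq w h2, ← mul_assoc, ← mul_assoc] at e
  have p1 : (π / (s + s * τ)) ^ ((N:ℝ) / 2) * (τ / (1 + τ) * s) ^ (-((N:ℝ) / 2)) = π ^ ((N:ℝ) / 2) * (s ^ (-(N:ℝ)) * τ ^ (-((N:ℝ) / 2))) := by
    rw [Real.rpow_neg hc.le, ← Real.inv_rpow hc.le, ← Real.mul_rpow (by positivity) (by positivity), show -(N:ℝ) = ((-2 : ℤ):ℝ) * ((N:ℝ) / 2) by push_cast; ring,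
      Real.rpow_mul h2.le, Real.rpow_intCast, Real.rpow_neg h1.le, ← Real.inv_rpow h1.le, ← Real.mul_rpow (by positivity) (by positivity), ← Real.mul_rpow (by positivity) (by positivity)]
    congr 1
    rw [zpow_neg]
    field_simp
  have p2 : (π / (s * τ)) ^ ((N:ℝ) / 2) * s ^ (-((N:ℝ) / 2)) = π ^ ((N:ℝ) / 2) * (s ^ (-(N:ℝ)) * τ ^ (-((N:ℝ) / 2))) := by
    rw [Real.rpow_neg h2.le, ← Real.inv_rpow h2.le, ← Real.mul_rpow (by positivity) (by positivity), show -(N:ℝ) = ((-2 : ℤ):ℝ) * ((N:ℝ) / 2) by push_cast; ring,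
      Real.rpow_mul h2.le, Real.rpow_intCast, Real.rpow_neg h1.le, ← Real.inv_rpow h1.le, ← Real.mul_rpow (by positivity) (by positivity), ← Real.mul_rpow (by positivity) (by positivity)]
    congr 1
    rw [zpow_neg]
    field_simp
  rw [p1, p2] at e
  unfold sk
  simp only
  have e0 : ∀ P : EN N × EN N, D2 w P.1 P.2 * (s ^ ((N:ℝ) - 1) * τ ^ (((N:ℝ) + α) / 2 - 1) * (exp (-(s * ‖P.1‖ ^ 2)) * exp (-(s * τ * ‖P.2‖ ^ 2))))
      = (s ^ ((N:ℝ) - 1) * τ ^ (((N:ℝ) + α) / 2 - 1)) * (D2 w P.1 P.2 * (exp (-(s * ‖P.1‖ ^ 2)) * exp (-(s * τ * ‖P.2‖ ^ 2)))) := fun P => by ring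
  simp_rw [e0]
  rw [integral_const_mul, ← Measure.volume_eq_prod, e]
  rw [show α / 2 - 1 = (((N:ℝ) + α) / 2 - 1) + -((N:ℝ) / 2) by ring, Real.rpow_add h1, show s⁻¹ = s ^ ((N:ℝ) - 1) * s ^ (-(N:ℝ)) by
    rw [← Real.rpow_add h2, ← Real.rpow_neg_one]; congr 1; ring]
  ring

lemma J_eval {N : ℕ} {α : ℝ} (hN0 : N ≠ 0) (h0 : 0 < α) (h2 : α < 2) (hN : α < N) {w : EN N → ℝ} (hw : Tst w) :
    Gamma (((N:ℝ) - α) / 2) * Gamma (((N:ℝ) + α) / 2) *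
      (∫ P : EN N × EN N, D2 w P.1 P.2 * (‖P.1‖ ^ (α - (N:ℝ)) * ‖P.2‖ ^ (-((N:ℝ) + α))) ∂(volume.prod volume))
      = -(2 * π ^ ((N:ℝ) / 2) * π ^ ((N:ℝ) / 2) * w 0 * (Gamma (α / 2) * Gamma (1 - α / 2) / (α / 2))) := by
  have hb : 0 < ((N:ℝ) + α) / 2 := by positivity
  have hb' : 0 < ((N:ℝ) - α) / 2 := by linarith
  have hG := Gamma_pos_of_pos hb
  have hG' := Gamma_pos_of_pos hb'
  have hm := hw.1.continuous.measurable
  set ν := (volume.restrict (Ioi (0:ℝ))).prod (volume.restrict (Ioi (0:ℝ))) with hν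
  have hνae : ∀ᵐ Q ∂ν, 0 < Q.1 ∧ 0 < Q.2 := by
    rw [hν, Measure.prod_restrict]
    exact (ae_restrict_iff' (measurableSet_Ioi.prod measurableSet_Ioi)).2 (ae_of_all _ fun Q hQ => ⟨hQ.1, hQ.2⟩)
  have hmeas : Measurable (fun z : (EN N × EN N) × (ℝ × ℝ) => D2 w z.1.1 z.1.2 * sk N α z.1 z.2) := by
    unfold sk D2; fun_prop
  have hInt : Integrable (fun z : (EN N × EN N) × (ℝ × ℝ) => D2 w z.1.1 z.1.2 * sk N α z.1 z.2) ((volume.prod volume).prod ν) := by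
    refine ⟨hmeas.aestronglyMeasurable, ?_⟩
    rw [hasFiniteIntegral_iff_norm, lintegral_prod _ hmeas.norm.ennreal_ofReal.aemeasurable]
    have h3 := ((riesz_D2_integrable hN0 h0 h2 hN hw).norm.const_mul (Gamma (((N:ℝ) - α) / 2) * Gamma (((N:ℝ) + α) / 2))).2
    rw [hasFiniteIntegral_iff_norm] at h3
    refine lt_of_le_of_lt (le_of_eq ?_) h3
    refine lintegral_congr_ae ?_
    filter_upwards [ae_ne_zero2 hN0] with P hP
    have : ∫⁻ Q, ENNReal.ofReal ‖D2 w P.1 P.2 * sk N α P Q‖ ∂ν = ∫⁻ Q, ENNReal.ofReal ‖D2 w P.1 P.2‖ * ENNReal.ofReal (sk N α P Q) ∂ν := by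
      refine lintegral_congr_ae ?_
      filter_upwards [hνae] with Q hQ
      rw [← ENNReal.ofReal_mul (norm_nonneg _), norm_mul, Real.norm_of_nonneg (sk_nonneg P hQ.1 hQ.2)]
    rw [this, lintegral_const_mul' _ _ (by simp), sk_lint h0 hN hP.1 hP.2, ← ENNReal.ofReal_mul (norm_nonneg _)]
    congr 1
    rw [norm_mul _ ‖_‖, norm_norm, norm_mul (D2 w _ _), Real.norm_of_nonneg (mul_pos hG' hG).le, Real.norm_of_nonneg (by positivity : 0 ≤ (‖P.1‖ ^ (α - (N:ℝ)) * ‖P.2‖ ^ (-((N:ℝ) + α))))]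
    ring
  have s1 : Gamma (((N:ℝ) - α) / 2) * Gamma (((N:ℝ) + α) / 2) *
      (∫ P : EN N × EN N, D2 w P.1 P.2 * (‖P.1‖ ^ (α - (N:ℝ)) * ‖P.2‖ ^ (-((N:ℝ) + α))) ∂(volume.prod volume))
      = ∫ P : EN N × EN N, ∫ Q, D2 w P.1 P.2 * sk N α P Q ∂ν ∂(volume.prod volume) := by
    rw [← integral_const_mul]
    refine integral_congr_ae ?_
    filter_upwards [ae_ne_zero2 hN0] with P hP
    rw [integral_const_mul, sk_integral h0 hN hP.1 hP.2]
    ring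
  rw [s1, integral_integral_swap hInt]
  have hR := hInt.integral_prod_right
  set R : ℝ × ℝ → ℝ := fun Q => 2 * π ^ ((N:ℝ) / 2) * (Q.1 ^ (α / 2 - 1) * (Q.2⁻¹ * (mA w (Q.1 / (1 + Q.1) * Q.2) - mA w Q.2))) with hRd
  have hRe : (fun Q => ∫ P : EN N × EN N, D2 w P.1 P.2 * sk N α P Q ∂(volume.prod volume)) =ᵐ[ν] R := by
    filter_upwards [hνae] with Q hQ using inner_P hw hQ.1 hQ.2
  rw [integral_congr_ae hRe]
  have hR' : Integrable R ν := hR.congr hRe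
  rw [integral_prod _ hR']
  obtain ⟨K, hK⟩ := mA_bdd hw
  have hin : ∀ᵐ τ ∂(volume.restrict (Ioi (0:ℝ))), ∫ s in Ioi (0:ℝ), R (τ, s)
      = -(2 * π ^ ((N:ℝ) / 2) * π ^ ((N:ℝ) / 2) * w 0) * (τ ^ (α / 2 - 1) * log ((1 + τ) / τ)) := by
    filter_upwards [hR'.prod_right_ae, self_mem_ae_restrict measurableSet_Ioi] with τ hτ hτ0
    have hτ0 : 0 < τ := hτ0
    simp only [hRd] at hτ ⊢
    have hcne : 2 * π ^ ((N:ℝ) / 2) * τ ^ (α / 2 - 1) ≠ 0 := by positivity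
    simp_rw [← mul_assoc (2 * π ^ ((N:ℝ) / 2))] at hτ ⊢
    rw [integrable_const_mul_iff (IsUnit.mk0 _ hcne)] at hτ
    rw [integral_const_mul, frullani (mA_cont hw) hK (mA_zero hN0 hw) (mA_top hw) (by positivity) (by rw [div_lt_one (by positivity)]; linarith) hτ]
    rw [sub_zero, ← inv_div (1 + τ) τ, log_inv]
    ring
  rw [integral_congr_ae hin, integral_const_mul]
  have hlast : ∫ τ in Ioi (0:ℝ), τ ^ (α / 2 - 1) * log ((1 + τ) / τ) = Gamma (α / 2) * Gamma (1 - α / 2) / (α / 2) := by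
    have g1 := Gamma_pos_of_pos (show 0 < α / 2 by linarith)
    have g2 := Gamma_pos_of_pos (show 0 < 1 - α / 2 by linarith)
    rw [integral_eq_lintegral_of_nonneg_ae, logint (by linarith) (by linarith), ENNReal.toReal_ofReal (by positivity)]
    · refine (ae_restrict_iff' measurableSet_Ioi).2 (ae_of_all _ fun τ hτ => ?_)
      have hτ : 0 < τ := hτ
      refine mul_nonneg (by positivity) (log_nonneg ?_)
      rw [one_le_div hτ]; linarith
    · exact Measurable.aestronglyMeasurable (by fun_prop)
  rw [hlast]; ring

lemma FL_fund0 {N : ℕ} {α : ℝ} (hN0 : N ≠ 0) (h0 : 0 < α) (h2 : α < 2) (hN : α < N) {w : EN N → ℝ} (hw : Tst w) :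
    ∫ y : EN N, rieszA N α * ‖y‖ ^ (α - (N:ℝ)) * FL N α w y = - w 0 := by
  have hJ := J_eval hN0 h0 h2 hN hw
  rw [integral_prod _ (riesz_D2_integrable hN0 h0 h2 hN hw)] at hJ
  have hb : 0 < ((N:ℝ) + α) / 2 := by positivity
  have hb' : 0 < ((N:ℝ) - α) / 2 := by linarith
  have hG := Gamma_pos_of_pos hb
  have hG' := Gamma_pos_of_pos hb'
  have g1 := Gamma_pos_of_pos (show 0 < α / 2 by linarith)
  have g2 := Gamma_pos_of_pos (show 0 < 1 - α / 2 by linarith)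
  have hneg : |Gamma (-α / 2)| = Gamma (1 - α / 2) / (α / 2) := by
    have := Real.Gamma_add_one (s := -α / 2) (by linarith : -α / 2 ≠ 0)
    rw [show -α / 2 + 1 = 1 - α / 2 by ring] at this
    rw [this, show -α / 2 * Gamma (-α / 2) / (α / 2) = -Gamma (-α/2) by field_simp]
    apply abs_of_neg
    nlinarith
  have e1 : ∫ y : EN N, rieszA N α * ‖y‖ ^ (α - (N:ℝ)) * FL N α w y
      = rieszA N α * (fracLapCoeff N α / 2) * ∫ y : EN N, ∫ h, D2 w y h * (‖y‖ ^ (α - (N:ℝ)) * ‖h‖ ^ (-((N:ℝ) + α))) := by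
    rw [← integral_const_mul]
    congr 1; ext y
    unfold FL
    simp_rw [mul_left_comm (D2 w _ _)]
    rw [integral_const_mul]
    ring
  rw [e1]
  simp only at hJ
  generalize (∫ y : EN N, ∫ h, D2 w y h * (‖y‖ ^ (α - (N:ℝ)) * ‖h‖ ^ (-((N:ℝ) + α)))) = J at hJ ⊢
  unfold rieszA fracLapCoeff
  rw [hneg, show -(N:ℝ) / 2 = -((N:ℝ) / 2) by ring, Real.rpow_neg pi_pos.le]
  have hp : 0 < π ^ ((N:ℝ)/2) := by positivity
  have hq : (0:ℝ) < 2 ^ α := by positivity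
  generalize π ^ ((N:ℝ)/2) = p at *
  generalize (2:ℝ) ^ α = q at *
  generalize Gamma (((N:ℝ) + α) / 2) = A at *
  generalize Gamma (((N:ℝ) - α) / 2) = B at *
  generalize Gamma (α / 2) = C at *
  generalize Gamma (1 - α / 2) = D at *
  have hJ2 : J = -(2 * p * p * w 0 * (C * D / (α / 2))) / (B * A) := by
    rw [eq_div_iff (by positivity), ← hJ]; ring
  rw [hJ2]
  field_simp

lemma FL_fund {N : ℕ} {α : ℝ} (hN0 : N ≠ 0) (h0 : 0 < α) (h2 : α < 2) (hN : α < N) {w : EN N → ℝ} (hw : Tst w) (x : EN N) :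
    ∫ y : EN N, rieszA N α * ‖x - y‖ ^ (α - (N:ℝ)) * FL N α w y = - w x := by
  have hw' : Tst (fun t => w (t - (-x))) := by
    constructor
    · exact hw.1.comp (contDiff_id.sub contDiff_const)
    · exact hw.2.comp_homeomorph (Homeomorph.subRight (-x))
  have h := FL_fund0 hN0 h0 h2 hN hw'
  simp_rw [FL_trans, sub_neg_eq_add, zero_add] at h
  rw [← h, ← integral_add_right_eq_self _ x]
  congr 1; ext y
  rw [sub_add_cancel_right, norm_neg]

lemma Tst.trans {N : ℕ} {w : EN N → ℝ} (hw : Tst w) (x : EN N) : Tst (fun t => w (t - x)) :=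
  ⟨hw.1.comp (contDiff_id.sub contDiff_const), hw.2.comp_homeomorph (Homeomorph.subRight x)⟩

lemma riesz_FL_int {N : ℕ} {α : ℝ} (hN0 : N ≠ 0) (h0 : 0 < α) (h2 : α < 2) (hN : α < N) {w : EN N → ℝ} (hw : Tst w) (x : EN N) :
    Integrable (fun y : EN N => ‖x - y‖ ^ (α - (N:ℝ)) * FL N α w y) := by
  have hw' := hw.trans (-x)
  obtain ⟨C, hC0, hC⟩ := hw'.FL_bound hN0 h0 h2
  have h1 : Integrable (fun y : EN N => ‖y‖ ^ (α - (N:ℝ)) * FL N α (fun t => w (t - -x)) y) := by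
    refine ((riesz_weight_int hN0 h0 hN).const_mul C).mono' ?_ (ae_of_all _ fun y => ?_)
    · have := FL_meas (α := α) hw'.1.continuous.measurable
      exact Measurable.aestronglyMeasurable (by fun_prop)
    · rw [norm_mul, Real.norm_of_nonneg (by positivity), mul_left_comm]
      gcongr
      exact hC y
  have h3 := h1.comp_sub_right x
  refine h3.congr (ae_of_all _ fun y => ?_)
  beta_reduce
  rw [FL_trans, sub_neg_eq_add, sub_add_cancel, norm_sub_rev]

lemma out_meas {N : ℕ} (a : EN N) (r : ℝ) : MeasurableSet {z : EN N | r < ‖z - a‖} :=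
  measurableSet_lt measurable_const (by fun_prop)

lemma star {N : ℕ} {α : ℝ} (hN0 : N ≠ 0) (h0 : 0 < α) (h2 : α < 2) (hN : α < N) {w : EN N → ℝ} (hw : Tst w)
    {a : EN N} {r : ℝ} (hr : 0 < r) {x : EN N} (hx : x ∈ ball a r) :
    w x + ∫ y, greenBall N α a r x y * FL N α w y = ∫ z in {z | r < ‖z - a‖}, poissonBall N α a r x z * w z := by
  have hA := rieszA_pos h0 hN
  have hFm := FL_meas (α := α) hw.1.continuous.measurable
  set S := {z : EN N | r < ‖z - a‖} with hS
  have hSm : MeasurableSet S := out_meas a r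
  have hsw := sweep hN0 h0 h2 hN hr hx
  have hKm : Measurable (fun z => poissonBall N α a r x z) := (poissonBall_meas N α a r).comp (g := fun p : EN N × EN N => poissonBall N α a r p.1 p.2) (f := fun z => (x, z)) (by fun_prop)
  have hGm : Measurable (fun z => greenBall N α a r x z) := (greenBall_meas h0 hN a r).comp (g := fun p : EN N × EN N => greenBall N α a r p.1 p.2) (f := fun z => (x, z)) (by fun_prop)
  have hK0 : ∀ᵐ z ∂(volume.restrict S), 0 ≤ poissonBall N α a r x z :=
    (ae_restrict_iff' hSm).2 (ae_of_all _ fun z hz => poissonBall_nonneg h0 h2 hN hr hx hz)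
  have hG0 : ∀ y, 0 ≤ greenBall N α a r x y := greenBall_nonneg h0 hN a hr x
  -- real form of sweeping
  have hsr : ∀ᵐ y : EN N, ∫ z in S, poissonBall N α a r x z * (rieszA N α * ‖z - y‖ ^ (α - (N:ℝ)))
      = rieszA N α * ‖x - y‖ ^ (α - (N:ℝ)) - greenBall N α a r x y := by
    filter_upwards [hsw] with y hy
    rw [integral_eq_lintegral_of_nonneg_ae]
    · have e : ∫⁻ z in S, ENNReal.ofReal (poissonBall N α a r x z * (rieszA N α * ‖z - y‖ ^ (α - (N:ℝ))))
          = ∫⁻ z in S, ENNReal.ofReal (poissonBall N α a r x z) * ENNReal.ofReal (rieszA N α * ‖z - y‖ ^ (α - (N:ℝ))) := by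
        refine lintegral_congr_ae ?_
        filter_upwards [hK0] with z hz
        rw [ENNReal.ofReal_mul hz]
      rw [e]
      have hne : ∫⁻ z in S, ENNReal.ofReal (poissonBall N α a r x z) * ENNReal.ofReal (rieszA N α * ‖z - y‖ ^ (α - (N:ℝ))) ≠ ∞ := by
        intro h
        rw [h] at hy
        simp at hy
      have := congrArg ENNReal.toReal hy
      rw [ENNReal.toReal_add hne (by simp), ENNReal.toReal_ofReal (hG0 y), ENNReal.toReal_ofReal (by positivity)] at this
      linarith
    · filter_upwards [hK0] with z hz
      exact mul_nonneg hz (by positivity)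
    · exact Measurable.aestronglyMeasurable (by fun_prop)
  have hmeas : Measurable (fun p : EN N × EN N => poissonBall N α a r x p.2 * (rieszA N α * ‖p.2 - p.1‖ ^ (α - (N:ℝ))) * FL N α w p.1) := by
    fun_prop
  have hRi := (riesz_FL_int hN0 h0 h2 hN hw x)
  have hInt : Integrable (fun p : EN N × EN N => poissonBall N α a r x p.2 * (rieszA N α * ‖p.2 - p.1‖ ^ (α - (N:ℝ))) * FL N α w p.1) (volume.prod (volume.restrict S)) := by
    refine ⟨hmeas.aestronglyMeasurable, ?_⟩
    rw [hasFiniteIntegral_iff_norm, lintegral_prod _ hmeas.norm.ennreal_ofReal.aemeasurable]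
    have h3 := (hRi.norm.const_mul (rieszA N α)).2
    rw [hasFiniteIntegral_iff_norm] at h3
    refine lt_of_le_of_lt (lintegral_mono_ae ?_) h3
    filter_upwards [hsw] with y hy
    calc _ = (∫⁻ z in S, ENNReal.ofReal (poissonBall N α a r x z) * ENNReal.ofReal (rieszA N α * ‖z - y‖ ^ (α - (N:ℝ)))) * ENNReal.ofReal ‖FL N α w y‖ := by
          rw [← lintegral_mul_const' _ _ (by simp)]
          refine lintegral_congr_ae ?_
          filter_upwards [hK0] with z hz
          rw [← ENNReal.ofReal_mul hz, ← ENNReal.ofReal_mul (mul_nonneg hz (by positivity)), norm_mul, Real.norm_of_nonneg (mul_nonneg hz (by positivity))]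
      _ ≤ ENNReal.ofReal (rieszA N α * ‖x - y‖ ^ (α - (N:ℝ))) * ENNReal.ofReal ‖FL N α w y‖ := by
          rw [← hy]; gcongr; exact le_self_add
      _ = _ := by
          rw [← ENNReal.ofReal_mul (by positivity)]
          congr 1
          rw [norm_mul, norm_norm, norm_mul, Real.norm_of_nonneg hA.le, Real.norm_of_nonneg (by positivity : 0 ≤ ‖x - y‖ ^ (α - (N:ℝ)))]
          ring
  have e1 : ∫ z in S, poissonBall N α a r x z * w z = - ∫ z in S, ∫ y, poissonBall N α a r x z * (rieszA N α * ‖z - y‖ ^ (α - (N:ℝ))) * FL N α w y := by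
    rw [← integral_neg]
    congr 1; ext z
    simp_rw [mul_assoc (poissonBall N α a r x z)]
    rw [integral_const_mul, FL_fund hN0 h0 h2 hN hw z]
    ring
  rw [e1, ← integral_integral_swap hInt]
  have e2 : ∫ y, ∫ z in S, poissonBall N α a r x z * (rieszA N α * ‖z - y‖ ^ (α - (N:ℝ))) * FL N α w y
      = ∫ y, (rieszA N α * ‖x - y‖ ^ (α - (N:ℝ)) * FL N α w y - greenBall N α a r x y * FL N α w y) := by
    refine integral_congr_ae ?_
    filter_upwards [hsr] with y hy
    rw [integral_mul_const, hy]; ring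
  have i1 : Integrable (fun y => rieszA N α * ‖x - y‖ ^ (α - (N:ℝ)) * FL N α w y) := by
    simp_rw [mul_assoc]; exact hRi.const_mul _
  have i2 : Integrable (fun y => greenBall N α a r x y * FL N α w y) := by
    refine i1.norm.mono' (Measurable.aestronglyMeasurable (by fun_prop)) (ae_of_all _ fun y => ?_)
    rw [norm_mul, norm_mul, Real.norm_of_nonneg (hG0 y), Real.norm_of_nonneg (by positivity : 0 ≤ rieszA N α * ‖x - y‖ ^ (α - (N:ℝ)))]
    gcongr
    exact greenBall_le h0 hN a hr x y
  rw [e2, integral_sub i1 i2, FL_fund hN0 h0 h2 hN hw x]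
  ring

/-- convolution majorant of the Green function -/
def g0 (N : ℕ) (α r : ℝ) (z : EN N) : ℝ := (ball (0 : EN N) (2 * r)).indicator (fun z => rieszA N α * ‖z‖ ^ (α - (N:ℝ))) z

lemma g0_int {N : ℕ} {α : ℝ} (hN0 : N ≠ 0) (h0 : 0 < α) (r : ℝ) : Integrable (g0 N α r) := by
  unfold g0
  rw [integrable_indicator_iff measurableSet_ball]
  exact (((riesz_locInt hN0 h0).integrableOn_isCompact (isCompact_closedBall 0 (2 * r))).mono_set ball_subset_closedBall).const_mul _

lemma g0_nonneg {N : ℕ} {α : ℝ} (h0 : 0 < α) (hN : α < N) (r : ℝ) (z : EN N) : 0 ≤ g0 N α r z := by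
  have := rieszA_pos h0 hN
  exact indicator_nonneg (fun _ _ => by positivity) _

lemma greenBall_le_g0 {N : ℕ} {α : ℝ} (h0 : 0 < α) (hN : α < N) (a : EN N) {r : ℝ} (hr : 0 < r) (x y : EN N) :
    greenBall N α a r x y ≤ g0 N α r (x - y) := by
  by_cases hx : x ∈ ball a r
  · by_cases hy : y ∈ ball a r
    · unfold g0
      rw [indicator_of_mem]
      · exact greenBall_le h0 hN a hr x y
      · rw [mem_ball_zero_iff, ← dist_eq_norm]
        have := dist_triangle_right x y a
        rw [mem_ball] at hx hy
        linarith
    · rw [greenBall_zero a hr x hy]; exact g0_nonneg h0 hN _ _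
  · rw [greenBall_symm, greenBall_zero a hr y hx]; exact g0_nonneg h0 hN _ _

lemma green_bdd_int {N : ℕ} {α : ℝ} (hN0 : N ≠ 0) (h0 : 0 < α) (hN : α < N) (a : EN N) {r : ℝ} (hr : 0 < r) (x : EN N) :
    Integrable (fun y => greenBall N α a r x y) := by
  have hGm : Measurable (fun z => greenBall N α a r x z) := (greenBall_meas h0 hN a r).comp (g := fun p : EN N × EN N => greenBall N α a r p.1 p.2) (f := fun z => (x, z)) (by fun_prop)
  refine ((g0_int hN0 h0 r).comp_sub_left x).mono' hGm.aestronglyMeasurable (ae_of_all _ fun y => ?_)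
  rw [Real.norm_of_nonneg (greenBall_nonneg h0 hN a hr x y)]
  exact greenBall_le_g0 h0 hN a hr x y

/-- far decay of the Poisson kernel -/
lemma poisson_far {N : ℕ} {α : ℝ} (h0 : 0 < α) (h2 : α < 2) (hN : α < N) (a : EN N) {r R : ℝ} (hr : 0 < r) (hR : r < R) :
    ∃ C, 0 < C ∧ ∀ x ∈ ball a r, ∀ z, R ≤ ‖z - a‖ → poissonBall N α a r x z ≤ C * (1 + ‖z‖) ^ (-((N:ℝ) + α)) := by
  have hp := poissonCoeff_pos h0 h2 hN
  have hR0 : 0 < R := hr.trans hR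
  set κ : ℝ := ((1 + ‖a‖) / R + 1)⁻¹ with hκ
  have hκ0 : 0 < κ := by positivity
  set b : ℝ := 1 - r / R with hb
  have hb0 : 0 < b := by rw [hb, sub_pos, div_lt_one hR0]; exact hR
  have hbR : r = (1 - b) * R := by rw [hb]; field_simp; ring
  have hb1 : b < 1 := by rw [hb]; have : 0 < r / R := by positivity
                         linarith
  refine ⟨poissonCoeff N α * ((r ^ 2 / (b * κ ^ 2)) ^ (α / 2) * (b * κ) ^ (-(N:ℝ))), by positivity, fun x hx z hz => ?_⟩
  have hx : ‖x - a‖ < r := by rwa [mem_ball, dist_eq_norm] at hx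
  set d := ‖z - a‖ with hd
  have hd0 : 0 < d := by linarith
  have h1 : κ * (1 + ‖z‖) ≤ d := by
    have t : ‖z‖ ≤ ‖a‖ + d := by
      have := norm_add_le (z - a) a
      rw [sub_add_cancel] at this
      linarith
    rw [hκ, inv_mul_le_iff₀ (by positivity)]
    have : (1 + ‖a‖) ≤ (1 + ‖a‖) / R * d := by
      rw [div_mul_eq_mul_div, le_div_iff₀ hR0]
      gcongr
    linarith
  have hz0 : 0 < 1 + ‖z‖ := by positivity
  have h3 : b * d ≤ ‖x - z‖ := by
    have : d ≤ ‖x - z‖ + ‖x - a‖ := by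
      rw [hd]
      have := norm_sub_le_norm_sub_add_norm_sub z x a
      rwa [norm_sub_rev z x] at this
    nlinarith
  have h4 : b * d ^ 2 ≤ d ^ 2 - r ^ 2 := by
    have p1 : r ≤ (1 - b) * d := by
      rw [hbR]
      exact mul_le_mul_of_nonneg_left hz (by linarith)
    have p2 : r ^ 2 ≤ ((1 - b) * d) ^ 2 := by gcongr
    have p3 : ((1 - b) * d) ^ 2 ≤ (1 - b) * d ^ 2 := by
      rw [mul_pow]
      refine mul_le_mul_of_nonneg_right ?_ (by positivity)
      nlinarith
    linarith
  have k1 : (r ^ 2 - ‖x - a‖ ^ 2) / (d ^ 2 - r ^ 2) ≤ r ^ 2 / (b * κ ^ 2) * (1 + ‖z‖) ^ (-2 : ℝ) := by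
    rw [show (-2:ℝ) = ((-2 : ℤ) : ℝ) by norm_num, Real.rpow_intCast, zpow_neg]
    rw [div_mul_eq_mul_div, div_le_div_iff₀ (by have : 0 < b * d ^ 2 := by positivity
                                                linarith) (by positivity)]
    have q1 : b * (κ * (1 + ‖z‖)) ^ 2 ≤ d ^ 2 - r ^ 2 := by
      refine le_trans ?_ h4
      gcongr
    have q2 : 0 ≤ r ^ 2 - ‖x - a‖ ^ 2 := by nlinarith [norm_nonneg (x - a)]
    have q3 : r ^ 2 - ‖x - a‖ ^ 2 ≤ r ^ 2 := by nlinarith [norm_nonneg (x - a)]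
    calc _ ≤ r ^ 2 * (b * κ ^ 2) := by gcongr
      _ = r ^ 2 * ((1 + ‖z‖) ^ 2)⁻¹ * (b * (κ * (1 + ‖z‖)) ^ 2) := by field_simp
      _ ≤ _ := by
        refine mul_le_mul_of_nonneg_left q1 (by positivity)
  have k2 : ‖x - z‖ ^ (-(N:ℝ)) ≤ (b * κ) ^ (-(N:ℝ)) * (1 + ‖z‖) ^ (-(N:ℝ)) := by
    rw [← Real.mul_rpow (by positivity) hz0.le]
    apply Real.rpow_le_rpow_of_nonpos (by positivity)
    · refine le_trans ?_ h3
      rw [mul_assoc]; gcongr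
    · simp
  unfold poissonBall
  have hnn : 0 ≤ (r ^ 2 - ‖x - a‖ ^ 2) / (d ^ 2 - r ^ 2) := by
    apply div_nonneg <;> nlinarith [norm_nonneg (x - a)]
  calc _ ≤ poissonCoeff N α * (r ^ 2 / (b * κ ^ 2) * (1 + ‖z‖) ^ (-2 : ℝ)) ^ (α / 2) * ((b * κ) ^ (-(N:ℝ)) * (1 + ‖z‖) ^ (-(N:ℝ))) := by
        gcongr
    _ = _ := by
        rw [Real.mul_rpow (by positivity) (by positivity), ← Real.rpow_mul hz0.le, show -2 * (α / 2) = -α by ring, neg_add, Real.rpow_add hz0]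
        ring

open Classical in
/-- the Poisson kernel extended by zero -/
def KS (N : ℕ) (α : ℝ) (a : EN N) (r : ℝ) (x z : EN N) : ℝ :=
  if x ∈ ball a r ∧ r < ‖z - a‖ then poissonBall N α a r x z else 0

lemma KS_nonneg {N : ℕ} {α : ℝ} (h0 : 0 < α) (h2 : α < 2) (hN : α < N) {a : EN N} {r : ℝ} (hr : 0 < r) (x z : EN N) :
    0 ≤ KS N α a r x z := by
  unfold KS
  split_ifs with h
  · exact poissonBall_nonneg h0 h2 hN hr h.1 h.2
  · exact le_rfl

lemma KS_meas (N : ℕ) (α : ℝ) (a : EN N) (r : ℝ) : Measurable (fun p : EN N × EN N => KS N α a r p.1 p.2) := by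
  unfold KS
  refine Measurable.ite ?_ (poissonBall_meas N α a r) measurable_const
  exact (measurable_fst measurableSet_ball).inter (measurable_snd (out_meas a r))

lemma KS_meas_right (N : ℕ) (α : ℝ) (a : EN N) (r : ℝ) (x : EN N) : Measurable (fun z => KS N α a r x z) :=
  (KS_meas N α a r).comp (g := fun p : EN N × EN N => KS N α a r p.1 p.2) (f := fun z => (x, z)) (by fun_prop)

lemma KS_meas_left (N : ℕ) (α : ℝ) (a : EN N) (r : ℝ) (z : EN N) : Measurable (fun x => KS N α a r x z) :=
  (KS_meas N α a r).comp (g := fun p : EN N × EN N => KS N α a r p.1 p.2) (f := fun x => (x, z)) (by fun_prop)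

lemma G_meas_right {N : ℕ} {α : ℝ} (h0 : 0 < α) (hN : α < N) (a : EN N) (r : ℝ) (x : EN N) : Measurable (fun z => greenBall N α a r x z) :=
  (greenBall_meas h0 hN a r).comp (g := fun p : EN N × EN N => greenBall N α a r p.1 p.2) (f := fun z => (x, z)) (by fun_prop)

lemma KS_out {N : ℕ} {α : ℝ} {a : EN N} {r : ℝ} {x : EN N} (hx : x ∉ ball a r) (z : EN N) : KS N α a r x z = 0 := by
  unfold KS; rw [if_neg]; tauto

lemma KS_in {N : ℕ} {α : ℝ} {a : EN N} {r : ℝ} (x : EN N) {z : EN N} (hz : ¬ r < ‖z - a‖) : KS N α a r x z = 0 := by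
  unfold KS; rw [if_neg]; tauto

lemma KS_eq {N : ℕ} {α : ℝ} {a : EN N} {r : ℝ} {x z : EN N} (hx : x ∈ ball a r) (hz : r < ‖z - a‖) :
    KS N α a r x z = poissonBall N α a r x z := by
  unfold KS; rw [if_pos ⟨hx, hz⟩]

lemma KS_int {N : ℕ} {α : ℝ} {a : EN N} {r : ℝ} {x : EN N} (hx : x ∈ ball a r) (v : EN N → ℝ) :
    ∫ z in {z | r < ‖z - a‖}, poissonBall N α a r x z * v z = ∫ z, KS N α a r x z * v z := by
  rw [← integral_indicator (out_meas a r)]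
  congr 1; ext z
  by_cases hz : r < ‖z - a‖
  · rw [indicator_of_mem (by exact hz), KS_eq hx hz]
  · rw [indicator_of_notMem (by exact hz), KS_in x hz, zero_mul]

lemma star' {N : ℕ} {α : ℝ} (hN0 : N ≠ 0) (h0 : 0 < α) (h2 : α < 2) (hN : α < N) {w : EN N → ℝ} (hw : Tst w)
    {a : EN N} {r : ℝ} (hr : 0 < r) {x : EN N} (hx : x ∈ ball a r) :
    w x + ∫ y, greenBall N α a r x y * FL N α w y = ∫ z, KS N α a r x z * w z := by
  rw [star hN0 h0 h2 hN hw hr hx, KS_int hx]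

lemma KS_near {N : ℕ} {α : ℝ} (hN0 : N ≠ 0) (h0 : 0 < α) (h2 : α < 2) (hN : α < N) (a : EN N) {r R : ℝ} (hr : 0 < r) (hR : r < R) :
    ∃ C, 0 < C ∧ ∀ x, ∫⁻ z in ball a R, ENNReal.ofReal (KS N α a r x z) ≤ ENNReal.ofReal C := by
  have hA := rieszA_pos h0 hN
  set L : ℝ := R + 2 with hL
  set D : ℝ := R + L + 1 with hD
  have hD0 : 0 < D := by linarith
  refine ⟨D ^ ((N:ℝ) - α), by positivity, fun x => ?_⟩
  by_cases hx : x ∈ ball a r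
  swap
  · simp [KS_out hx]
  have : NeZero N := ⟨hN0⟩
  set v : EN N := EuclideanSpace.single (0 : Fin N) L with hv
  have hvn : ‖v‖ = L := by
    rw [hv, EuclideanSpace.norm_single, Real.norm_of_nonneg (by linarith)]
  obtain ⟨y, hy, hyb⟩ := (Measure.dense_of_ae (sweep hN0 h0 h2 hN hr hx)).exists_mem_open (isOpen_ball (x := a + v) (ε := 1)) ⟨a + v, by simp⟩
  have hxb := hx
  rw [mem_ball] at hyb hx
  simp only [mem_setOf_eq] at hy
  have hva : dist (a + v) a = L := by rw [dist_eq_norm, add_sub_cancel_left, hvn]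
  have t1 := dist_triangle y (a + v) a
  have t2 := dist_triangle_left (a + v) a y
  have hya1 : dist y a ≤ L + 1 := by linarith
  have hya2 : L - 1 ≤ dist y a := by linarith
  have hxy : 1 ≤ ‖x - y‖ := by
    rw [← dist_eq_norm]
    have := dist_triangle_left y a x
    linarith
  have hexp : α - (N:ℝ) ≤ 0 := by linarith
  have b1 : ‖x - y‖ ^ (α - (N:ℝ)) ≤ 1 := Real.rpow_le_one_of_one_le_of_nonpos hxy hexp
  have b2 : ∀ z ∈ ball a R, D ^ (α - (N:ℝ)) ≤ ‖z - y‖ ^ (α - (N:ℝ)) := by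
    intro z hz
    rw [mem_ball] at hz
    have q1 := dist_triangle_left y a z
    have q2 := dist_triangle_right z y a
    rw [← dist_eq_norm]
    exact Real.rpow_le_rpow_of_nonpos (by linarith) (by linarith) hexp
  have hDp : 0 < D ^ (α - (N:ℝ)) := by positivity
  have key : ENNReal.ofReal (rieszA N α * D ^ (α - (N:ℝ))) * ∫⁻ z in ball a R, ENNReal.ofReal (KS N α a r x z) ≤ ENNReal.ofReal (rieszA N α) := by
    calc _ = ∫⁻ z in ball a R, ENNReal.ofReal (rieszA N α * D ^ (α - (N:ℝ))) * ENNReal.ofReal (KS N α a r x z) := by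
          rw [lintegral_const_mul' _ _ (by simp)]
      _ ≤ ∫⁻ z, {z | r < ‖z - a‖}.indicator (fun z => ENNReal.ofReal (poissonBall N α a r x z) * ENNReal.ofReal (rieszA N α * ‖z - y‖ ^ (α - (N:ℝ)))) z := by
          rw [← lintegral_indicator measurableSet_ball]
          refine lintegral_mono fun z => ?_
          by_cases hz : z ∈ ball a R
          · rw [indicator_of_mem hz]
            by_cases hz' : r < ‖z - a‖
            · rw [indicator_of_mem (by exact hz'), KS_eq hxb hz', mul_comm]
              exact mul_le_mul' le_rfl (ENNReal.ofReal_le_ofReal (mul_le_mul_of_nonneg_left (b2 z hz) hA.le))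
            · rw [KS_in x hz']; simp
          · rw [indicator_of_notMem hz]; simp
      _ = ∫⁻ z in {z | r < ‖z - a‖}, ENNReal.ofReal (poissonBall N α a r x z) * ENNReal.ofReal (rieszA N α * ‖z - y‖ ^ (α - (N:ℝ))) :=
          lintegral_indicator (out_meas a r) _
      _ ≤ ENNReal.ofReal (rieszA N α * ‖x - y‖ ^ (α - (N:ℝ))) := by
          rw [← hy]; exact le_self_add
      _ ≤ _ := by
          refine ENNReal.ofReal_le_ofReal ?_
          nlinarith
  have hfin := ENNReal.le_div_iff_mul_le (a := ∫⁻ z in ball a R, ENNReal.ofReal (KS N α a r x z)) (b := ENNReal.ofReal (rieszA N α * D ^ (α - (N:ℝ)))) (c := ENNReal.ofReal (rieszA N α)) (Or.inl (by simp; positivity)) (Or.inl (by simp))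
  rw [mul_comm] at key
  refine (hfin.2 key).trans ?_
  rw [← ENNReal.ofReal_div_of_pos (by positivity)]
  refine ENNReal.ofReal_le_ofReal (le_of_eq ?_)
  rw [show (N:ℝ) - α = -(α - (N:ℝ)) by ring, Real.rpow_neg hD0.le]
  field_simp

/-- admissible functions: bounded on a larger ball and in the weighted space -/
def Adm (N : ℕ) (α : ℝ) (a : EN N) (R : ℝ) (v : EN N → ℝ) : Prop :=
  (∃ M, 0 < M ∧ ∀ z ∈ ball a R, |v z| ≤ M) ∧ Integrable (fun y => v y * (1 + ‖y‖) ^ (-((N:ℝ) + α)))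

lemma memL_aesm {N : ℕ} {α : ℝ} {v : EN N → ℝ} (hv : Integrable (fun y => v y * (1 + ‖y‖) ^ (-((N:ℝ) + α)))) :
    AEStronglyMeasurable v := by
  have h1 : AEStronglyMeasurable (fun y : EN N => (1 + ‖y‖) ^ ((N:ℝ) + α)) volume :=
    Measurable.aestronglyMeasurable (by fun_prop)
  refine (hv.1.mul h1).congr (ae_of_all _ fun y => ?_)
  simp only [Pi.mul_apply]
  rw [mul_assoc, ← Real.rpow_add (by positivity)]
  simp

lemma Tst.adm {N : ℕ} {α : ℝ} (h0 : 0 < α) {w : EN N → ℝ} (hw : Tst w) (a : EN N) (R : ℝ) : Adm N α a R w := by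
  obtain ⟨M, hM0, hM⟩ := hw.bdd
  refine ⟨⟨M, hM0, fun z _ => hM z⟩, ?_⟩
  refine hw.integrable.norm.mono' ?_ (ae_of_all _ fun y => ?_)
  · have := hw.1.continuous.measurable
    exact Measurable.aestronglyMeasurable (by fun_prop)
  · rw [norm_mul, Real.norm_of_nonneg (by positivity : 0 ≤ (1 + ‖y‖) ^ (-((N:ℝ) + α)))]
    refine mul_le_of_le_one_right (norm_nonneg _) ?_
    apply Real.rpow_le_one_of_one_le_of_nonpos
    · linarith [norm_nonneg y]
    · have : (0:ℝ) ≤ N := by positivity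
      linarith

lemma KS_lint {N : ℕ} {α : ℝ} (hN0 : N ≠ 0) (h0 : 0 < α) (h2 : α < 2) (hN : α < N) {a : EN N} {r R : ℝ} (hr : 0 < r) (hR : r < R)
    {v : EN N → ℝ} (hv : Adm N α a R v) :
    ∃ C, 0 < C ∧ ∀ x, ∫⁻ z, ENNReal.ofReal ‖KS N α a r x z * v z‖ ≤ ENNReal.ofReal C := by
  obtain ⟨⟨M, hM0, hM⟩, hvi⟩ := hv
  obtain ⟨C1, hC1, h1⟩ := KS_near hN0 h0 h2 hN a hr hR
  obtain ⟨C2, hC2, h3⟩ := poisson_far h0 h2 hN a hr hR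
  set W : ℝ := ∫ y, ‖v y * (1 + ‖y‖) ^ (-((N:ℝ) + α))‖ with hW
  have hW0 : 0 ≤ W := integral_nonneg fun _ => norm_nonneg _
  refine ⟨M * C1 + C2 * W, by positivity, fun x => ?_⟩
  have hpt : ∀ z, ENNReal.ofReal ‖KS N α a r x z * v z‖ ≤
      (ball a R).indicator (fun z => ENNReal.ofReal M * ENNReal.ofReal (KS N α a r x z)) z
        + ENNReal.ofReal C2 * ENNReal.ofReal ‖v z * (1 + ‖z‖) ^ (-((N:ℝ) + α))‖ := by
    intro z
    have hK := KS_nonneg h0 h2 hN hr (a := a) x z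
    rw [norm_mul, Real.norm_of_nonneg hK]
    by_cases hz : z ∈ ball a R
    · rw [indicator_of_mem hz, ← ENNReal.ofReal_mul hM0.le, mul_comm]
      refine le_trans (ENNReal.ofReal_le_ofReal ?_) le_self_add
      exact mul_le_mul_of_nonneg_right (hM z hz) hK
    · rw [indicator_of_notMem hz, zero_add, ← ENNReal.ofReal_mul hC2.le]
      refine ENNReal.ofReal_le_ofReal ?_
      rw [norm_mul, Real.norm_of_nonneg (by positivity : 0 ≤ (1 + ‖z‖) ^ (-((N:ℝ) + α))), mul_left_comm, mul_comm]
      refine mul_le_mul_of_nonneg_left ?_ (norm_nonneg _)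
      rw [mem_ball, dist_eq_norm, not_lt] at hz
      by_cases hx : x ∈ ball a r
      · rw [KS_eq hx (hR.trans_le hz)]
        exact h3 x hx z hz
      · rw [KS_out hx]; positivity
  refine (lintegral_mono hpt).trans ?_
  have hm : Measurable ((ball a R).indicator (fun z => ENNReal.ofReal M * ENNReal.ofReal (KS N α a r x z))) :=
    (((KS_meas_right N α a r x).ennreal_ofReal).const_mul _).indicator measurableSet_ball
  rw [lintegral_add_left hm, lintegral_indicator measurableSet_ball, lintegral_const_mul' _ _ (by simp), lintegral_const_mul' _ _ (by simp),
    ← ofReal_integral_eq_lintegral_ofReal hvi.norm (ae_of_all _ fun _ => norm_nonneg _), ← hW,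
    ENNReal.ofReal_add (by positivity) (by positivity), ENNReal.ofReal_mul hM0.le, ENNReal.ofReal_mul hC2.le]
  gcongr
  exact h1 x

lemma KS_integrable {N : ℕ} {α : ℝ} (hN0 : N ≠ 0) (h0 : 0 < α) (h2 : α < 2) (hN : α < N) {a : EN N} {r R : ℝ} (hr : 0 < r) (hR : r < R)
    {v : EN N → ℝ} (hv : Adm N α a R v) (x : EN N) : Integrable (fun z => KS N α a r x z * v z) := by
  obtain ⟨C, hC0, hC⟩ := KS_lint hN0 h0 h2 hN hr hR hv
  refine ⟨(KS_meas_right N α a r x).aestronglyMeasurable.mul (memL_aesm hv.2), ?_⟩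
  rw [hasFiniteIntegral_iff_norm]
  exact (hC x).trans_lt (by simp)

/-- Fubini for a kernel with bounded row mass -/
lemma ker_prod_int {N : ℕ} {k : EN N × EN N → ℝ} (hk : AEStronglyMeasurable k (volume.prod volume)) {C : ℝ}
    (hC : ∀ x, ∫⁻ z, ENNReal.ofReal ‖k (x, z)‖ ≤ ENNReal.ofReal C) {f : EN N → ℝ} (hf : Integrable f) :
    Integrable (fun p : EN N × EN N => k p * f p.1) (volume.prod volume) := by
  have hm : AEStronglyMeasurable (fun p : EN N × EN N => k p * f p.1) (volume.prod volume) := hk.mul hf.1.comp_fst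
  refine ⟨hm, ?_⟩
  rw [hasFiniteIntegral_iff_norm, lintegral_prod _ hm.norm.aemeasurable.ennreal_ofReal]
  have h3 := hf.2
  rw [hasFiniteIntegral_iff_norm] at h3
  calc _ ≤ ∫⁻ x, ENNReal.ofReal C * ENNReal.ofReal ‖f x‖ := by
        refine lintegral_mono fun x => ?_
        calc _ = (∫⁻ z, ENNReal.ofReal ‖k (x, z)‖) * ENNReal.ofReal ‖f x‖ := by
              rw [← lintegral_mul_const' _ _ (by simp)]
              congr 1; ext z
              rw [norm_mul, ENNReal.ofReal_mul (norm_nonneg _)]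
          _ ≤ _ := by gcongr; exact hC x
    _ = ENNReal.ofReal C * ∫⁻ x, ENNReal.ofReal ‖f x‖ := lintegral_const_mul' _ _ (by simp)
    _ < ∞ := ENNReal.mul_lt_top (by simp) h3

lemma KS_prod_int {N : ℕ} {α : ℝ} (hN0 : N ≠ 0) (h0 : 0 < α) (h2 : α < 2) (hN : α < N) {a : EN N} {r R : ℝ} (hr : 0 < r) (hR : r < R)
    {v : EN N → ℝ} (hv : Adm N α a R v) {f : EN N → ℝ} (hf : Integrable f) :
    Integrable (fun p : EN N × EN N => KS N α a r p.1 p.2 * v p.2 * f p.1) (volume.prod volume) := by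
  obtain ⟨C, hC0, hC⟩ := KS_lint hN0 h0 h2 hN hr hR hv
  exact ker_prod_int (k := fun p : EN N × EN N => KS N α a r p.1 p.2 * v p.2)
    ((KS_meas N α a r).aestronglyMeasurable.mul (memL_aesm hv.2).comp_snd) hC hf

lemma G_lint {N : ℕ} {α : ℝ} (hN0 : N ≠ 0) (h0 : 0 < α) (hN : α < N) (a : EN N) {r : ℝ} (hr : 0 < r)
    {g : EN N → ℝ} {M : ℝ} (hM0 : 0 < M) (hM : ∀ z ∈ ball a r, |g z| ≤ M) (x : EN N) :
    ∫⁻ z, ENNReal.ofReal ‖greenBall N α a r x z * g z‖ ≤ ENNReal.ofReal (M * ∫ z, g0 N α r z) := by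
  have e : ∫ z, g0 N α r z = ∫ z, g0 N α r (x - z) := (integral_sub_left_eq_self (g0 N α r) volume x).symm
  rw [e, ← integral_const_mul, ofReal_integral_eq_lintegral_ofReal (((g0_int hN0 h0 r).comp_sub_left x).const_mul M)
    (ae_of_all _ fun z => mul_nonneg hM0.le (g0_nonneg h0 hN r _))]
  refine lintegral_mono fun z => ENNReal.ofReal_le_ofReal ?_
  rw [norm_mul, Real.norm_of_nonneg (greenBall_nonneg h0 hN a hr x z), mul_comm]
  by_cases hz : z ∈ ball a r
  · exact mul_le_mul (hM z hz) (greenBall_le_g0 h0 hN a hr x z) (greenBall_nonneg h0 hN a hr x z) hM0.le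
  · rw [greenBall_zero a hr x hz, mul_zero]
    exact mul_nonneg hM0.le (g0_nonneg h0 hN r _)

lemma G_prod_int {N : ℕ} {α : ℝ} (hN0 : N ≠ 0) (h0 : 0 < α) (hN : α < N) (a : EN N) {r : ℝ} (hr : 0 < r)
    {g : EN N → ℝ} (hg : AEStronglyMeasurable g) {M : ℝ} (hM0 : 0 < M) (hM : ∀ z ∈ ball a r, |g z| ≤ M) {f : EN N → ℝ} (hf : Integrable f) :
    Integrable (fun p : EN N × EN N => greenBall N α a r p.1 p.2 * g p.2 * f p.1) (volume.prod volume) :=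
  ker_prod_int (k := fun p : EN N × EN N => greenBall N α a r p.1 p.2 * g p.2)
    ((greenBall_meas h0 hN a r).aestronglyMeasurable.mul hg.comp_snd) (G_lint hN0 h0 hN a hr hM0 hM) hf

lemma G_integrable {N : ℕ} {α : ℝ} (hN0 : N ≠ 0) (h0 : 0 < α) (hN : α < N) (a : EN N) {r : ℝ} (hr : 0 < r)
    {g : EN N → ℝ} (hg : AEStronglyMeasurable g) {M : ℝ} (hM0 : 0 < M) (hM : ∀ z ∈ ball a r, |g z| ≤ M) (x : EN N) :
    Integrable (fun z => greenBall N α a r x z * g z) := by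
  refine ⟨(G_meas_right h0 hN a r x).aestronglyMeasurable.mul hg, ?_⟩
  rw [hasFiniteIntegral_iff_norm]
  exact (G_lint hN0 h0 hN a hr hM0 hM x).trans_lt (by simp)

/-- bounded by the weight implies integrable against an element of the weighted space -/
lemma memL_mul_int {N : ℕ} {α : ℝ} {v : EN N → ℝ} (hv : Integrable (fun y => v y * (1 + ‖y‖) ^ (-((N:ℝ) + α))))
    {f : EN N → ℝ} (hf : AEStronglyMeasurable f) {C : ℝ} (hC : ∀ y, |f y| ≤ C * (1 + ‖y‖) ^ (-((N:ℝ) + α))) :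
    Integrable (fun y => v y * f y) := by
  refine (hv.norm.const_mul C).mono' ((memL_aesm hv).mul hf) (ae_of_all _ fun y => ?_)
  rw [norm_mul, norm_mul, Real.norm_of_nonneg (by positivity : 0 ≤ (1 + ‖y‖) ^ (-((N:ℝ) + α))), mul_left_comm]
  exact mul_le_mul_of_nonneg_left (hC y) (norm_nonneg _)

lemma Tst.FL_int {N : ℕ} {α : ℝ} (hN0 : N ≠ 0) (h0 : 0 < α) (h2 : α < 2) {w : EN N → ℝ} (hw : Tst w) : Integrable (FL N α w) := by
  obtain ⟨C, hC0, hC⟩ := hw.FL_bound hN0 h0 h2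
  exact ((weight_int h0).const_mul C).mono' (FL_meas (α := α) hw.1.continuous.measurable).aestronglyMeasurable (ae_of_all _ hC)

lemma Tst.FL_bdd {N : ℕ} {α : ℝ} (hN0 : N ≠ 0) (h0 : 0 < α) (h2 : α < 2) {w : EN N → ℝ} (hw : Tst w) : ∃ M, 0 < M ∧ ∀ y, |FL N α w y| ≤ M := by
  obtain ⟨C, hC0, hC⟩ := hw.FL_bound hN0 h0 h2
  refine ⟨C, hC0, fun y => (hC y).trans ?_⟩
  refine mul_le_of_le_one_right hC0.le ?_
  apply Real.rpow_le_one_of_one_le_of_nonpos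
  · linarith [norm_nonneg y]
  · have : (0:ℝ) ≤ N := by positivity
    linarith

lemma supp_zero {N : ℕ} {φ : EN N → ℝ} {s : Set (EN N)} (h : tsupport φ ⊆ s) {x : EN N} (hx : x ∉ s) : φ x = 0 :=
  image_eq_zero_of_notMem_tsupport fun h' => hx (h h')

lemma ball_out {N : ℕ} {a z : EN N} {r : ℝ} (hz : r < ‖z - a‖) : z ∉ ball a r := by
  rw [mem_ball, dist_eq_norm]; linarith

lemma G_FL {N : ℕ} {α : ℝ} (hN0 : N ≠ 0) (h0 : 0 < α) (h2 : α < 2) (hN : α < N) {a : EN N} {r : ℝ} (hr : 0 < r)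
    {φ : EN N → ℝ} (hφ : Tst φ) (hs : tsupport φ ⊆ ball a r) (y : EN N) :
    ∫ x, greenBall N α a r x y * FL N α φ x = - φ y := by
  by_cases hy : y ∈ ball a r
  · have := star' hN0 h0 h2 hN hφ hr hy
    have e : ∫ z, KS N α a r y z * φ z = 0 := by
      refine integral_eq_zero_of_ae (ae_of_all _ fun z => ?_)
      by_cases hz : r < ‖z - a‖
      · simp [supp_zero hs (ball_out hz)]
      · simp [KS_in y hz]
    rw [e] at this
    simp_rw [greenBall_symm a r _ y]
    linarith
  · simp_rw [greenBall_zero a hr _ hy, supp_zero hs hy]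
    simp

/-- balayage of FL φ -/
def kk (N : ℕ) (α : ℝ) (a : EN N) (r : ℝ) (φ : EN N → ℝ) (z : EN N) : ℝ := ∫ x, KS N α a r x z * FL N α φ x

lemma kk_test {N : ℕ} {α : ℝ} (hN0 : N ≠ 0) (h0 : 0 < α) (h2 : α < 2) (hN : α < N) {a : EN N} {r : ℝ} (hr : 0 < r)
    {φ : EN N → ℝ} (hφ : Tst φ) (hs : tsupport φ ⊆ ball a r) {ψ : EN N → ℝ} (hψ : Tst ψ) (hsψ : tsupport ψ ⊆ {z | r < ‖z - a‖}) :
    (∫ z, ψ z * FL N α φ z) + ∫ z, ψ z * kk N α a r φ z = 0 := by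
  obtain ⟨M, hM0, hM⟩ := hψ.FL_bdd hN0 h0 h2
  have hFm := FL_meas (α := α) hψ.1.continuous.measurable
  have hi1 := G_prod_int hN0 h0 hN a hr hFm.aestronglyMeasurable hM0 (fun z _ => hM z) (hφ.FL_int hN0 h0 h2)
  have hi2 := KS_prod_int hN0 h0 h2 hN hr (R := r + 1) (by linarith) (hψ.adm h0 a (r + 1)) (hφ.FL_int hN0 h0 h2)
  have e0 : ∀ x, ∫ y, greenBall N α a r x y * FL N α ψ y * FL N α φ x = ∫ z, KS N α a r x z * ψ z * FL N α φ x := by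
    intro x
    rw [integral_mul_const, integral_mul_const]
    congr 1
    by_cases hx : x ∈ ball a r
    · have := star' hN0 h0 h2 hN hψ hr hx
      rw [supp_zero hsψ, zero_add] at this
      · exact this
      · rw [mem_ball, dist_eq_norm] at hx
        exact not_lt.2 hx.le
    · simp_rw [KS_out hx, fun y => greenBall_symm (α := α) a r x y, greenBall_zero a hr _ hx]
      simp
  have e1 := integral_congr_ae (μ := volume) (ae_of_all _ e0)
  have s1 := integral_integral_swap (f := fun x y => greenBall N α a r x y * FL N α ψ y * FL N α φ x) hi1
  have s2 := integral_integral_swap (f := fun x z => KS N α a r x z * ψ z * FL N α φ x) hi2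
  beta_reduce at s1 s2
  rw [s1, s2] at e1
  have e2 : ∀ y, ∫ x, greenBall N α a r x y * FL N α ψ y * FL N α φ x = - (φ y * FL N α ψ y) := by
    intro y
    simp_rw [fun x => mul_right_comm (greenBall N α a r x y)]
    rw [integral_mul_const, G_FL hN0 h0 h2 hN hr hφ hs y]
    ring
  have e3 : ∀ z, ∫ x, KS N α a r x z * ψ z * FL N α φ x = ψ z * kk N α a r φ z := by
    intro z
    have e : (fun x => KS N α a r x z * ψ z * FL N α φ x) = fun x => KS N α a r x z * FL N α φ x * ψ z := by
      ext x; ring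
    rw [e, integral_mul_const, mul_comm]; rfl
  simp_rw [e2, e3] at e1
  rw [← e1, integral_neg, FL_symm hN0 h0 h2 hφ hψ]
  ring

lemma kk_ae {N : ℕ} {α : ℝ} (hN0 : N ≠ 0) (h0 : 0 < α) (h2 : α < 2) (hN : α < N) {a : EN N} {r : ℝ} (hr : 0 < r)
    {φ : EN N → ℝ} (hφ : Tst φ) (hs : tsupport φ ⊆ ball a r) :
    ∀ᵐ z, z ∈ {z : EN N | r < ‖z - a‖} → FL N α φ z + kk N α a r φ z = 0 := by
  have hopen : IsOpen {z : EN N | r < ‖z - a‖} := isOpen_lt continuous_const (by fun_prop)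
  have hFi := hφ.FL_int hN0 h0 h2
  -- local integrability of kk
  have hkl : LocallyIntegrable (kk N α a r φ) := by
    rw [locallyIntegrable_iff]
    intro k hk
    obtain ⟨R0, hR0⟩ := hk.isBounded.subset_ball a
    set R := max R0 (r + 1) with hRdef
    have hR : r < R := lt_of_lt_of_le (by linarith) (le_max_right _ _)
    have hkR : k ⊆ ball a R := hR0.trans (ball_subset_ball (le_max_left _ _))
    refine IntegrableOn.mono_set ?_ hkR
    have hadm : Adm N α a R ((ball a R).indicator (fun _ => (1:ℝ))) := by
      refine ⟨⟨1, one_pos, fun z hz => by rw [indicator_of_mem hz]; simp⟩, ?_⟩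
      refine (weight_int (α := α) h0).mono' ?_ (ae_of_all _ fun y => ?_)
      · exact ((measurable_const.indicator measurableSet_ball).mul (by fun_prop)).aestronglyMeasurable
      · by_cases hy : y ∈ ball a R
        · rw [indicator_of_mem hy, one_mul, Real.norm_of_nonneg (by positivity)]
        · rw [indicator_of_notMem hy, zero_mul, norm_zero]; positivity
    have hi := (KS_prod_int hN0 h0 h2 hN hr hR hadm hFi).integral_prod_right
    rw [← integrable_indicator_iff measurableSet_ball]
    refine hi.congr (ae_of_all _ fun z => ?_)
    dsimp only
    by_cases hz : z ∈ ball a R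
    · rw [indicator_of_mem hz, indicator_of_mem hz]; simp [kk]
    · rw [indicator_of_notMem hz, indicator_of_notMem hz]; simp
  refine hopen.ae_eq_zero_of_integral_contDiff_smul_eq_zero ((hFi.locallyIntegrable.add hkl).locallyIntegrableOn _) ?_
  intro g hg hgc hgs
  have hT : Tst g := ⟨hg, hgc⟩
  have := kk_test hN0 h0 h2 hN hr hφ hs hT hgs
  rw [← this]
  have i1 : Integrable (fun z => g z * FL N α φ z) := by
    exact (hFi.locallyIntegrable).integrable_smul_left_of_hasCompactSupport hg.continuous hgc
  have i2 : Integrable (fun z => g z * kk N α a r φ z) := by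
    exact hkl.integrable_smul_left_of_hasCompactSupport hg.continuous hgc
  rw [← integral_add i1 i2]
  congr 1; ext z
  simp [mul_add]

lemma local_back {N : ℕ} {α : ℝ} (hN0 : N ≠ 0) (h0 : 0 < α) (h2 : α < 2) (hN : α < N) {a : EN N} {r R : ℝ} (hr : 0 < r) (hR : r < R)
    {γ : ℝ} (hγ : 0 < γ) {u : EN N → ℝ} (hpos : ∀ x, 0 ≤ u x) (hu : Adm N α a R u)
    (hrep : ∀ x ∈ ball a r, u x + (∫ y in ball a r, greenBall N α a r x y * u y ^ γ) = Hball N α a r u x)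
    {φ : EN N → ℝ} (hφ : Tst φ) (hs : tsupport φ ⊆ ball a r) :
    ∫ x, u x * FL N α φ x = ∫ x, u x ^ γ * φ x := by
  have hFi := hφ.FL_int hN0 h0 h2
  have hFm := FL_meas (α := α) hφ.1.continuous.measurable
  have hum := memL_aesm hu.2
  have hugm : AEStronglyMeasurable (fun x => u x ^ γ) := (hum.aemeasurable.pow_const γ).aestronglyMeasurable
  obtain ⟨⟨M, hM0, hM⟩, hui⟩ := hu
  have hMg : ∀ z ∈ ball a r, |u z ^ γ| ≤ M ^ γ := by
    intro z hz
    rw [abs_of_nonneg (Real.rpow_nonneg (hpos z) _)]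
    exact Real.rpow_le_rpow (hpos z) (le_of_abs_le (hM z (ball_subset_ball hR.le hz))) hγ.le
  have hi1 := G_prod_int hN0 h0 hN a hr hugm (Real.rpow_pos_of_pos hM0 γ) hMg hFi
  have hi2 := KS_prod_int hN0 h0 h2 hN hr hR ⟨⟨M, hM0, hM⟩, hui⟩ hFi
  have hrep' : ∀ x, (ball a r).indicator u x = (∫ z, KS N α a r x z * u z) - ∫ y, greenBall N α a r x y * u y ^ γ := by
    intro x
    by_cases hx : x ∈ ball a r
    · have h := hrep x hx
      unfold Hball at h
      rw [KS_int hx] at h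
      have e : ∫ y in ball a r, greenBall N α a r x y * u y ^ γ = ∫ y, greenBall N α a r x y * u y ^ γ := by
        rw [← integral_indicator measurableSet_ball]
        congr 1; ext y
        by_cases hy : y ∈ ball a r
        · rw [indicator_of_mem hy]
        · rw [indicator_of_notMem hy, greenBall_zero a hr x hy, zero_mul]
      rw [indicator_of_mem hx, ← h, e]; ring
    · rw [indicator_of_notMem hx]
      simp_rw [KS_out hx, fun y => greenBall_symm (α := α) a r x y, greenBall_zero a hr _ hx]
      simp
  have huF : Integrable (fun x => u x * FL N α φ x) := by
    obtain ⟨C, hC0, hC⟩ := hφ.FL_bound hN0 h0 h2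
    exact memL_mul_int hui hFm.aestronglyMeasurable hC
  have e1 : ∫ x, (ball a r).indicator u x * FL N α φ x = (∫ z, u z * kk N α a r φ z) + ∫ y, u y ^ γ * φ y := by
    calc _ = ∫ x, ((∫ z, KS N α a r x z * u z * FL N α φ x) - ∫ y, greenBall N α a r x y * u y ^ γ * FL N α φ x) := by
          congr 1; ext x
          rw [hrep', integral_mul_const, integral_mul_const, sub_mul]
      _ = (∫ x, ∫ z, KS N α a r x z * u z * FL N α φ x) - ∫ x, ∫ y, greenBall N α a r x y * u y ^ γ * FL N α φ x :=
          integral_sub hi2.integral_prod_left hi1.integral_prod_left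
      _ = (∫ z, ∫ x, KS N α a r x z * u z * FL N α φ x) - ∫ y, ∫ x, greenBall N α a r x y * u y ^ γ * FL N α φ x := by
          have s1 := integral_integral_swap (f := fun x y => greenBall N α a r x y * u y ^ γ * FL N α φ x) hi1
          have s2 := integral_integral_swap (f := fun x z => KS N α a r x z * u z * FL N α φ x) hi2
          beta_reduce at s1 s2
          rw [s1, s2]
      _ = _ := by
          rw [sub_eq_add_neg, ← integral_neg]
          congr 1
          · congr 1; ext z
            have e : (fun x => KS N α a r x z * u z * FL N α φ x) = fun x => KS N α a r x z * FL N α φ x * u z := by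
              ext x; ring
            rw [e, integral_mul_const, mul_comm]; rfl
          · congr 1; ext y
            simp_rw [fun x => mul_right_comm (greenBall N α a r x y)]
            rw [integral_mul_const, G_FL hN0 h0 h2 hN hr hφ hs y]
            ring
  have e2 : ∫ z, u z * kk N α a r φ z = - ∫ z, (ball a r)ᶜ.indicator u z * FL N α φ z := by
    rw [← integral_neg]
    refine integral_congr_ae ?_
    have hsph : ∀ᵐ z : EN N, z ∉ sphere a r := by
      have : (volume : Measure (EN N)) (sphere a r) = 0 := Measure.addHaar_sphere_of_ne_zero _ a hr.ne'
      exact measure_eq_zero_iff_ae_notMem.1 this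
    filter_upwards [kk_ae hN0 h0 h2 hN hr hφ hs, hsph] with z hz hz2
    by_cases hzb : z ∈ ball a r
    · rw [indicator_of_notMem (by simpa using hzb)]
      have : kk N α a r φ z = 0 := by
        unfold kk
        rw [mem_ball, dist_eq_norm] at hzb
        simp_rw [fun x => KS_in (α := α) (a := a) (r := r) x (z := z) (not_lt.2 hzb.le)]
        simp
      rw [this]; simp
    · rw [indicator_of_mem (by exact hzb)]
      have h3 : r < ‖z - a‖ := by
        rw [mem_ball, dist_eq_norm, not_lt] at hzb
        rw [mem_sphere, dist_eq_norm] at hz2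
        exact lt_of_le_of_ne hzb (Ne.symm hz2)
      have := hz h3
      rw [show kk N α a r φ z = - FL N α φ z by linarith]; ring
  have e3 : ∫ x, u x * FL N α φ x = (∫ x, (ball a r).indicator u x * FL N α φ x) + ∫ x, (ball a r)ᶜ.indicator u x * FL N α φ x := by
    have j1 : Integrable (fun x => (ball a r).indicator u x * FL N α φ x) := by
      refine (huF.indicator measurableSet_ball (s := ball a r)).congr (ae_of_all _ fun x => ?_)
      by_cases hx : x ∈ ball a r <;> simp [hx, indicator]
    have j2 : Integrable (fun x => (ball a r)ᶜ.indicator u x * FL N α φ x) := by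
      refine (huF.indicator measurableSet_ball.compl (s := (ball a r)ᶜ)).congr (ae_of_all _ fun x => ?_)
      by_cases hx : x ∈ ball a r <;> simp [hx, indicator]
    rw [← integral_add j1 j2]
    congr 1; ext x
    rw [← add_mul, ← Pi.add_apply, indicator_self_add_compl]
  rw [e3, e1, e2]; ring

lemma exists_adm {N : ℕ} {α : ℝ} {U : Set (EN N)} (hU : IsOpen U) {u : EN N → ℝ} (hcont : ContinuousOn u U) (hmem : memLalpha N α u)
    {a : EN N} {r : ℝ} (hr : 0 < r) (hb : closedBall a r ⊆ U) :
    ∃ R, r < R ∧ closedBall a R ⊆ U ∧ Adm N α a R u := by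
  obtain ⟨δ, hδ, h⟩ := (isCompact_closedBall a r).exists_cthickening_subset_open hU hb
  rw [cthickening_closedBall hδ.le hr.le] at h
  obtain ⟨M, hM⟩ := (isCompact_closedBall a (δ + r)).exists_bound_of_continuousOn (hcont.mono h)
  refine ⟨δ + r, by linarith, h, ⟨max M 1, by positivity, fun z hz => ?_⟩, hmem⟩
  exact (hM z (ball_subset_closedBall hz)).trans (le_max_left _ _)

lemma back_dir {N : ℕ} {α : ℝ} (hN0 : N ≠ 0) (h0 : 0 < α) (h2 : α < 2) (hN : α < N)
    {γ : ℝ} (hγ : 0 < γ) {U : Set (EN N)} (hU : IsOpen U) {u : EN N → ℝ} (hpos : ∀ x, 0 ≤ u x)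
    (hcont : ContinuousOn u U) (hmem : memLalpha N α u)
    (hrep : ∀ (a : EN N) (r : ℝ), 0 < r → closedBall a r ⊆ U → ∀ x ∈ ball a r,
      u x + (∫ y in ball a r, greenBall N α a r x y * u y ^ γ) = Hball N α a r u x)
    {φ : EN N → ℝ} (hφ : Tst φ) (hs : tsupport φ ⊆ U) :
    ∫ x, u x * FL N α φ x = ∫ x, u x ^ γ * φ x := by
  have hloc : ∀ x : EN N, ∃ r, 0 < r ∧ (x ∈ U → closedBall x r ⊆ U) := by
    intro x
    by_cases hx : x ∈ U
    · obtain ⟨r, hr, h⟩ := Metric.nhds_basis_closedBall.mem_iff.1 (hU.mem_nhds hx)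
      exact ⟨r, hr, fun _ => h⟩
    · exact ⟨1, one_pos, fun h => absurd h hx⟩
  choose rad hrad hradU using hloc
  obtain ⟨t, htK, ht⟩ := hφ.2.isCompact.elim_nhds_subcover (fun x => ball x (rad x)) (fun x _ => ball_mem_nhds x (hrad x))
  obtain ⟨f, hf⟩ := SmoothPartitionOfUnity.exists_isSubordinate (modelWithCornersSelf ℝ (EN N)) (isClosed_tsupport φ)
    (fun i : t => ball (i : EN N) (rad i)) (fun i => isOpen_ball) (by
      intro x hx
      obtain ⟨i, hi, hxi⟩ := mem_iUnion₂.1 (ht hx)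
      exact mem_iUnion.2 ⟨⟨i, hi⟩, hxi⟩)
  have hT : ∀ i : t, Tst (fun x => f i x * φ x) := fun i =>
    ⟨(contMDiff_iff_contDiff.1 (f i).contMDiff).mul hφ.1, hφ.2.mul_left⟩
  have hTs : ∀ i : t, tsupport (fun x => f i x * φ x) ⊆ ball (i : EN N) (rad i) := fun i =>
    (tsupport_mul_subset_left).trans (hf i)
  have hsum : φ = fun x => ∑ i ∈ Finset.univ, f i x * φ x := by
    ext x
    by_cases hx : x ∈ tsupport φ
    · have := f.sum_eq_one hx
      rw [finsum_eq_sum_of_fintype] at this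
      rw [← Finset.sum_mul, this, one_mul]
    · rw [image_eq_zero_of_notMem_tsupport hx]; simp
  have hloc : ∀ i : t, ∫ x, u x * FL N α (fun x => f i x * φ x) x = ∫ x, u x ^ γ * (f i x * φ x) := by
    intro i
    have hiU := hradU i (hs (htK i i.2))
    obtain ⟨R, hR, _, hA⟩ := exists_adm hU hcont hmem (hrad i) hiU
    exact local_back hN0 h0 h2 hN (hrad i) hR hγ hpos hA (hrep i _ (hrad i) hiU) (hT i) (hTs i)
  have hFL : ∀ x, FL N α φ x = ∑ i ∈ Finset.univ, FL N α (fun x => f i x * φ x) x := by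
    intro x
    conv_lhs => rw [hsum]
    rw [FL_sum hN0 h0 h2 Finset.univ (fun (i : t) x => f i x * φ x) (fun i _ => hT i)]
  have i1 : ∀ i ∈ (Finset.univ : Finset t), Integrable (fun x => u x * FL N α (fun x => f i x * φ x) x) := by
    intro i _
    obtain ⟨C, hC0, hC⟩ := (hT i).FL_bound hN0 h0 h2
    exact memL_mul_int hmem (FL_meas (α := α) (hT i).1.continuous.measurable).aestronglyMeasurable hC
  have hug : ContinuousOn (fun x => u x ^ γ) U := hcont.rpow_const (fun x _ => Or.inr hγ.le)
  have i2 : ∀ i ∈ (Finset.univ : Finset t), Integrable (fun x => u x ^ γ * (f i x * φ x)) := by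
    intro i _
    have hc : ContinuousOn (fun x => u x ^ γ * (f i x * φ x)) (tsupport φ) :=
      (hug.mono hs).mul (hT i).1.continuous.continuousOn
    have hi := hc.integrableOn_compact (μ := volume) hφ.2.isCompact
    rw [← integrable_indicator_iff (isClosed_tsupport φ).measurableSet] at hi
    refine hi.congr (ae_of_all _ fun x => ?_)
    by_cases hx : x ∈ tsupport φ
    · rw [indicator_of_mem hx]
    · rw [indicator_of_notMem hx]; simp [image_eq_zero_of_notMem_tsupport hx]
  calc _ = ∫ x, ∑ i ∈ Finset.univ, u x * FL N α (fun x => f i x * φ x) x := by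
        congr 1; ext x
        rw [hFL, Finset.mul_sum]
    _ = ∑ i ∈ Finset.univ, ∫ x, u x ^ γ * (f i x * φ x) := by
        rw [integral_finsetSum _ i1]
        exact Finset.sum_congr rfl fun i _ => hloc i
    _ = ∫ x, ∑ i ∈ Finset.univ, u x ^ γ * (f i x * φ x) := (integral_finsetSum _ i2).symm
    _ = _ := by
        congr 1; ext x
        conv_rhs => rw [hsum]
        rw [Finset.mul_sum]

/-- mollifiers -/
def bmp (N : ℕ) (ε : ℝ) (hε : 0 < ε) (n : ℕ) : ContDiffBump (0 : EN N) :=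
  ⟨ε / (n + 2) / 2, ε / (n + 2), by positivity, by
    have : 0 < ε / ((n:ℝ) + 2) := by positivity
    linarith⟩

lemma bmp_tendsto (N : ℕ) (ε : ℝ) (hε : 0 < ε) : Tendsto (fun n => (bmp N ε hε n).rOut) atTop (𝓝 0) := by
  have : Tendsto (fun n : ℕ => ((n : ℝ) + 2)) atTop atTop :=
    tendsto_atTop_add_const_right _ _ tendsto_natCast_atTop_atTop
  exact tendsto_const_nhds.div_atTop this

def mol (N : ℕ) (ε : ℝ) (hε : 0 < ε) (n : ℕ) : EN N → ℝ := (bmp N ε hε n).normed volume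

lemma mol_tst (N : ℕ) (ε : ℝ) (hε : 0 < ε) (n : ℕ) : Tst (mol N ε hε n) :=
  ⟨(bmp N ε hε n).contDiff_normed, (bmp N ε hε n).hasCompactSupport_normed⟩

lemma mol_even (N : ℕ) (ε : ℝ) (hε : 0 < ε) (n : ℕ) (t : EN N) : mol N ε hε n (-t) = mol N ε hε n t :=
  (bmp N ε hε n).normed_neg t

lemma mol_nonneg (N : ℕ) (ε : ℝ) (hε : 0 < ε) (n : ℕ) (t : EN N) : 0 ≤ mol N ε hε n t :=
  (bmp N ε hε n).nonneg_normed t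

lemma mol_integral (N : ℕ) (ε : ℝ) (hε : 0 < ε) (n : ℕ) : ∫ t, mol N ε hε n t = 1 :=
  (bmp N ε hε n).integral_normed

lemma mol_supp (N : ℕ) (ε : ℝ) (hε : 0 < ε) (n : ℕ) : tsupport (mol N ε hε n) ⊆ ball 0 ε := by
  unfold mol
  rw [ContDiffBump.tsupport_normed_eq]
  refine closedBall_subset_ball ?_
  change ε / ((n:ℝ) + 2) < ε
  rw [div_lt_iff₀ (by positivity)]
  have : (0:ℝ) ≤ n := by positivity
  nlinarith

lemma mol_at (N : ℕ) (ε : ℝ) (hε : 0 < ε) {g : EN N → ℝ} (hg : AEStronglyMeasurable g) {x : EN N} (hx : ContinuousAt g x) :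
    Tendsto (fun n => ∫ z, g z * mol N ε hε n (z - x)) atTop (𝓝 (g x)) := by
  have := ContDiffBump.convolution_tendsto_right (μ := volume) (φ := bmp N ε hε) (g := fun _ => g) (k := fun _ => x) (x₀ := x) (z₀ := g x) (l := atTop)
    (bmp_tendsto N ε hε) (Eventually.of_forall fun _ => hg) (hx.tendsto.comp tendsto_snd) tendsto_const_nhds
  refine this.congr fun n => ?_
  rw [convolution_eq_swap]
  congr 1; ext z
  rw [ContinuousLinearMap.lsmul_apply, smul_eq_mul, mul_comm, ← neg_sub z x, (bmp N ε hε n).normed_neg]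
  rfl

lemma mol_ae (N : ℕ) (ε : ℝ) (hε : 0 < ε) {g : EN N → ℝ} (hg : LocallyIntegrable g) :
    ∀ᵐ x, Tendsto (fun n => ∫ z, g z * mol N ε hε n (z - x)) atTop (𝓝 (g x)) := by
  have := ContDiffBump.ae_convolution_tendsto_right_of_locallyIntegrable (μ := volume) (φ := bmp N ε hε) (l := atTop) (K := 2)
    (bmp_tendsto N ε hε) (Eventually.of_forall fun n => by
      change ε / ((n:ℝ) + 2) ≤ 2 * (ε / ((n:ℝ) + 2) / 2); linarith) hg
  filter_upwards [this] with x hx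
  refine hx.congr fun n => ?_
  rw [convolution_eq_swap]
  congr 1; ext z
  rw [ContinuousLinearMap.lsmul_apply, smul_eq_mul, mul_comm, ← neg_sub z x, (bmp N ε hε n).normed_neg]
  rfl

/-- averages are bounded by local bounds -/
lemma mol_bdd (N : ℕ) (ε : ℝ) (hε : 0 < ε) {g : EN N → ℝ} {x : EN N} {M : ℝ} (hM : ∀ z ∈ ball x ε, |g z| ≤ M) (n : ℕ) :
    |∫ z, g z * mol N ε hε n (z - x)| ≤ M := by
  have hT := (mol_tst N ε hε n).trans x
  have h1 := norm_integral_le_of_norm_le (f := fun z => g z * mol N ε hε n (z - x)) (hT.integrable.const_mul M) (ae_of_all _ fun z => by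
    by_cases hz : z ∈ ball x ε
    · rw [norm_mul, Real.norm_of_nonneg (mol_nonneg N ε hε n _)]
      exact mul_le_mul_of_nonneg_right (hM z hz) (mol_nonneg N ε hε n _)
    · rw [supp_zero (mol_supp N ε hε n) (x := z - x) (by rwa [mem_ball_zero_iff, ← dist_eq_norm])]; simp)
  rw [integral_const_mul, integral_sub_right_eq_self (fun t => mol N ε hε n t) x, mol_integral, mul_one] at h1
  exact h1

lemma weight_shift {N : ℕ} {s : ℝ} (hs : 0 < s) {L : ℝ} (hL : 0 ≤ L) {y z : EN N} (hy : ‖y‖ ≤ L) :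
    (1 + ‖z - y‖) ^ (-s) ≤ (1 + L) ^ s * (1 + ‖z‖) ^ (-s) := by
  have h1 : (1 + ‖z‖) ≤ (1 + L) * (1 + ‖z - y‖) := by
    have := norm_add_le (z - y) y
    rw [sub_add_cancel] at this
    nlinarith [norm_nonneg (z - y)]
  have h2 : (1 + ‖z‖) ^ s ≤ (1 + L) ^ s * (1 + ‖z - y‖) ^ s := by
    rw [← Real.mul_rpow (by positivity) (by positivity)]
    exact Real.rpow_le_rpow (by positivity) h1 hs.le
  rw [Real.rpow_neg (by positivity), Real.rpow_neg (by positivity), ← div_eq_mul_inv, le_div_iff₀ (by positivity), inv_mul_le_iff₀ (by positivity), mul_comm]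
  exact h2

lemma Tst.le_weight {N : ℕ} {s : ℝ} (hs : 0 < s) {w : EN N → ℝ} (hw : Tst w) :
    ∃ C, 0 < C ∧ ∀ y, |w y| ≤ C * (1 + ‖y‖) ^ (-s) := by
  obtain ⟨M, hM0, hM⟩ := hw.bdd
  obtain ⟨ρ, hρ1, hρ⟩ := hw.supp
  refine ⟨M * (1 + ρ) ^ s, by positivity, fun y => ?_⟩
  by_cases hy : ρ < ‖y‖
  · rw [hρ y hy, abs_zero]; positivity
  · push Not at hy
    refine (hM y).trans ?_
    rw [mul_assoc]
    refine le_mul_of_one_le_right hM0.le ?_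
    have := weight_shift hs (by linarith) (z := y) hy
    rw [sub_self, norm_zero, add_zero, Real.one_rpow] at this
    exact this

lemma conv_prod_int {N : ℕ} {α : ℝ} (h0 : 0 < α) {u : EN N → ℝ} (hu : Integrable (fun y => u y * (1 + ‖y‖) ^ (-((N:ℝ) + α))))
    {k : EN N → ℝ} (hk : Integrable k) {L : ℝ} (hL : 0 ≤ L) (hkL : ∀ y, L < ‖y‖ → k y = 0)
    {Φ : EN N → ℝ} (hΦ : Measurable Φ) {C : ℝ} (hC0 : 0 < C) (hC : ∀ y, |Φ y| ≤ C * (1 + ‖y‖) ^ (-((N:ℝ) + α))) :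
    Integrable (fun p : EN N × EN N => k p.1 * (u p.2 * Φ (p.2 - p.1))) (volume.prod volume) := by
  have hs : 0 < (N:ℝ) + α := by positivity
  have hum := memL_aesm hu
  refine ((hk.norm.mul_prod hu.norm).const_mul (C * (1 + L) ^ ((N:ℝ) + α))).mono' ?_ (ae_of_all _ fun p => ?_)
  · refine hk.1.comp_fst.mul (hum.comp_snd.mul ?_)
    exact Measurable.aestronglyMeasurable (hΦ.comp (by fun_prop))
  · by_cases hp : L < ‖p.1‖
    · rw [hkL _ hp, zero_mul, norm_zero, zero_mul, mul_zero]
    · push Not at hp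
      have h1 := weight_shift hs hL (z := p.2) hp
      have h2 : ‖Φ (p.2 - p.1)‖ ≤ C * ((1 + L) ^ ((N:ℝ) + α) * (1 + ‖p.2‖) ^ (-((N:ℝ) + α))) :=
        (hC _).trans (mul_le_mul_of_nonneg_left h1 hC0.le)
      have h3 : 0 ≤ ‖k p.1‖ * ‖u p.2‖ := by positivity
      rw [norm_mul, norm_mul, norm_mul, Real.norm_of_nonneg (by positivity : 0 ≤ (1 + ‖p.2‖) ^ (-((N:ℝ) + α)))]
      calc _ = ‖k p.1‖ * ‖u p.2‖ * ‖Φ (p.2 - p.1)‖ := by ring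
        _ ≤ ‖k p.1‖ * ‖u p.2‖ * (C * ((1 + L) ^ ((N:ℝ) + α) * (1 + ‖p.2‖) ^ (-((N:ℝ) + α)))) := mul_le_mul_of_nonneg_left h2 h3
        _ = _ := by ring

lemma tsupport_trans {N : ℕ} (w : EN N → ℝ) (y : EN N) {ε : ℝ} (h : tsupport w ⊆ ball 0 ε) :
    tsupport (fun t => w (t - y)) ⊆ ball y ε := by
  have : tsupport (fun t => w (t - y)) ⊆ (fun t => t - y) ⁻¹' tsupport w := by
    refine closure_minimal (fun t ht => subset_tsupport _ ht) ((isClosed_tsupport w).preimage (by fun_prop))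
  intro t ht
  have := h (this ht)
  rwa [mem_ball_zero_iff, ← dist_eq_norm] at this

lemma one_adm {N : ℕ} {α : ℝ} (h0 : 0 < α) (a : EN N) (R : ℝ) : Adm N α a R (fun _ => 1) :=
  ⟨⟨1, one_pos, fun z _ => by simp⟩, by simpa using weight_int (N := N) h0⟩

/-- smoothed representation -/
lemma smooth_rep {N : ℕ} {α : ℝ} (hN0 : N ≠ 0) (h0 : 0 < α) (h2 : α < 2) (hN : α < N)
    {γ : ℝ} {U : Set (EN N)} {u : EN N → ℝ} (hmem : memLalpha N α u)
    (hsol : ∀ φ : EN N → ℝ, Tst φ → tsupport φ ⊆ U → (∀ x, 0 ≤ φ x) → ∫ x, u x * FL N α φ x = ∫ x, u x ^ γ * φ x)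
    {a : EN N} {r ε : ℝ} (hr : 0 < r) (hε : 0 < ε) (hb : ball a (r + ε) ⊆ U) {x : EN N} (hx : x ∈ ball a r) (n : ℕ) :
    ∫ z, u z * (∫ y, KS N α a r x y * mol N ε hε n (y - z)) =
      (∫ z, u z * mol N ε hε n (z - x)) + ∫ y, greenBall N α a r x y * ∫ z, u z ^ γ * mol N ε hε n (z - y) := by
  set ρ := mol N ε hε n with hρ
  have hT : Tst ρ := mol_tst N ε hε n
  have hev : ∀ t, ρ (-t) = ρ t := mol_even N ε hε n
  obtain ⟨C, hC0, hC⟩ := hT.FL_bound hN0 h0 h2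
  have hFm := FL_meas (α := α) hT.1.continuous.measurable
  have hI := conv_prod_int h0 hmem (green_bdd_int hN0 h0 hN a hr x) (L := ‖a‖ + r) (by positivity) (fun y hy => by
    refine greenBall_zero a hr x fun h => ?_
    rw [mem_ball, dist_eq_norm] at h
    have := norm_add_le (y - a) a
    rw [sub_add_cancel] at this
    linarith) hFm hC0 hC
  have sw := integral_integral_swap (f := fun y z => greenBall N α a r x y * (u z * FL N α ρ (z - y))) hI
  beta_reduce at sw
  have e1 : ∀ y, ∫ z, greenBall N α a r x y * (u z * FL N α ρ (z - y)) = greenBall N α a r x y * ∫ z, u z ^ γ * ρ (z - y) := by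
    intro y
    rw [integral_const_mul]
    by_cases hy : y ∈ ball a r
    · congr 1
      have := hsol (fun t => ρ (t - y)) (hT.trans y) ((tsupport_trans ρ y (mol_supp N ε hε n)).trans
        ((ball_subset (by rw [mem_ball] at hy; linarith)).trans hb)) (fun t => mol_nonneg N ε hε n _)
      simp_rw [FL_trans] at this
      exact this
    · rw [greenBall_zero a hr x hy, zero_mul, zero_mul]
  have e2 : ∀ z, ∫ y, greenBall N α a r x y * (u z * FL N α ρ (z - y)) = u z * (∫ y, KS N α a r x y * ρ (y - z)) - u z * ρ (z - x) := by
    intro z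
    have h := star' hN0 h0 h2 hN (hT.trans z) hr hx
    simp_rw [FL_trans] at h
    have e : (fun y => greenBall N α a r x y * (u z * FL N α ρ (z - y))) = fun y => u z * (greenBall N α a r x y * FL N α ρ (y - z)) := by
      ext y
      rw [← neg_sub y z, FL_even hev]; ring
    rw [e, integral_const_mul, ← h, ← neg_sub x z, hev]; ring
  have i3 : Integrable (fun z => u z * ρ (z - x)) := by
    obtain ⟨C', _, hC'⟩ := (hT.trans x).le_weight (s := (N:ℝ) + α) (by positivity)
    exact memL_mul_int hmem (hT.trans x).1.continuous.aestronglyMeasurable hC'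
  have i4 := hI.integral_prod_right
  dsimp only at i4
  simp_rw [e2] at i4
  have i5 : Integrable (fun z => u z * (∫ y, KS N α a r x y * ρ (y - z))) := by
    refine (i4.add i3).congr (ae_of_all _ fun z => ?_)
    simp
  simp_rw [e1, e2] at sw
  rw [integral_sub i5 i3] at sw
  linarith

lemma fwd_dir {N : ℕ} {α : ℝ} (hN0 : N ≠ 0) (h0 : 0 < α) (h2 : α < 2) (hN : α < N)
    {γ : ℝ} (hγ : 0 < γ) {U : Set (EN N)} (hU : IsOpen U) {u : EN N → ℝ} (hpos : ∀ x, 0 ≤ u x)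
    (hcont : ContinuousOn u U) (hmem : memLalpha N α u)
    (hsol : ∀ φ : EN N → ℝ, Tst φ → tsupport φ ⊆ U → (∀ x, 0 ≤ φ x) → ∫ x, u x * FL N α φ x = ∫ x, u x ^ γ * φ x)
    {a : EN N} {r : ℝ} (hr : 0 < r) (hb : closedBall a r ⊆ U) {x : EN N} (hx : x ∈ ball a r) :
    u x + (∫ y, greenBall N α a r x y * u y ^ γ) = ∫ z, KS N α a r x z * u z := by
  obtain ⟨R, hR, hRU, hA⟩ := exists_adm hU hcont hmem hr hb
  have hs : 0 < (N:ℝ) + α := by positivity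
  have hum := memL_aesm hmem
  have hugm : AEStronglyMeasurable (fun x => u x ^ γ) := (hum.aemeasurable.pow_const γ).aestronglyMeasurable
  set ε : ℝ := min ((R - r) / 2) 1 with hεd
  have hε : 0 < ε := lt_min (by linarith) one_pos
  have hε1 : ε ≤ 1 := min_le_right _ _
  have hε2 : ε ≤ (R - r) / 2 := min_le_left _ _
  set R1 : ℝ := (r + R) / 2 with hR1
  have hrR1 : r < R1 := by rw [hR1]; linarith
  have hR1R : R1 + ε ≤ R := by rw [hR1]; linarith
  clear_value ε R1
  have hKx := KS_integrable hN0 h0 h2 hN hr hR (one_adm h0 a R) x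
  simp only [mul_one] at hKx
  have hKu := KS_integrable hN0 h0 h2 hN hr hR hA x
  obtain ⟨⟨M, hM0, hM⟩, _⟩ := hA
  have hbR : ball a R ⊆ U := ball_subset_closedBall.trans hRU
  have hcu : ∀ y ∈ ball a R, ContinuousAt u y := fun y hy => hcont.continuousAt (hU.mem_nhds (hbR hy))
  set k1 : EN N → ℝ := (ball a R1).indicator (KS N α a r x) with hk1
  set k2 : EN N → ℝ := (ball a R1)ᶜ.indicator (KS N α a r x) with hk2
  have hk12 : ∀ y, KS N α a r x y = k1 y + k2 y := fun y => by
    rw [hk1, hk2, ← Pi.add_apply, indicator_self_add_compl]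
  have hk1i : Integrable k1 := hKx.indicator measurableSet_ball
  have hk2i : Integrable k2 := hKx.indicator measurableSet_ball.compl
  have hk2m : Measurable k2 := (KS_meas_right N α a r x).indicator measurableSet_ball.compl
  have hk1u : Integrable (fun y => k1 y * u y) := by
    refine (hKu.indicator (measurableSet_ball (x := a) (ε := R1))).congr (ae_of_all _ fun y => ?_)
    by_cases hy : y ∈ ball a R1 <;> simp [hk1, hy, indicator]
  have hk2u : Integrable (fun y => k2 y * u y) := by
    refine (hKu.indicator (measurableSet_ball (x := a) (ε := R1)).compl).congr (ae_of_all _ fun y => ?_)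
    by_cases hy : y ∈ ball a R1 <;> simp [hk2, hy, indicator]
  obtain ⟨C, hC0, hC⟩ := poisson_far h0 h2 hN a hr hrR1
  have hk2b : ∀ y, |k2 y| ≤ C * (1 + ‖y‖) ^ (-((N:ℝ) + α)) := by
    intro y
    by_cases hy : y ∈ ball a R1
    · rw [hk2, indicator_of_notMem (by simpa using hy), abs_zero]; positivity
    · rw [hk2, indicator_of_mem (by exact hy), abs_of_nonneg (KS_nonneg h0 h2 hN hr x y)]
      rw [mem_ball, dist_eq_norm, not_lt] at hy
      rw [KS_eq hx (hrR1.trans_le hy)]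
      exact hC x hx y hy
  set ρ : ℕ → EN N → ℝ := fun n => mol N ε hε n with hρ
  have hT : ∀ n, Tst (ρ n) := mol_tst N ε hε
  set A2 : ℕ → EN N → ℝ := fun n z => ∫ y, k2 y * ρ n (y - z) with hA2
  have hA2b : ∀ n z, |A2 n z| ≤ C * (1 + 1) ^ ((N:ℝ) + α) * (1 + ‖z‖) ^ (-((N:ℝ) + α)) := by
    intro n z
    refine mol_bdd N ε hε (fun y hy => (hk2b y).trans ?_) n
    rw [mul_assoc]
    refine mul_le_mul_of_nonneg_left ?_ hC0.le
    have hyz : ‖z - y‖ ≤ 1 := by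
      rw [mem_ball', dist_eq_norm] at hy; linarith
    have := weight_shift hs zero_le_one (z := z) hyz
    rwa [sub_sub_cancel] at this
  have hA2m : ∀ n, AEStronglyMeasurable (A2 n) := by
    intro n
    have hm : Measurable (fun p : EN N × EN N => k2 p.2 * ρ n (p.2 - p.1)) := by
      have := (hT n).1.continuous.measurable
      exact (hk2m.comp measurable_snd).mul (this.comp (by fun_prop))
    exact (hm.stronglyMeasurable.integral_prod_right').aestronglyMeasurable
  have hA2i : ∀ n, Integrable (fun z => u z * A2 n z) := fun n => memL_mul_int hmem (hA2m n) (hA2b n)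
  have hI1 : ∀ n, Integrable (fun p : EN N × EN N => k1 p.1 * (u p.2 * ρ n (p.2 - p.1))) (volume.prod volume) := by
    intro n
    obtain ⟨C', hC'0, hC'⟩ := (hT n).le_weight hs
    refine conv_prod_int h0 hmem hk1i (L := ‖a‖ + R1) (by have := norm_nonneg a; linarith) (fun y hy => ?_) (hT n).1.continuous.measurable hC'0 hC'
    refine indicator_of_notMem (fun h => ?_) _
    rw [mem_ball, dist_eq_norm] at h
    have := norm_add_le (y - a) a
    rw [sub_add_cancel] at this
    linarith
  have hev : ∀ n y z, ρ n (z - y) = ρ n (y - z) := fun n y z => by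
    rw [← neg_sub y z]; exact mol_even N ε hε n _
  have hid : ∀ n, (∫ y, k1 y * ∫ z, u z * ρ n (z - y)) + ∫ z, u z * A2 n z =
      (∫ z, u z * ρ n (z - x)) + ∫ y, greenBall N α a r x y * ∫ z, u z ^ γ * ρ n (z - y) := by
    intro n
    have hsm := smooth_rep hN0 h0 h2 hN hmem hsol hr hε ((ball_subset_ball (by linarith)).trans hbR) hx n
    refine Eq.trans ?_ hsm
    have sw := integral_integral_swap (f := fun y z => k1 y * (u z * ρ n (z - y))) (hI1 n)
    beta_reduce at sw
    simp_rw [integral_const_mul] at sw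
    have i1 := (hI1 n).integral_prod_right
    dsimp only at i1
    rw [sw, ← integral_add i1 (hA2i n)]
    congr 1; ext z
    have e : (fun y => k1 y * (u z * ρ n (z - y))) = fun y => u z * (k1 y * ρ n (y - z)) := by
      ext y; rw [hev]; ring
    rw [e, integral_const_mul, ← mul_add]
    congr 1
    obtain ⟨B, hB0, hB⟩ := ((hT n).trans z).bdd
    have j : ∀ k : EN N → ℝ, Integrable k → Integrable (fun y => k y * ρ n (y - z)) := fun k hk =>
      hk.mul_bdd (c := B) ((hT n).trans z).1.continuous.aestronglyMeasurable (ae_of_all _ hB)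
    rw [hA2, ← integral_add (j _ hk1i) (j _ hk2i)]
    congr 1; ext y
    rw [hk12 y, add_mul]
  -- limits
  have T1 : Tendsto (fun n => ∫ y, k1 y * ∫ z, u z * ρ n (z - y)) atTop (𝓝 (∫ y, k1 y * u y)) := by
    refine tendsto_integral_of_dominated_convergence (fun y => M * ‖k1 y‖) (fun n => ?_) (hk1i.norm.const_mul M) (fun n => ae_of_all _ fun y => ?_) (ae_of_all _ fun y => ?_)
    · have := (hI1 n).integral_prod_left.1
      dsimp only at this
      simp_rw [integral_const_mul] at this
      exact this
    · by_cases hy : y ∈ ball a R1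
      · rw [norm_mul, mul_comm]
        refine mul_le_mul_of_nonneg_right ?_ (norm_nonneg _)
        refine mol_bdd N ε hε (fun z hz => hM z ?_) n
        exact ball_subset (by rw [mem_ball] at hy; linarith) hz
      · rw [hk1, indicator_of_notMem hy]; simp
    · by_cases hy : y ∈ ball a R1
      · exact (mol_at N ε hε hum (hcu y (ball_subset_ball (by linarith) hy))).const_mul _
      · rw [hk1, indicator_of_notMem hy]; simp
  have T2 : Tendsto (fun n => ∫ z, u z * A2 n z) atTop (𝓝 (∫ z, u z * k2 z)) := by
    refine tendsto_integral_of_dominated_convergence (fun y => C * (1 + 1) ^ ((N:ℝ) + α) * ‖u y * (1 + ‖y‖) ^ (-((N:ℝ) + α))‖) (fun n => (hA2i n).1) (hmem.norm.const_mul _) (fun n => ae_of_all _ fun y => ?_) ?_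
    · rw [norm_mul, norm_mul, Real.norm_of_nonneg (by positivity : 0 ≤ (1 + ‖y‖) ^ (-((N:ℝ) + α))), mul_left_comm]
      exact mul_le_mul_of_nonneg_left (hA2b n y) (norm_nonneg _)
    · filter_upwards [mol_ae N ε hε hk2i.locallyIntegrable] with z hz
      exact hz.const_mul _
  have T3 : Tendsto (fun n => ∫ z, u z * ρ n (z - x)) atTop (𝓝 (u x)) :=
    mol_at N ε hε hum (hcu x (ball_subset_ball hR.le hx))
  have T4 : Tendsto (fun n => ∫ y, greenBall N α a r x y * ∫ z, u z ^ γ * ρ n (z - y)) atTop (𝓝 (∫ y, greenBall N α a r x y * u y ^ γ)) := by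
    have hGi := green_bdd_int hN0 h0 hN a hr x
    refine tendsto_integral_of_dominated_convergence (fun y => M ^ γ * ‖greenBall N α a r x y‖) (fun n => ?_) (hGi.norm.const_mul _) (fun n => ae_of_all _ fun y => ?_) (ae_of_all _ fun y => ?_)
    · refine hGi.1.mul ?_
      have hm : AEStronglyMeasurable (fun p : EN N × EN N => u p.2 ^ γ * ρ n (p.2 - p.1)) (volume.prod volume) := by
        have := (hT n).1.continuous
        exact hugm.comp_snd.mul (Continuous.aestronglyMeasurable (by fun_prop))
      exact hm.integral_prod_right'
    · by_cases hy : y ∈ ball a r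
      · rw [norm_mul, mul_comm]
        refine mul_le_mul_of_nonneg_right ?_ (norm_nonneg _)
        refine mol_bdd N ε hε (fun z hz => ?_) n
        rw [abs_of_nonneg (Real.rpow_nonneg (hpos z) _)]
        refine Real.rpow_le_rpow (hpos z) (le_of_abs_le (hM z ?_)) hγ.le
        exact ball_subset (by rw [mem_ball] at hy; linarith) hz
      · rw [greenBall_zero a hr x hy]; simp
    · by_cases hy : y ∈ ball a r
      · exact (mol_at N ε hε hugm ((hcu y (ball_subset_ball hR.le hy)).rpow_const (Or.inr hγ.le))).const_mul _
      · simp_rw [greenBall_zero a hr x hy]; simp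
  have hL := T1.add T2
  simp_rw [hid] at hL
  have := tendsto_nhds_unique hL (T3.add T4)
  rw [← this]
  have hk2u' : Integrable (fun y => u y * k2 y) := hk2u.congr (ae_of_all _ fun y => mul_comm _ _)
  rw [← integral_add hk1u hk2u']
  congr 1; ext y
  rw [hk12 y]; ring

lemma statement_aux (N : ℕ) (hN : 3 ≤ N) (α : ℝ) (hα0 : 0 < α) (hα2 : α < 2) (γ : ℝ) (hγ : 0 < γ)
    (U : Set (EN N)) (hU : IsOpen U) (u : EN N → ℝ) (hpos : ∀ x, 0 ≤ u x) (hcont : ContinuousOn u U) (hmem : memLalpha N α u) :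
    (∀ φ : EN N → ℝ, ContDiff ℝ (⊤ : ℕ∞) φ → HasCompactSupport φ → tsupport φ ⊆ U → (∀ x, 0 ≤ φ x) →
      ∫ x, u x * fracLap N α φ x = ∫ x, u x ^ γ * φ x) ↔
    (∀ (a : EN N) (r : ℝ), 0 < r → closedBall a r ⊆ U → ∀ x ∈ ball a r,
      u x + (∫ y in ball a r, greenBall N α a r x y * u y ^ γ) = Hball N α a r u x) := by
  have hN0 : N ≠ 0 := by omega
  have hN' : α < N := by
    have : (3:ℝ) ≤ N := by exact_mod_cast hN
    linarith
  constructor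
  · intro h a r hr hb x hx
    have := fwd_dir hN0 hα0 hα2 hN' hγ hU hpos hcont hmem (fun φ hφ hs hp => by
      have := h φ hφ.1 hφ.2 hs hp
      simp_rw [hφ.fracLap_eq hN0 hα0 hα2] at this
      exact this) hr hb hx
    unfold Hball
    rw [KS_int hx, ← this]
    congr 1
    rw [← integral_indicator measurableSet_ball]
    congr 1; ext y
    by_cases hy : y ∈ ball a r
    · rw [indicator_of_mem hy]
    · rw [indicator_of_notMem hy, greenBall_zero a hr x hy, zero_mul]
  · intro h φ h1 h2 hs hp
    have hφ : Tst φ := ⟨h1, h2⟩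
    simp_rw [hφ.fracLap_eq hN0 hα0 hα2]
    exact back_dir hN0 hα0 hα2 hN' hγ hU hpos hcont hmem h hφ hs

end Helpers

/-- characterization of solutions via the Green operator and harmonic measure of
balls. -/
theorem statement_5 (N : ℕ) (hN : 3 ≤ N) (α : ℝ) (hα0 : 0 < α) (hα2 : α < 2)
    (γ : ℝ) (hγ : 0 < γ) (U : Set (EN N)) (hU : IsOpen U)
    (u : EN N → ℝ) (hpos : ∀ x, 0 ≤ u x) (hcont : ContinuousOn u U)
    (hmem : memLalpha N α u) :
    ((∀ φ : EN N → ℝ, ContDiff ℝ (⊤ : ℕ∞) φ → HasCompactSupport φ → tsupport φ ⊆ U →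
        (∀ x, 0 ≤ φ x) →
        ∫ x, u x * fracLap N α φ x = ∫ x, u x ^ γ * φ x) ↔
      (∀ (a : EN N) (r : ℝ), 0 < r → Metric.closedBall a r ⊆ U →
        ∀ x ∈ Metric.ball a r,
          u x + (∫ y in Metric.ball a r, greenBall N α a r x y * u y ^ γ) =
            Hball N α a r u x)) := by
  exact statement_aux N hN α hα0 hα2 γ hγ U hU u hpos hcont hmem

end
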